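/- Let f be a strictly non-real meromorphic function in the complex plane such that all but finitely many zeros and poles of f and of f'' are real. Then, as r → ∞, the integrated counting functions satisfy N̄(r, f) + N̄(r, 1/f) = O(r), and the Nevanlinna characteristic satisfies T(r, f'/f) = O(r log r). -/

import Mathlib

open Complex Filter Topology MeasureTheory
open scoped Classical

noncomputable section

/-- `mtilde f` is the function `z ↦ conj (f (conj z))`, denoted `f̃` in the paper. -/
def mtilde (f : ℂ → ℂ) : ℂ → ℂ := fun z => (starRingEnd ℂ) (f ((starRingEnd ℂ) z))

/-- Equality of meromorphic functions: near every point of `ℂ`, the two functions agree on a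
punctured neighbourhood (so the set where they disagree is closed and discrete). -/
def MeroEq (h₁ h₂ : ℂ → ℂ) : Prop := ∀ z : ℂ, ∀ᶠ w in 𝓝[≠] z, h₁ w = h₂ w

/-- `f` is strictly non-real: `f̃` is not a constant multiple of `f`. -/
def StrictlyNonReal (f : ℂ → ℂ) : Prop := ¬ ∃ c : ℂ, MeroEq (mtilde f) (fun z => c * f z)

/-- A rational function, as a meromorphic function on `ℂ`. -/
def IsRatFn (h : ℂ → ℂ) : Prop :=
  ∃ p q : Polynomial ℂ, q ≠ 0 ∧ MeroEq h (fun z => p.eval z / q.eval z)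

/-- The order of vanishing (negative at a pole) of a function at a point, when the function is
meromorphic there; junk value `0` otherwise. -/
def meroOrder (h : ℂ → ℂ) (z : ℂ) : WithTop ℤ :=
  if hh : MeromorphicAt h z then meromorphicOrderAt h z else 0

/-- The positive part of the logarithm. -/
def logPlus (x : ℝ) : ℝ := max (Real.log x) 0

/-- The Nevanlinna proximity function `m(r, h)`. -/
def proximity (h : ℂ → ℂ) (r : ℝ) : ℝ :=
  (2 * Real.pi)⁻¹ * ∫ θ in (0:ℝ)..(2 * Real.pi),
    logPlus (‖h ((r : ℂ) * Complex.exp (θ * Complex.I))‖)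

/-- The multiplicity of a pole of `h` at `z` (0 if not a pole). -/
def poleMult (h : ℂ → ℂ) (z : ℂ) : ℕ := (-((meroOrder h z).untopD 0)).toNat

/-- The number of poles, counted with multiplicity, in the closed disc of radius `t`. -/
def poleCount (h : ℂ → ℂ) (t : ℝ) : ℝ := ∑ᶠ z ∈ Metric.closedBall (0:ℂ) t, (poleMult h z : ℝ)

/-- The integrated counting function `N(r, h)` of the poles of `h` (with multiplicity). -/
def NCount (h : ℂ → ℂ) (r : ℝ) : ℝ := ∫ t in (1:ℝ)..r, poleCount h t / t

/-- The Nevanlinna characteristic `T(r, h) = m(r, h) + N(r, h)`. -/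
def TChar (h : ℂ → ℂ) (r : ℝ) : ℝ := proximity h r + NCount h r

/-- The number of points of `S` in the closed disc of radius `t`. -/
def distinctCount (S : Set ℂ) (t : ℝ) : ℝ := (S ∩ Metric.closedBall (0:ℂ) t).ncard

/-- The integrated counting function `N̄(r, h)` of the distinct poles of `h`. -/
def NbarPoles (h : ℂ → ℂ) (r : ℝ) : ℝ :=
  ∫ t in (1:ℝ)..r, distinctCount {z | meroOrder h z < 0} t / t

/-- The integrated counting function `N̄(r, 1/h)` of the distinct zeros of `h`. -/
def NbarZeros (h : ℂ → ℂ) (r : ℝ) : ℝ :=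
  ∫ t in (1:ℝ)..r, distinctCount {z | 0 < meroOrder h z} t / t

/-- `h` has finite (Nevanlinna) order: `T(r, h) ≤ r ^ C` for all large `r`. -/
def FiniteOrder (h : ℂ → ℂ) : Prop := ∃ C : ℝ, ∀ᶠ r in atTop, TChar h r ≤ r ^ C

/-- `h` has finite lower order: `T(r, h) ≤ r ^ C` for arbitrarily large `r`. -/
def FiniteLowerOrder (h : ℂ → ℂ) : Prop := ∃ C : ℝ, ∃ᶠ r in atTop, TChar h r ≤ r ^ C

/-- The Setup of Section 3 of the paper: `M ≥ 4` and `f` is a strictly non-real meromorphic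
function in the plane such that `f, f', …, f^(M+3)` all have finitely many non-real zeros. -/
def Setup (M : ℕ) (f : ℂ → ℂ) : Prop :=
  4 ≤ M ∧ (∀ z, MeromorphicAt f z) ∧ StrictlyNonReal f ∧
    ∀ m, m ≤ M + 3 → {z : ℂ | 0 < meroOrder (iteratedDeriv m f) z ∧ z.im ≠ 0}.Finite

/-- The function `F_m(z) = z - f^(m)(z) / f^(m+1)(z)`. -/
def Fm (f : ℂ → ℂ) (m : ℕ) : ℂ → ℂ :=
  fun z => z - iteratedDeriv m f z / iteratedDeriv (m + 1) f z

/-- `Km` is the meromorphic function with finitely many zeros and poles satisfying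
`F_m' = K_m G_m'`, where `G_m` is the analogue of `F_m` for `g = f̃`. -/
def IsKm (f : ℂ → ℂ) (m : ℕ) (Km : ℂ → ℂ) : Prop :=
  (∀ z, MeromorphicAt Km z) ∧ {z | 0 < meroOrder Km z}.Finite ∧
    {z | meroOrder Km z < 0}.Finite ∧
    MeroEq (deriv (Fm f m)) (fun z => Km z * deriv (Fm (mtilde f) m) z)

end

open Complex Filter Topology MeasureTheory
open scoped Classical

namespace NV
open Metric Real

lemma avg_mono_cod {φ ψ : ℂ → ℝ} {c : ℂ} {R : ℝ} (hR : R ≠ 0) (hφ : CircleIntegrable φ c R)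
    (hψ : CircleIntegrable ψ c R)
    (h : ∀ᶠ z in codiscreteWithin (sphere c |R|), φ z ≤ ψ z) :
    circleAverage φ c R ≤ circleAverage ψ c R := by
  have e : φ =ᶠ[codiscreteWithin (sphere c |R|)] (fun z => min (φ z) (ψ z)) := by
    filter_upwards [h] with z hz
    simp [hz]
  rw [circleAverage_congr_codiscreteWithin e hR]
  exact circleAverage_mono (hφ.congr_codiscreteWithin e) hψ (fun z _ => min_le_right _ _)

/-- Pointwise bound for zero-free functions. -/
lemma zf_log_bound {g : ℂ → ℂ} {R r M : ℝ} (hg : AnalyticOnNhd ℂ g (closedBall 0 R))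
    (hg0 : ∀ z ∈ closedBall (0:ℂ) R, g z ≠ 0) (hr : 0 ≤ r) (hrR : r < R)
    (hM : circleAverage (fun z => |Real.log ‖g z‖|) 0 R ≤ M) {w : ℂ} (hw : ‖w‖ ≤ r) :
    |Real.log ‖g w‖| ≤ (R + r) / (R - r) * M := by
  have hRpos : 0 < R := lt_of_le_of_lt hr hrR
  have hharm : InnerProductSpace.HarmonicOnNhd (fun z => Real.log ‖g z‖) (closedBall 0 R) :=
    fun x hx ↦ (hg x hx).harmonicAt_log_norm (hg0 x hx)
  have hwb : w ∈ ball (0:ℂ) R := by simp; linarith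
  have h1 := InnerProductSpace.HarmonicOnNhd.circleAverage_re_herglotzRieszKernel_smul hharm hwb
  have hcont : ContinuousOn (fun z => Real.log ‖g z‖) (closedBall 0 R) := by
    intro z hz
    have := (hg z hz).continuousAt
    have h2 : ‖g z‖ ≠ 0 := by simpa using hg0 z hz
    exact (this.norm.log h2).continuousWithinAt
  have hs : sphere (0:ℂ) R ⊆ closedBall 0 R := sphere_subset_closedBall
  have hI : CircleIntegrable (fun z => |Real.log ‖g z‖|) 0 R :=
    (hcont.mono hs).abs.circleIntegrable hRpos.le
  rw [← h1]
  refine (abs_circleAverage_le_circleAverage_abs).trans ?_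
  have h3 : circleAverage (fun z => (R + r) / (R - r) * |Real.log ‖g z‖|) 0 R =
      (R + r) / (R - r) * circleAverage (fun z => |Real.log ‖g z‖|) 0 R := by
    have := circleAverage_fun_smul (a := (R + r) / (R - r)) (f := fun z => |Real.log ‖g z‖|) (c := 0) (R := R)
    simpa using this
  have hq : 0 ≤ (R + r) / (R - r) := by
    apply div_nonneg <;> linarith
  refine le_trans ?_ (mul_le_mul_of_nonneg_left hM hq)
  rw [← h3]
  have hcontK : ContinuousOn (re ∘ herglotzRieszKernel 0 w) (sphere 0 R) := by
    have : ∀ z ∈ sphere (0:ℂ) R, z - w ≠ 0 := by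
      intro z hz h
      have : z = w := by linear_combination h
      subst this
      simp at hz hwb; linarith
    rw [herglotzRieszKernel_fun_def]
    simp only [sub_zero]
    refine Complex.continuous_re.comp_continuousOn ?_
    refine ContinuousOn.div (by fun_prop) (by fun_prop) this
  apply circleAverage_mono
  · exact ((hcontK.smul (hcont.mono hs)).abs).circleIntegrable hRpos.le
  · exact (continuousOn_const.mul (hcont.mono hs).abs).circleIntegrable hRpos.le
  · intro z hz
    rw [abs_of_pos hRpos] at hz
    have ha := re_herglotzRieszKernel_le hz hwb
    have hb := le_re_herglotzRieszKernel hz hwb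
    simp only [sub_zero] at ha hb
    change |(herglotzRieszKernel 0 w z).re * Real.log ‖g z‖| ≤ _
    rw [abs_mul, herglotzRieszKernel_def, sub_zero, sub_zero]
    gcongr
    rw [abs_le]
    have hh : (R + ‖w‖) / (R - ‖w‖) ≤ (R + r) / (R - r) := by
      gcongr
    constructor
    · refine le_trans ?_ hb
      have : 0 ≤ (R - ‖w‖) / (R + ‖w‖) := by
        apply div_nonneg <;> [linarith; positivity]
      linarith
    · exact ha.trans hh

lemma zf_deriv_bound {g : ℂ → ℂ} {R r M : ℝ} (hg : AnalyticOnNhd ℂ g (closedBall 0 R))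
    (hg0 : ∀ z ∈ closedBall (0:ℂ) R, g z ≠ 0) (hr : 0 ≤ r) (hrR : r < R)
    (hM : circleAverage (fun z => |Real.log ‖g z‖|) 0 R ≤ M) {w : ℂ} (hw : ‖w‖ ≤ r) :
    ‖deriv g w / g w‖ ≤ 256 * R ^ 2 * (M + 1) / (R - r) ^ 3 := by
  have hRpos : 0 < R := lt_of_le_of_lt hr hrR
  have hM0 : 0 ≤ M := le_trans (circleAverage_nonneg_of_nonneg (fun z _ => abs_nonneg _)) hM
  -- logarithm
  have hd : DifferentiableOn ℂ (fun z => deriv g z / g z) (ball 0 R) := by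
    intro z hz
    have hz' := ball_subset_closedBall hz
    exact ((hg z hz').deriv.differentiableAt.div (hg z hz').differentiableAt (hg0 z hz')).differentiableWithinAt
  obtain ⟨G, hG⟩ := hd.isExactOn_ball
  have hconst : ∀ z ∈ ball (0:ℂ) R, Real.log ‖g z‖ = (G z).re - (G 0).re + Real.log ‖g 0‖ := by
    have hF : ∀ z ∈ ball (0:ℂ) R, HasDerivAt (fun z => g z * Complex.exp (-G z)) 0 z := by
      intro z hz
      have h1 := (hg z (ball_subset_closedBall hz)).differentiableAt.hasDerivAt
      have h2 := (hG z hz).neg.cexp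
      refine (h1.mul h2).congr_deriv ?_
      have := hg0 z (ball_subset_closedBall hz)
      field_simp
      simp
    intro z hz
    have h0 : (0:ℂ) ∈ ball (0:ℂ) R := by simpa using hRpos
    have heq : g z * Complex.exp (-G z) = g 0 * Complex.exp (-G 0) := by
      refine (convex_ball (0:ℂ) R).is_const_of_fderivWithin_eq_zero (𝕜 := ℂ)
        (f := fun z => g z * Complex.exp (-G z)) ?_ ?_ hz h0
      · intro x hx; exact (hF x hx).differentiableAt.differentiableWithinAt
      · intro x hx
        rw [fderivWithin_of_isOpen isOpen_ball hx]
        ext; simp [(hF x hx).hasFDerivAt.fderiv]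
    have hn := congrArg (fun x => Real.log ‖x‖) heq
    have a1 : ‖g z‖ ≠ 0 := by simpa using hg0 z (ball_subset_closedBall hz)
    have a2 : ‖g 0‖ ≠ 0 := by simpa using hg0 0 (ball_subset_closedBall h0)
    simp only [norm_mul, Complex.norm_exp] at hn
    rw [Real.log_mul a1 (by positivity), Real.log_mul a2 (by positivity), Real.log_exp, Real.log_exp] at hn
    simp at hn; linarith
  set s := (R - r) / 4 with hs
  have hspos : 0 < s := by rw [hs]; linarith
  set r2 := r + 2 * s
  set r1 := r + s
  have hr2R : r2 < R := by simp only [r2, hs]; linarith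
  set M1 := R * (M + 1) / s with hM1
  have hM1pos : 0 < M1 := by positivity
  have hbd : ∀ z, ‖z‖ ≤ r2 → |Real.log ‖g z‖| ≤ M1 := by
    intro z hz
    have := zf_log_bound hg hg0 (by positivity : 0 ≤ r2) hr2R hM hz
    refine this.trans ?_
    have e1 : R - r2 = 2 * s := by simp only [r2, hs]; ring
    rw [e1, hM1]
    rw [div_mul_eq_mul_div, div_le_div_iff₀ (by positivity) hspos]
    nlinarith [mul_nonneg hspos.le hM0, mul_nonneg hspos.le hRpos.le, mul_nonneg (mul_nonneg hspos.le hM0) hRpos.le, mul_nonneg (mul_nonneg hspos.le hM0) (sub_nonneg.2 hr2R.le)]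
  have hb : ∀ z, ‖z‖ ≤ r1 → ‖G z - G 0‖ ≤ 4 * M1 * R / s := by
    intro z hz
    have hBC := Complex.borelCaratheodory_zero (f := fun z => G z - G 0) (M := 2 * M1) (R := r2) (z := z)
      (by positivity) ?_ ?_ (by positivity) ?_ (by simp)
    · refine hBC.trans ?_
      have : r2 - ‖z‖ ≥ s := by simp only [r2, r1] at *; linarith
      have h2 : ‖z‖ ≤ R := by simp only [r1, r2] at *; linarith
      have : 2 * (2 * M1) * ‖z‖ / (r2 - ‖z‖) ≤ 2 * (2 * M1) * R / s := by gcongr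
      refine this.trans (le_of_eq ?_); ring
    · intro x hx
      exact ((hG x (ball_subset_ball hr2R.le hx)).differentiableAt.sub_const _).differentiableWithinAt
    · intro x hx
      have hx' : ‖x‖ ≤ r2 := by simpa using (mem_ball_zero_iff.1 hx).le
      have := hconst x (ball_subset_ball hr2R.le hx)
      have e1 := abs_le.1 (hbd x hx')
      have e2 := abs_le.1 (hbd 0 (by simp; positivity))
      simp only [Set.mem_ofPred_eq, sub_re]
      linarith
    · simp only [mem_ball_zero_iff]
      simp only [r1, r2] at *; linarith
  have hc := Complex.norm_deriv_le_of_forall_mem_sphere_norm_le (f := fun z => G z - G 0) (c := w) (R := s)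
    (C := 4 * M1 * R / s) hspos ?_ ?_
  · have hwR : w ∈ ball (0:ℂ) R := by simp; linarith
    have e : deriv (fun z => G z - G 0) w = deriv g w / g w := ((hG w hwR).sub_const _).deriv
    rw [e] at hc
    refine hc.trans (le_of_eq ?_)
    have : R - r = 4 * s := by rw [hs]; ring
    rw [this, hM1]; field_simp; ring
  · apply DifferentiableOn.diffContOnCl
    intro x hx
    rw [closure_ball _ hspos.ne'] at hx
    have : x ∈ ball (0:ℂ) R := by
      simp only [mem_ball_zero_iff, mem_closedBall, dist_eq_norm] at *
      have := norm_le_norm_add_norm_sub' x w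
      simp only [r2, hs] at *; linarith
    exact ((hG x this).differentiableAt.sub_const _).differentiableWithinAt
  · intro z hz
    apply hb
    simp only [mem_sphere, dist_eq_norm] at hz
    have := norm_le_norm_add_norm_sub' z w
    simp only [r1]; linarith
end NV

open Complex Filter Topology MeasureTheory
open scoped Classical

namespace NV
open Metric Real

lemma sin_int : IntervalIntegrable (fun x : ℝ => |Real.sin x| ^ (-(1/2) : ℝ)) volume (-(π/2)) (π/2) := by
  have h0 : IntervalIntegrable (fun x : ℝ => |Real.sin x| ^ (-(1/2) : ℝ)) volume 0 (π/2) := by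
    have hb : IntervalIntegrable (fun x : ℝ => (2/π) ^ (-(1/2) : ℝ) * x ^ (-(1/2) : ℝ)) volume 0 (π/2) :=
      (intervalIntegral.intervalIntegrable_rpow' (by norm_num)).const_mul _
    refine hb.mono_fun ?_ ?_
    · exact (by fun_prop : Measurable (fun x : ℝ => |Real.sin x| ^ (-(1/2) : ℝ))).aestronglyMeasurable
    · refine (ae_restrict_iff' measurableSet_uIoc).2 (ae_of_all _ fun x hx => ?_)
      rw [Set.uIoc_of_le (by positivity)] at hx
      have hs := Real.mul_le_sin hx.1.le hx.2
      have hp : 0 < 2 / π * x := by have := hx.1; positivity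
      change ‖|Real.sin x| ^ (-(1/2) : ℝ)‖ ≤ ‖(2/π) ^ (-(1/2) : ℝ) * x ^ (-(1/2) : ℝ)‖
      rw [Real.norm_of_nonneg (by positivity : 0 ≤ |Real.sin x| ^ (-(1/2) : ℝ)), ← Real.mul_rpow (by positivity) hx.1.le,
        Real.norm_of_nonneg (by positivity), abs_of_pos (lt_of_lt_of_le hp hs)]
      exact Real.rpow_le_rpow_of_nonpos hp hs (by norm_num)
  have h1 : IntervalIntegrable (fun x : ℝ => |Real.sin x| ^ (-(1/2) : ℝ)) volume (-(π/2)) 0 := by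
    have := h0.comp_mul_left (c := -1) 
    simpa [div_neg] using this.symm
  exact h1.trans h0

lemma sin_int' (a b : ℝ) : IntervalIntegrable (fun x : ℝ => |Real.sin x| ^ (-(1/2) : ℝ)) volume a b := by
  have hp : Function.Periodic (fun x : ℝ => |Real.sin x| ^ (-(1/2) : ℝ)) π := by
    intro x; simp [Real.sin_add_pi]
  apply hp.intervalIntegrable pi_pos.ne' (t := -(π/2))
  convert sin_int using 1; ring

/-- constant for the mean of `|w-u|^{-1/2}`. -/
noncomputable def Ksin : ℝ := (2 * π)⁻¹ * ∫ x in (0:ℝ)..(2*π), |Real.sin x| ^ (-(1/2) : ℝ)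

lemma Ksin_nonneg : 0 ≤ Ksin := by
  unfold Ksin
  apply mul_nonneg (by positivity)
  apply intervalIntegral.integral_nonneg (by positivity)
  intro x _; positivity

lemma avg_sqrt (u : ℂ) {r : ℝ} (hr : 1/4 ≤ r) :
    CircleIntegrable (fun w => ‖w - u‖ ^ (-(1/2) : ℝ)) 0 r ∧
    circleAverage (fun w => ‖w - u‖ ^ (-(1/2) : ℝ)) 0 r ≤ 2 * Ksin := by
  have hr0 : 0 < r := by linarith
  set φ := Complex.arg u
  have hlow : ∀ θ : ℝ, r * |Real.sin (θ - φ)| ≤ ‖circleMap 0 r θ - u‖ := by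
    intro θ
    have hu : u = ‖u‖ * Complex.exp (φ * I) := (Complex.norm_mul_exp_arg_mul_I u).symm
    have e1 : circleMap 0 r θ - u = Complex.exp (φ * I) * (r * Complex.exp ((θ - φ : ℝ) * I) - ‖u‖) := by
      rw [mul_sub, mul_comm _ (‖u‖ : ℂ), ← hu]
      simp only [circleMap, zero_add]
      rw [mul_left_comm, ← Complex.exp_add]
      push_cast; ring_nf
    rw [e1, norm_mul, Complex.norm_exp_ofReal_mul_I, one_mul]
    refine le_trans (le_of_eq ?_) (Complex.abs_im_le_norm _)
    simp only [sub_im, mul_im, ofReal_re, ofReal_im, Complex.exp_ofReal_mul_I_im]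
    simp [abs_mul, abs_of_pos hr0]
  have hae : ∀ᵐ θ : ℝ, Real.sin (θ - φ) ≠ 0 := by
    have : Set.Countable {θ : ℝ | Real.sin (θ - φ) = 0} := by
      have : {θ : ℝ | Real.sin (θ - φ) = 0} ⊆ Set.range (fun n : ℤ => (n:ℝ) * π + φ) := by
        intro θ hθ
        obtain ⟨n, hn⟩ := Real.sin_eq_zero_iff.1 hθ
        exact ⟨n, by simp only; linarith⟩
      exact (Set.countable_range _).mono this
    have h := compl_mem_ae_iff.2 (this.measure_zero volume)
    filter_upwards [h] with θ hθ using hθ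
  have hbd : ∀ᵐ θ : ℝ, ‖circleMap 0 r θ - u‖ ^ (-(1/2) : ℝ) ≤ 2 * |Real.sin (θ - φ)| ^ (-(1/2) : ℝ) := by
    filter_upwards [hae] with θ hθ
    have h1 : 0 < r * |Real.sin (θ - φ)| := by positivity
    refine (Real.rpow_le_rpow_of_nonpos h1 (hlow θ) (by norm_num)).trans ?_
    rw [Real.mul_rpow hr0.le (abs_nonneg _)]
    refine mul_le_mul_of_nonneg_right ?_ (by positivity)
    have : (1/4:ℝ) ^ (-(1/2):ℝ) = 2 := by
      rw [show (1/4:ℝ) = 2 ^ (-2:ℝ) by norm_num [Real.rpow_neg]]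
      rw [← Real.rpow_mul (by norm_num)]; norm_num
    exact (Real.rpow_le_rpow_of_nonpos (by norm_num) hr (by norm_num)).trans this.le
  have hIs : IntervalIntegrable (fun θ => 2 * |Real.sin (θ - φ)| ^ (-(1/2) : ℝ)) volume 0 (2*π) := by
    apply IntervalIntegrable.const_mul
    have := (sin_int' (0 - φ) (2*π - φ)).comp_sub_right φ
    simpa using this
  have hI : CircleIntegrable (fun w => ‖w - u‖ ^ (-(1/2) : ℝ)) 0 r := by
    unfold CircleIntegrable
    refine hIs.mono_fun ?_ ?_
    · have : Measurable (fun θ : ℝ => ‖circleMap 0 r θ - u‖ ^ (-(1/2) : ℝ)) := by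
        have := (continuous_circleMap 0 r).measurable
        fun_prop
      exact this.aestronglyMeasurable
    · refine ae_restrict_of_ae ?_
      filter_upwards [hbd] with θ hθ
      rw [Real.norm_of_nonneg (by positivity), Real.norm_of_nonneg (by positivity)]
      exact hθ
  refine ⟨hI, ?_⟩
  have h2 : (∫ θ in (0:ℝ)..(2*π), ‖circleMap 0 r θ - u‖ ^ (-(1/2) : ℝ)) ≤
      ∫ θ in (0:ℝ)..(2*π), 2 * |Real.sin (θ - φ)| ^ (-(1/2) : ℝ) := by
    apply intervalIntegral.integral_mono_ae (by positivity) hI hIs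
    filter_upwards [hbd] with θ hθ using hθ
  rw [circleAverage_def, smul_eq_mul]
  have h3 : (∫ θ in (0:ℝ)..(2*π), |Real.sin (θ - φ)| ^ (-(1/2) : ℝ)) = ∫ x in (0:ℝ)..(2*π), |Real.sin x| ^ (-(1/2) : ℝ) := by
    rw [intervalIntegral.integral_comp_sub_right (fun x => |Real.sin x| ^ (-(1/2) : ℝ))]
    have hp : Function.Periodic (fun x : ℝ => |Real.sin x| ^ (-(1/2) : ℝ)) (2*π) := by
      intro x; simp [Real.sin_add_two_pi]
    have := hp.intervalIntegral_add_eq (0 - φ) 0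
    simp only [zero_add] at this
    rw [← this]; congr 1; ring
  rw [intervalIntegral.integral_const_mul, h3] at h2
  unfold Ksin
  have : 0 < (2*π)⁻¹ := by positivity
  nlinarith

lemma avg_abs_log (u : ℂ) (hu : ‖u‖ ≤ 1) {r : ℝ} (hr : 1/4 ≤ r) (hr1 : r ≤ 1) :
    CircleIntegrable (fun w => |Real.log ‖w - u‖|) 0 r ∧
    circleAverage (fun w => |Real.log ‖w - u‖|) 0 r ≤ 4 := by
  have hr0 : 0 < r := by linarith
  have hI : CircleIntegrable (fun w => Real.log ‖w - u‖) 0 r := circleIntegrable_log_norm_sub_const r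
  have hIa : CircleIntegrable (fun w => |Real.log ‖w - u‖|) 0 r := hI.abs
  refine ⟨hIa, ?_⟩
  have h1 := circleAverage_log_norm_sub_const_eq_log_radius_add_posLog (a := u) (c := 0) hr0.ne'
  have h2 : circleAverage (fun w => |Real.log ‖w - u‖|) 0 r ≤
      circleAverage (fun w => 2 * Real.log 2 - Real.log ‖w - u‖) 0 r := by
    apply circleAverage_mono hIa ((circleIntegrable_const _ _ _).sub hI)
    intro z hz
    change |Real.log ‖z - u‖| ≤ 2 * Real.log 2 - Real.log ‖z - u‖
    rw [abs_of_pos hr0] at hz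
    have hz' : ‖z‖ = r := by simpa using hz
    have h3 : ‖z - u‖ ≤ 2 := (norm_sub_le _ _).trans (by linarith)
    rcases eq_or_lt_of_le (norm_nonneg (z - u)) with h | h
    · rw [← h]; simp; positivity
    · have := Real.log_le_log h h3
      have h4 : 0 ≤ Real.log 2 := by positivity
      rw [abs_le]; constructor <;> linarith
  refine h2.trans ?_
  have h5 : circleAverage (fun w => 2 * Real.log 2 - Real.log ‖w - u‖) 0 r =
    2 * Real.log 2 - circleAverage (fun w => Real.log ‖w - u‖) 0 r := by
    have := circleAverage_fun_sub (circleIntegrable_const (2 * Real.log 2) 0 r) hI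
    rw [this, circleAverage_const]
  rw [h5, h1]
  have h6 : 0 ≤ log⁺ (r⁻¹ * ‖0 - u‖) := posLog_nonneg
  have h7 : - (2 * Real.log 2) ≤ Real.log r := by
    rw [show -(2 * Real.log 2) = Real.log (1/4) by
      rw [show (1/4:ℝ) = (2^2)⁻¹ by norm_num, Real.log_inv, Real.log_pow]; push_cast; ring]
    exact Real.log_le_log (by norm_num) hr
  have := Real.log_two_lt_d9
  linarith
end NV

open Complex Filter Topology MeasureTheory
open scoped Classical

namespace NV
open Metric Real

lemma factor {h : ℂ → ℂ} {R : ℝ} (hh : MeromorphicOn h (closedBall 0 R))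
    (ho : ∀ u ∈ closedBall (0:ℂ) R, meromorphicOrderAt h u ≠ ⊤) :
    ∃ (S : Finset ℂ) (D : ℂ → ℤ) (g : ℂ → ℂ), (∀ u ∈ S, ‖u‖ ≤ R) ∧
      AnalyticOnNhd ℂ g (closedBall 0 R) ∧ (∀ u ∈ closedBall (0:ℂ) R, g u ≠ 0) ∧
      (∀ u ∈ S, D u = (meromorphicOrderAt h u).untop₀) ∧
      (∀ u ∈ closedBall (0:ℂ) R, (meromorphicOrderAt h u).untop₀ ≠ 0 → u ∈ S) ∧
      h =ᶠ[codiscreteWithin (closedBall 0 R)] fun w => (∏ u ∈ S, (w - u) ^ (D u)) * g w := by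
  have hf := (MeromorphicOn.divisor h (closedBall 0 R)).finiteSupport (isCompact_closedBall 0 R)
  obtain ⟨g, hg, hg0, he⟩ := hh.extract_zeros_poles (fun u => ho u u.2) hf
  refine ⟨hf.toFinset, MeromorphicOn.divisor h (closedBall 0 R), g, ?_, hg, fun u hu => hg0 ⟨u, hu⟩, ?_, ?_, ?_⟩
  · intro u hu
    have := (MeromorphicOn.divisor h (closedBall 0 R)).supportWithinDomain (by simpa using hu)
    simpa using this
  · intro u hu
    have := (MeromorphicOn.divisor h (closedBall 0 R)).supportWithinDomain (by simpa using hu)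
    rw [MeromorphicOn.divisor_apply hh this]
  · intro u hu h0
    simp only [Set.Finite.mem_toFinset, Function.mem_support]
    rwa [MeromorphicOn.divisor_apply hh hu]
  · filter_upwards [he] with w hw
    rw [hw]
    simp only [Pi.smul_apply', smul_eq_mul]
    congr 1
    rw [finprod_eq_prod_of_mulSupport_subset (s := hf.toFinset)]
    · simp
    · intro u hu
      simp only [Set.Finite.coe_toFinset, Function.mem_support, Function.mem_mulSupport] at *
      intro h0; apply hu; simp [h0]

lemma sphere_cod {U : Set ℂ} {r : ℝ} {p : ℂ → Prop} (hU : sphere (0:ℂ) |r| ⊆ U)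
    (h : ∀ᶠ z in codiscreteWithin U, p z) : ∀ᶠ z in codiscreteWithin (sphere (0:ℂ) |r|), p z :=
  h.filter_mono (codiscreteWithin_mono hU)

lemma finset_cod (S : Finset ℂ) (U : Set ℂ) : ∀ᶠ z in codiscreteWithin U, z ∉ S := by
  have := compl_finite_mem_codiscreteWithin (s := U) (t := (S : Set ℂ)) S.finite_toSet
  filter_upwards [this] with z hz using by simpa using hz

lemma posLog_sqrt_bound {x K : ℝ} (hx : 0 ≤ x) (hK : 0 < K) :
    log⁺ x ≤ 2 * (Real.log K + (1 + Real.sqrt x) / K - 1) := by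
  have h1 : log⁺ x ≤ 2 * Real.log (1 + Real.sqrt x) := by
    rw [posLog_eq_log_max_one hx]
    have : max 1 x ≤ (1 + Real.sqrt x)^2 := by
      have := Real.sq_sqrt hx
      have h0 := Real.sqrt_nonneg x
      apply max_le <;> nlinarith
    calc Real.log (max 1 x) ≤ Real.log ((1 + Real.sqrt x)^2) := Real.log_le_log (by positivity) this
      _ = _ := by rw [Real.log_pow]; norm_num
  have h2 := Real.log_le_sub_one_of_pos (x := (1 + Real.sqrt x) / K) (by positivity)
  rw [Real.log_div (by positivity) hK.ne'] at h2
  linarith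

lemma sqrt_add_le' {x y : ℝ} (hx : 0 ≤ x) (hy : 0 ≤ y) : Real.sqrt (x + y) ≤ Real.sqrt x + Real.sqrt y := by
  rw [Real.sqrt_le_left (by positivity)]
  nlinarith [Real.sq_sqrt hx, Real.sq_sqrt hy, Real.sqrt_nonneg x, Real.sqrt_nonneg y, mul_nonneg (Real.sqrt_nonneg x) (Real.sqrt_nonneg y)]

lemma sqrt_sum_le {ι : Type*} (S : Finset ι) (f : ι → ℝ) (hf : ∀ i ∈ S, 0 ≤ f i) :
    Real.sqrt (∑ i ∈ S, f i) ≤ ∑ i ∈ S, Real.sqrt (f i) := by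
  induction S using Finset.induction_on with
  | empty => simp
  | insert a s ha ih =>
    rw [Finset.sum_insert ha, Finset.sum_insert ha]
    refine (sqrt_add_le' (hf a (by simp)) (Finset.sum_nonneg fun i hi => hf i (by simp [hi]))).trans ?_
    have := ih (fun i hi => hf i (by simp [hi]))
    linarith

lemma circleIntegrable_finset_sum {ι : Type*} (S : Finset ι) {f : ι → ℂ → ℝ} {c : ℂ} {r : ℝ}
    (hf : ∀ i ∈ S, CircleIntegrable (f i) c r) : CircleIntegrable (fun z => ∑ i ∈ S, f i z) c r := by
  induction S using Finset.induction_on with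
  | empty => simpa using circleIntegrable_const 0 c r
  | insert a s ha ih =>
    simp only [Finset.sum_insert ha]
    exact (hf a (by simp)).add (ih fun i hi => hf i (by simp [hi]))

lemma avg_finset_sum {ι : Type*} (S : Finset ι) {f : ι → ℂ → ℝ} {c : ℂ} {r : ℝ}
    (hf : ∀ i ∈ S, CircleIntegrable (f i) c r) :
    circleAverage (fun z => ∑ i ∈ S, f i z) c r = ∑ i ∈ S, circleAverage (f i) c r := by
  induction S using Finset.induction_on with
  | empty => simpa using circleAverage_const (0:ℝ) c r
  | insert a s ha ih =>
    simp only [Finset.sum_insert ha]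
    rw [← ih fun i hi => hf i (by simp [hi])]
    exact circleAverage_fun_add (hf a (by simp)) (circleIntegrable_finset_sum s fun i hi => hf i (by simp [hi]))

lemma avg_const_mul (a : ℝ) (f : ℂ → ℝ) (c : ℂ) (r : ℝ) :
    circleAverage (fun z => a * f z) c r = a * circleAverage f c r := by
  have := circleAverage_fun_smul (a := a) (f := f) (c := c) (R := r)
  simpa using this

lemma avg_const_add (a : ℝ) {f : ℂ → ℝ} {c : ℂ} {r : ℝ} (hf : CircleIntegrable f c r) :
    circleAverage (fun z => a + f z) c r = a + circleAverage f c r := by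
  rw [circleAverage_fun_add (circleIntegrable_const a c r) hf, circleAverage_const]

lemma ci_const_mul (a : ℝ) {f : ℂ → ℝ} {c : ℂ} {r : ℝ} (hf : CircleIntegrable f c r) :
    CircleIntegrable (fun z => a * f z) c r := IntervalIntegrable.const_mul hf a

lemma ci_const_add (a : ℝ) {f : ℂ → ℝ} {c : ℂ} {r : ℝ} (hf : CircleIntegrable f c r) :
    CircleIntegrable (fun z => a + f z) c r := (circleIntegrable_const a c r).add hf

/-- Lemma on the logarithmic derivative, raw form. -/
lemma ldl_raw {h g : ℂ → ℂ} {R r G n : ℝ} {S : Finset ℂ} {D : ℂ → ℤ} (hr : 1/2 ≤ r) (hrR : r < R)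
    (hh : MeromorphicOn h (closedBall 0 R))
    (hg : AnalyticOnNhd ℂ g (closedBall 0 R)) (hg0 : ∀ u ∈ closedBall (0:ℂ) R, g u ≠ 0)
    (he : h =ᶠ[codiscreteWithin (closedBall 0 R)] fun w => (∏ u ∈ S, (w - u) ^ (D u)) * g w)
    (hn : ∑ u ∈ S, |(D u : ℝ)| ≤ n) (hG : ∀ w : ℂ, ‖w‖ = r → ‖deriv g w / g w‖ ≤ G) :
    circleAverage (fun z => log⁺ ‖deriv h z / h z‖) 0 r ≤
      2 * Real.log (1 + Real.sqrt G + 2 * Ksin * n) := by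
  have hr0 : 0 < r := by linarith
  have hsub : sphere (0:ℂ) |r| ⊆ ball 0 R := by
    intro z hz; rw [abs_of_pos hr0] at hz; simp at *; linarith
  have hn0 : 0 ≤ n := le_trans (Finset.sum_nonneg fun _ _ => abs_nonneg _) hn
  have hKs := Ksin_nonneg
  set K := 1 + Real.sqrt G + 2 * Ksin * n with hK
  have hKpos : 0 < K := by positivity
  have e1 : logDeriv h =ᶠ[codiscreteWithin (ball 0 R)]
      logDeriv (fun w => (∏ u ∈ S, (w - u) ^ (D u)) * g w) :=
    logDeriv_congr_codiscreteWithin isOpen_ball (he.filter_mono (codiscreteWithin_mono ball_subset_closedBall))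
  have e2 : ∀ w ∈ ball (0:ℂ) R, w ∉ S → logDeriv (fun w => (∏ u ∈ S, (w - u) ^ (D u)) * g w) w =
      ∑ u ∈ S, (D u : ℂ) * (1 / (w - u)) + deriv g w / g w := by
    intro w hw hwS
    have hne : ∀ u ∈ S, w - u ≠ 0 := by
      intro u hu h0; apply hwS; rwa [sub_eq_zero.1 h0]
    have hd : ∀ u ∈ S, DifferentiableAt ℂ (fun w => (w - u) ^ (D u)) w := by
      intro u hu
      exact DifferentiableAt.zpow (by fun_prop) (Or.inl (hne u hu))
    rw [logDeriv_mul w (Finset.prod_ne_zero_iff.2 fun u hu => zpow_ne_zero _ (hne u hu))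
      (hg0 w (ball_subset_closedBall hw)) (DifferentiableAt.fun_finsetProd hd)
      (hg w (ball_subset_closedBall hw)).differentiableAt]
    rw [logDeriv_prod (f := fun u w => (w - u) ^ (D u)) (fun u hu => zpow_ne_zero _ (hne u hu)) hd]
    congr 1
    refine Finset.sum_congr rfl fun u hu => ?_
    rw [logDeriv_fun_zpow (f := fun w => w - u) (by fun_prop)]
    simp [logDeriv_apply]
  have hptw : ∀ᶠ z in codiscreteWithin (sphere (0:ℂ) |r|), log⁺ ‖deriv h z / h z‖ ≤
      2 * ((Real.log K - 1) + (1 / K) * ((1 + Real.sqrt G) + ∑ u ∈ S, |(D u : ℝ)| * ‖z - u‖ ^ (-(1/2) : ℝ))) := by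
    filter_upwards [sphere_cod hsub e1, finset_cod S _, self_mem_codiscreteWithin _] with z hz hzS hzs
    have hzs' : ‖z‖ = r := by rw [abs_of_pos hr0] at hzs; simpa using hzs
    have hzb : z ∈ ball (0:ℂ) R := hsub hzs
    change logDeriv h z = _ at hz
    rw [e2 z hzb hzS] at hz
    rw [← logDeriv_apply, hz]
    have hnorm : ‖∑ u ∈ S, (D u : ℂ) * (1 / (z - u)) + deriv g z / g z‖ ≤ 
        G + ∑ u ∈ S, |(D u : ℝ)| * ‖z - u‖⁻¹ := by
      refine (norm_add_le _ _).trans ?_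
      rw [add_comm]
      refine add_le_add (hG z hzs') ?_
      refine (norm_sum_le _ _).trans (Finset.sum_le_sum fun u hu => ?_)
      simp
    have hG0 : 0 ≤ G := (norm_nonneg _).trans (hG z hzs')
    have hsq : Real.sqrt ‖∑ u ∈ S, (D u : ℂ) * (1 / (z - u)) + deriv g z / g z‖ ≤ 
        Real.sqrt G + ∑ u ∈ S, |(D u : ℝ)| * ‖z - u‖ ^ (-(1/2) : ℝ) := by
      refine (Real.sqrt_le_sqrt hnorm).trans ?_
      refine (sqrt_add_le' hG0 (Finset.sum_nonneg fun _ _ => by positivity)).trans ?_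
      gcongr
      refine (sqrt_sum_le _ _ fun _ _ => by positivity).trans (Finset.sum_le_sum fun u hu => ?_)
      rw [Real.sqrt_mul (abs_nonneg _)]
      have h2 : Real.sqrt ‖z - u‖⁻¹ = ‖z - u‖ ^ (-(1/2) : ℝ) := by
        rw [Real.sqrt_eq_rpow, Real.inv_rpow (norm_nonneg _), Real.rpow_neg (norm_nonneg _)]
      rw [h2]
      gcongr
      rcases eq_or_ne (D u) 0 with h0 | h0
      · simp [h0]
      · have : (1:ℝ) ≤ |(D u : ℝ)| := by exact_mod_cast Int.one_le_abs h0
        rw [Real.sqrt_le_left (by positivity)]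
        nlinarith
    refine (posLog_sqrt_bound (norm_nonneg _) hKpos).trans ?_
    have : (1 + Real.sqrt ‖∑ u ∈ S, (D u : ℂ) * (1 / (z - u)) + deriv g z / g z‖) / K ≤ 
       (1 / K) * ((1 + Real.sqrt G) + ∑ u ∈ S, |(D u : ℝ)| * ‖z - u‖ ^ (-(1/2) : ℝ)) := by
      rw [div_eq_mul_one_div, mul_comm]
      exact mul_le_mul_of_nonneg_left (by linarith) (by positivity)
    linarith
  have hterm : ∀ u ∈ S, CircleIntegrable (fun z => |(D u : ℝ)| * ‖z - u‖ ^ (-(1/2) : ℝ)) 0 r :=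
    fun u hu => ci_const_mul _ (avg_sqrt u (by linarith)).1
  have hIs := circleIntegrable_finset_sum S hterm
  have hI2 := ci_const_add (1 + Real.sqrt G) hIs
  have hI3 := ci_const_mul (1/K) hI2
  have hI4 := ci_const_add (Real.log K - 1) hI3
  have hm : MeromorphicOn (fun z => deriv h z / h z) (sphere 0 |r|) := by
    intro z hz
    have := hh z (ball_subset_closedBall (hsub hz))
    exact this.deriv.div this
  refine (avg_mono_cod hr0.ne' hm.circleIntegrable_posLog_norm (ci_const_mul 2 hI4) hptw).trans ?_
  rw [avg_const_mul, avg_const_add _ hI3, avg_const_mul, avg_const_add _ hIs, avg_finset_sum S hterm]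
  have hsum : ∑ u ∈ S, circleAverage (fun z => |(D u : ℝ)| * ‖z - u‖ ^ (-(1/2) : ℝ)) 0 r ≤ 2 * Ksin * n := by
    calc _ ≤ ∑ u ∈ S, |(D u : ℝ)| * (2 * Ksin) := by
          refine Finset.sum_le_sum fun u hu => ?_
          rw [avg_const_mul]
          exact mul_le_mul_of_nonneg_left (avg_sqrt u (by linarith)).2 (abs_nonneg _)
      _ = (2 * Ksin) * ∑ u ∈ S, |(D u : ℝ)| := by rw [← Finset.sum_mul, mul_comm]
      _ ≤ _ := by gcongr
  have : (1 / K) * ((1 + Real.sqrt G) + ∑ u ∈ S, circleAverage (fun z => |(D u : ℝ)| * ‖z - u‖ ^ (-(1/2) : ℝ)) 0 r) ≤ 1 := by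
    rw [one_div, inv_mul_le_iff₀ hKpos]
    linarith
  linarith

/-- The log of the norm of the factorization. -/
lemma log_factor {h g : ℂ → ℂ} {R : ℝ} {S : Finset ℂ} {D : ℂ → ℤ}
    (hg0 : ∀ u ∈ closedBall (0:ℂ) R, g u ≠ 0)
    (he : h =ᶠ[codiscreteWithin (closedBall 0 R)] fun w => (∏ u ∈ S, (w - u) ^ (D u)) * g w) :
    ∀ᶠ w in codiscreteWithin (closedBall 0 R),
      Real.log ‖h w‖ = ∑ u ∈ S, (D u : ℝ) * Real.log ‖w - u‖ + Real.log ‖g w‖ := by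
  filter_upwards [he, finset_cod S _, self_mem_codiscreteWithin _] with w hw hwS hws
  have hne : ∀ u ∈ S, w - u ≠ 0 := by
    intro u hu h0; apply hwS; rwa [sub_eq_zero.1 h0]
  rw [hw, norm_mul, Real.log_mul _ (by simpa using hg0 w hws), norm_prod, Real.log_prod]
  · congr 1
    refine Finset.sum_congr rfl fun u hu => ?_
    rw [norm_zpow, Real.log_zpow]
  · intro u hu; exact norm_ne_zero_iff.2 (zpow_ne_zero _ (hne u hu))
  · exact norm_ne_zero_iff.2 (Finset.prod_ne_zero_iff.2 fun u hu => zpow_ne_zero (D u) (hne u hu))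

end NV

open Complex Filter Topology MeasureTheory
open scoped Classical

namespace NV
open Metric Real

/-- proximity on the circle of radius `r`. -/
noncomputable def mm (h : ℂ → ℂ) (r : ℝ) : ℝ := circleAverage (fun z => log⁺ ‖h z‖) 0 r

/-- meromorphic in the unit disc with finitely many poles. -/
def FP (h : ℂ → ℂ) : Prop :=
  ∃ P : Finset ℂ, ∀ z ∈ ball (0:ℂ) 1, MeromorphicAt h z ∧ (z ∉ P → AnalyticAt ℂ h z)

def NZ (h : ℂ → ℂ) : Prop := ∀ z ∈ ball (0:ℂ) 1, meromorphicOrderAt h z ≠ ⊤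

/-- eventually in the unit disc -/
def Ev (p : ℂ → Prop) : Prop := ∀ᶠ z in codiscreteWithin (ball (0:ℂ) 1), p z

lemma ev_open_iff {U : Set ℂ} (hU : IsOpen U) {p : ℂ → Prop} :
    (∀ᶠ z in codiscreteWithin U, p z) ↔ ∀ x ∈ U, ∀ᶠ z in 𝓝[≠] x, p z := by
  change {z | p z} ∈ codiscreteWithin U ↔ _
  rw [mem_codiscreteWithin_iff_forall_mem_nhdsNE]
  refine forall₂_congr fun x hx => ⟨fun h => ?_, fun h => ?_⟩
  · have hUx : U ∈ 𝓝[≠] x := mem_nhdsWithin_of_mem_nhds (hU.mem_nhds hx)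
    filter_upwards [h, hUx] with z hz hzU
    rcases hz with h1 | h1
    · exact h1
    · exact absurd hzU h1
  · filter_upwards [h] with z hz using Or.inl hz

lemma Ev_iff {p : ℂ → Prop} : Ev p ↔ ∀ x ∈ ball (0:ℂ) 1, ∀ᶠ z in 𝓝[≠] x, p z := ev_open_iff isOpen_ball

lemma FP.mero {h : ℂ → ℂ} (hh : FP h) {z : ℂ} (hz : z ∈ ball (0:ℂ) 1) : MeromorphicAt h z := by
  obtain ⟨P, hP⟩ := hh; exact (hP z hz).1

lemma FP.meroOn {h : ℂ → ℂ} (hh : FP h) {r : ℝ} (hr : r < 1) : MeromorphicOn h (closedBall 0 r) := by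
  intro z hz
  exact hh.mero (closedBall_subset_ball hr hz)

lemma FP.dich {h : ℂ → ℂ} (hh : FP h) : NZ h ∨ Ev (fun z => h z = 0) := by
  by_cases hN : NZ h
  · exact Or.inl hN
  right
  have hm : MeromorphicOn h (ball (0:ℂ) 1) := fun z hz => hh.mero hz
  have hc : IsConnected (ball (0:ℂ) 1) := ⟨⟨0, by simp⟩, (convex_ball (0:ℂ) 1).isPreconnected⟩
  have := hm.exists_meromorphicOrderAt_ne_top_iff_forall hc
  rw [Ev_iff]
  intro x hx
  rw [← meromorphicOrderAt_eq_top_iff]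
  by_contra hne
  exact hN fun z hz => this.1 ⟨⟨x, hx⟩, hne⟩ ⟨z, hz⟩

lemma NZ.ev {h : ℂ → ℂ} (hN : NZ h) (hh : FP h) : Ev (fun z => h z ≠ 0) := by
  rw [Ev_iff]
  intro x hx
  exact (meromorphicOrderAt_ne_top_iff_eventually_ne_zero (hh.mero hx)).1 (hN x hx)

lemma NZ.of_ev {h : ℂ → ℂ} (hh : FP h) (he : Ev (fun z => h z ≠ 0)) : NZ h := by
  rw [Ev_iff] at he
  intro x hx
  exact (meromorphicOrderAt_ne_top_iff_eventually_ne_zero (hh.mero hx)).2 (he x hx)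

lemma not_ev_both {p : ℂ → Prop} (h1 : Ev p) (h2 : Ev fun z => ¬ p z) : False := by
  rw [Ev_iff] at h1 h2
  have := (h1 0 (by simp)).and (h2 0 (by simp))
  obtain ⟨z, hz⟩ := this.exists
  exact hz.2 hz.1

lemma FP.const (c : ℂ) : FP (fun _ => c) :=
  ⟨∅, fun z _ => ⟨MeromorphicAt.const c z, fun _ => analyticAt_const⟩⟩

lemma FP.add {h k : ℂ → ℂ} (hh : FP h) (hk : FP k) : FP (fun z => h z + k z) := by
  obtain ⟨P, hP⟩ := hh
  obtain ⟨Q, hQ⟩ := hk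
  refine ⟨P ∪ Q, fun z hz => ⟨(hP z hz).1.add (hQ z hz).1, fun hn => ?_⟩⟩
  simp only [Finset.mem_union, not_or] at hn
  exact ((hP z hz).2 hn.1).add ((hQ z hz).2 hn.2)

lemma FP.mul {h k : ℂ → ℂ} (hh : FP h) (hk : FP k) : FP (fun z => h z * k z) := by
  obtain ⟨P, hP⟩ := hh
  obtain ⟨Q, hQ⟩ := hk
  refine ⟨P ∪ Q, fun z hz => ⟨(hP z hz).1.mul (hQ z hz).1, fun hn => ?_⟩⟩
  simp only [Finset.mem_union, not_or] at hn
  exact ((hP z hz).2 hn.1).mul ((hQ z hz).2 hn.2)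

lemma FP.cmul {h : ℂ → ℂ} (c : ℂ) (hh : FP h) : FP (fun z => c * h z) := (FP.const c).mul hh

lemma FP.neg {h : ℂ → ℂ} (hh : FP h) : FP (fun z => - h z) := by
  simpa using hh.cmul (-1)

lemma FP.sub {h k : ℂ → ℂ} (hh : FP h) (hk : FP k) : FP (fun z => h z - k z) := by
  simpa [sub_eq_add_neg] using hh.add hk.neg

lemma FP.pow {h : ℂ → ℂ} (hh : FP h) (n : ℕ) : FP (fun z => h z ^ n) := by
  induction n with
  | zero => simpa using FP.const 1
  | succ n ih => simpa [pow_succ] using ih.mul hh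

lemma FP.deriv {h : ℂ → ℂ} (hh : FP h) : FP (deriv h) := by
  obtain ⟨P, hP⟩ := hh
  exact ⟨P, fun z hz => ⟨(hP z hz).1.deriv, fun hn => ((hP z hz).2 hn).deriv⟩⟩

lemma FP.evAn {h : ℂ → ℂ} (hh : FP h) : Ev (fun z => AnalyticAt ℂ h z) := by
  rw [Ev_iff]
  intro x hx
  exact (hh.mero hx).eventually_analyticAt

lemma FP.of_analytic {h : ℂ → ℂ} (hh : ∀ z ∈ ball (0:ℂ) 1, AnalyticAt ℂ h z) : FP h :=
  ⟨∅, fun z hz => ⟨(hh z hz).meromorphicAt, fun _ => hh z hz⟩⟩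

/-- log is a Jensen-type lower bound for functions with finitely many poles -/
lemma FP.jensen {h : ℂ → ℂ} (hh : FP h) (hN : NZ h) : ∃ C : ℝ, 0 ≤ C ∧ ∀ r R : ℝ, 1/2 ≤ r → r < 1 → R < r →
    ∀ S : Finset ℂ, (∀ u ∈ S, ‖u‖ ≤ R) →
    (r - R) * ∑ u ∈ S, |((meromorphicOrderAt h u).untop₀ : ℝ)| - C ≤ circleAverage (fun z => Real.log ‖h z‖) 0 r := by
  obtain ⟨P, hP⟩ := id hh
  set Dv : ℂ → ℝ := fun u => ((meromorphicOrderAt h u).untop₀ : ℝ) with hDv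
  set E : Finset ℂ := insert 0 P with hE
  set c : ℂ → ℝ := fun u => |Dv u| * (2 + |Real.log ‖u‖|) with hc
  have hc0 : ∀ u, 0 ≤ c u := fun u => by positivity
  refine ⟨∑ u ∈ E, c u + |Dv 0| + |Real.log ‖meromorphicTrailingCoeffAt h 0‖|, by
    have := Finset.sum_nonneg (s := E) fun u _ => hc0 u
    positivity, ?_⟩
  intro r R hr hr1 hR S hS
  have hr0 : 0 < r := by linarith
  have hm : MeromorphicOn h (closedBall 0 |r|) := by rw [abs_of_pos hr0]; exact hh.meroOn hr1
  have hJ := hm.circleAverage_log_norm hr0.ne'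
  rw [hJ]
  rw [abs_of_pos hr0] at hm ⊢
  set d := MeromorphicOn.divisor h (closedBall 0 r) with hd
  have hdin : ∀ u ∈ closedBall (0:ℂ) r, ((d u : ℤ) : ℝ) = Dv u := fun u hu => by
    rw [hd, MeromorphicOn.divisor_apply hm hu]
  have hdout : ∀ u ∉ closedBall (0:ℂ) r, d u = 0 := fun u hu => by
    by_contra h0
    exact hu (d.supportWithinDomain h0)
  have hfin := d.finiteSupport (isCompact_closedBall 0 r)
  rw [finsum_eq_sum_of_support_subset (s := hfin.toFinset ∪ S)]
  swap
  · intro u hu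
    simp only [Finset.coe_union, Set.Finite.coe_toFinset, Set.mem_union, Function.mem_support] at *
    left; intro h0; apply hu; simp [h0]
  set T := hfin.toFinset ∪ S
  have hkey : ∀ u ∈ T, (r - R) * (if u ∈ S then |Dv u| else 0) - (if u ∈ E then c u else 0) ≤
      (d u : ℝ) * Real.log (r * ‖0 - u‖⁻¹) := by
    intro u hu
    rw [zero_sub, norm_neg]
    by_cases huE : u ∈ E
    · rw [if_pos huE]
      have h1 : (r - R) * (if u ∈ S then |Dv u| else 0) ≤ |Dv u| := by
        split_ifs with h
        · have : 0 ≤ R := (norm_nonneg u).trans (hS u h)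
          have := abs_nonneg (Dv u)
          nlinarith
        · simp
      have h2 : |(d u : ℝ)| ≤ |Dv u| := by
        by_cases hu : u ∈ closedBall (0:ℂ) r
        · rw [hdin u hu]
        · rw [hdout u hu]; simp
      have h3 : |Real.log (r * ‖u‖⁻¹)| ≤ 1 + |Real.log ‖u‖| := by
        rcases eq_or_ne u 0 with rfl | hu0
        · simp
        rw [Real.log_mul hr0.ne' (by simpa using hu0), Real.log_inv]
        refine (abs_add_le _ _).trans ?_
        rw [abs_neg]
        gcongr
        rw [abs_le]
        constructor
        · have := Real.one_sub_inv_le_log_of_pos hr0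
          have : r⁻¹ ≤ 2 := by rw [inv_le_comm₀ hr0 (by norm_num)]; linarith
          linarith
        · have := Real.log_nonpos hr0.le hr1.le
          linarith
      have h4 : |(d u : ℝ) * Real.log (r * ‖u‖⁻¹)| ≤ |Dv u| * (1 + |Real.log ‖u‖|) := by
        rw [abs_mul]; gcongr
      have h5 := neg_abs_le ((d u : ℝ) * Real.log (r * ‖u‖⁻¹))
      simp only [hc]
      linarith
    · rw [if_neg huE, sub_zero]
      have hu0 : u ≠ 0 := fun h => huE (by simp [hE, h])
      have huP : u ∉ P := fun h => huE (by simp [hE, h])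
      have hnu : 0 < ‖u‖ := norm_pos_iff.2 hu0
      by_cases hub : u ∈ closedBall (0:ℂ) r
      · have hub' : ‖u‖ ≤ r := by simpa using hub
        have hD0 : 0 ≤ Dv u := by
          have := ((hP u (closedBall_subset_ball hr1 hub)).2 huP).meromorphicOrderAt_nonneg
          have h7 : 0 ≤ (meromorphicOrderAt h u).untop₀ := WithTop.untop₀_nonneg.2 this
          simp only [hDv]
          exact_mod_cast h7
        rw [hdin u hub]
        split_ifs with h
        · rw [abs_of_nonneg hD0, mul_comm]
          refine mul_le_mul_of_nonneg_left ?_ hD0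
          have h8 := Real.one_sub_inv_le_log_of_pos (x := r * ‖u‖⁻¹) (by positivity)
          have h9 : (r * ‖u‖⁻¹)⁻¹ ≤ 1 - (r - R) := by
            rw [mul_inv, inv_inv, inv_mul_le_iff₀ hr0]
            have := hS u h
            have : 0 ≤ R := (norm_nonneg u).trans (hS u h)
            nlinarith
          linarith
        · rw [mul_zero]
          refine mul_nonneg hD0 (Real.log_nonneg ?_)
          rw [← div_eq_mul_inv, one_le_div hnu]; exact hub'
      · rw [hdout u hub]
        have : u ∉ S := fun h => hub (by simpa using (hS u h).trans hR.le)
        simp [this]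
  have hsum := Finset.sum_le_sum hkey
  rw [Finset.sum_sub_distrib, ← Finset.mul_sum, ← Finset.sum_filter, ← Finset.sum_filter] at hsum
  have e1 : T.filter (· ∈ S) = S := by
    ext u; simp [T]
  have e2 : ∑ u ∈ T.filter (· ∈ E), c u ≤ ∑ u ∈ E, c u :=
    Finset.sum_le_sum_of_subset_of_nonneg (fun u hu => (Finset.mem_filter.1 hu).2) fun u _ _ => hc0 u
  rw [e1] at hsum
  have h0 : -|Dv 0| ≤ (d 0 : ℝ) * Real.log r := by
    rw [hdin 0 (by simp [hr0.le])]
    have hl : |Real.log r| ≤ 1 := by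
      rw [abs_le]
      constructor
      · have := Real.one_sub_inv_le_log_of_pos hr0
        have : r⁻¹ ≤ 2 := by rw [inv_le_comm₀ hr0 (by norm_num)]; linarith
        linarith
      · have := Real.log_nonpos hr0.le hr1.le
        linarith
    have := neg_abs_le (Dv 0 * Real.log r)
    rw [abs_mul] at this
    nlinarith [abs_nonneg (Dv 0)]
  have h1 := neg_abs_le (Real.log ‖meromorphicTrailingCoeffAt h 0‖)
  linarith

end NV

open Complex Filter Topology MeasureTheory
open scoped Classical

namespace NV
open Metric Real

lemma sph_sub {r : ℝ} (hr : 0 < r) (hr1 : r < 1) : sphere (0:ℂ) |r| ⊆ ball 0 1 := by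
  intro z hz; rw [abs_of_pos hr] at hz; simp at *; linarith

lemma FP.ciP {h : ℂ → ℂ} (hh : FP h) {r : ℝ} (hr : 0 < r) (hr1 : r < 1) :
    CircleIntegrable (fun z => log⁺ ‖h z‖) 0 r :=
  MeromorphicOn.circleIntegrable_posLog_norm fun z hz => hh.mero (sph_sub hr hr1 hz)

lemma FP.ciL {h : ℂ → ℂ} (hh : FP h) {r : ℝ} (hr : 0 < r) (hr1 : r < 1) :
    CircleIntegrable (fun z => Real.log ‖h z‖) 0 r :=
  MeromorphicOn.circleIntegrable_log_norm fun z hz => hh.mero (sph_sub hr hr1 hz)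

lemma mero_ciP {h : ℂ → ℂ} (hh : ∀ z ∈ ball (0:ℂ) 1, MeromorphicAt h z) {r : ℝ} (hr : 0 < r) (hr1 : r < 1) :
    CircleIntegrable (fun z => log⁺ ‖h z‖) 0 r :=
  MeromorphicOn.circleIntegrable_posLog_norm fun z hz => hh z (sph_sub hr hr1 hz)

lemma avg_mono_ev {f g : ℂ → ℝ} {r : ℝ} (hr : 0 < r) (hr1 : r < 1) (hf : CircleIntegrable f 0 r)
    (hg : CircleIntegrable g 0 r) (h : Ev fun z => f z ≤ g z) : circleAverage f 0 r ≤ circleAverage g 0 r :=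
  avg_mono_cod hr.ne' hf hg (sphere_cod (sph_sub hr hr1) h)

lemma mm_nonneg (h : ℂ → ℂ) (r : ℝ) : 0 ≤ mm h r := by
  have := circleAverage_nonneg_of_nonneg (c := 0) (R := r) (f := fun z => log⁺ ‖h z‖) (fun z _ => posLog_nonneg)
  exact this

lemma mm_congr {h k : ℂ → ℂ} {r : ℝ} (hr : 0 < r) (hr1 : r < 1) (he : Ev fun z => h z = k z) : mm h r = mm k r := by
  refine circleAverage_congr_codiscreteWithin ?_ hr.ne'
  filter_upwards [sphere_cod (sph_sub hr hr1) he] with z hz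
  rw [hz]

lemma mm_zero {h : ℂ → ℂ} {r : ℝ} (hr : 0 < r) (hr1 : r < 1) (he : Ev fun z => h z = 0) : mm h r = 0 := by
  rw [mm_congr (k := fun _ => 0) hr hr1 he]
  simp [mm, circleAverage_const]

lemma abs_eq_posLog (x : ℝ) : |Real.log x| = 2 * log⁺ x - Real.log x := by
  rw [posLog_apply]
  rcases le_total (Real.log x) 0 with h | h
  · rw [abs_of_nonpos h, max_eq_left h]; ring
  · rw [abs_of_nonneg h, max_eq_right h]; ring

/-- real-valued closure of the class of bounds. -/
def SC (μ φ : ℝ → ℝ) : Prop := ∃ C : ℝ, 0 ≤ C ∧ ∀ r ρ B : ℝ, 1/2 ≤ r → r < ρ → ρ < 1 → 0 ≤ B →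
  (∀ s, 1/2 ≤ s → s ≤ ρ → μ s ≤ B) → φ r ≤ C * (1 + Real.log (1 + B) + Real.log (1 / (ρ - r)))

def LC (μ φ : ℝ → ℝ) : Prop := ∃ C : ℝ, 0 ≤ C ∧ ∀ r ρ B : ℝ, 1/2 ≤ r → r < ρ → ρ < 1 → 0 ≤ B →
  (∀ s, 1/2 ≤ s → s ≤ ρ → μ s ≤ B) → φ r ≤ C * (1 + B + Real.log (1 / (ρ - r)))

lemma log_inv_nonneg {r ρ : ℝ} (hr : 1/2 ≤ r) (h1 : r < ρ) (h2 : ρ < 1) : 0 ≤ Real.log (1 / (ρ - r)) := by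
  apply Real.log_nonneg
  rw [le_div_iff₀ (by linarith)]; linarith

lemma SC.toLC {μ φ : ℝ → ℝ} (h : SC μ φ) : LC μ φ := by
  obtain ⟨C, hC, h⟩ := h
  refine ⟨C, hC, fun r ρ B h1 h2 h3 h4 h5 => (h r ρ B h1 h2 h3 h4 h5).trans ?_⟩
  have := Real.log_le_sub_one_of_pos (x := 1 + B) (by linarith)
  gcongr; linarith

lemma LC.self {μ : ℝ → ℝ} : LC μ μ := by
  refine ⟨1, by norm_num, fun r ρ B h1 h2 h3 h4 h5 => ?_⟩
  have := h5 r h1 h2.le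
  have := log_inv_nonneg h1 h2 h3
  linarith

lemma SC.mono {μ φ ψ : ℝ → ℝ} (h : SC μ φ) (hle : ∀ r, 1/2 ≤ r → r < 1 → ψ r ≤ φ r) : SC μ ψ := by
  obtain ⟨C, hC, h⟩ := h
  exact ⟨C, hC, fun r ρ B h1 h2 h3 h4 h5 => (hle r h1 (h2.trans h3)).trans (h r ρ B h1 h2 h3 h4 h5)⟩

lemma LC.mono {μ φ ψ : ℝ → ℝ} (h : LC μ φ) (hle : ∀ r, 1/2 ≤ r → r < 1 → ψ r ≤ φ r) : LC μ ψ := by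
  obtain ⟨C, hC, h⟩ := h
  exact ⟨C, hC, fun r ρ B h1 h2 h3 h4 h5 => (hle r h1 (h2.trans h3)).trans (h r ρ B h1 h2 h3 h4 h5)⟩

lemma SC.add {μ φ ψ : ℝ → ℝ} (h : SC μ φ) (h' : SC μ ψ) : SC μ (fun r => φ r + ψ r) := by
  obtain ⟨C, hC, h⟩ := h
  obtain ⟨C', hC', h'⟩ := h'
  refine ⟨C + C', by linarith, fun r ρ B h1 h2 h3 h4 h5 => ?_⟩
  have e1 := h r ρ B h1 h2 h3 h4 h5
  have e2 := h' r ρ B h1 h2 h3 h4 h5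
  linarith

lemma LC.add {μ φ ψ : ℝ → ℝ} (h : LC μ φ) (h' : LC μ ψ) : LC μ (fun r => φ r + ψ r) := by
  obtain ⟨C, hC, h⟩ := h
  obtain ⟨C', hC', h'⟩ := h'
  refine ⟨C + C', by linarith, fun r ρ B h1 h2 h3 h4 h5 => ?_⟩
  have e1 := h r ρ B h1 h2 h3 h4 h5
  have e2 := h' r ρ B h1 h2 h3 h4 h5
  linarith

lemma SC.const (μ : ℝ → ℝ) (c : ℝ) : SC μ (fun _ => c) := by
  refine ⟨|c|, abs_nonneg c, fun r ρ B h1 h2 h3 h4 h5 => ?_⟩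
  have := log_inv_nonneg h1 h2 h3
  have h6 := Real.log_nonneg (x := 1 + B) (by linarith)
  have := le_abs_self c
  nlinarith [abs_nonneg c]

lemma LC.const (μ : ℝ → ℝ) (c : ℝ) : LC μ (fun _ => c) := (SC.const μ c).toLC

/-- Bound on the proximity function in a compact range. -/
lemma FP.mm_bdd {h : ℂ → ℂ} (hh : FP h) {ρ : ℝ} (hρ : ρ < 1) : ∃ B : ℝ, 0 ≤ B ∧ ∀ s, 1/2 ≤ s → s ≤ ρ → mm h s ≤ B := by
  rcases hh.dich with hN | h0
  swap
  · refine ⟨0, le_rfl, fun s h1 h2 => ?_⟩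
    rw [mm_zero (by linarith) (by linarith) h0]
  obtain ⟨S, D, g, hS, hg, hg0, -, -, he⟩ := factor (hh.meroOn hρ) (fun u hu => hN u (closedBall_subset_ball hρ hu))
  have hlog := log_factor hg0 he
  have hcont : ContinuousOn (fun w => |Real.log ‖g w‖|) (closedBall 0 ρ) := by
    apply ContinuousOn.abs
    apply ContinuousOn.log
    · exact hg.continuousOn.norm
    · intro w hw; simpa using hg0 w hw
  obtain ⟨M, hM⟩ := (isCompact_closedBall (0:ℂ) ρ).exists_bound_of_continuousOn hcont
  have hs0 : 0 ≤ ∑ u ∈ S, |(D u : ℝ)| := Finset.sum_nonneg fun _ _ => abs_nonneg _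
  refine ⟨|M| + ∑ u ∈ S, |(D u : ℝ)| * 4, by rw [← Finset.sum_mul]; positivity, fun s h1 h2 => ?_⟩
  have hs : 0 < s := by linarith
  have hterm : ∀ u ∈ S, CircleIntegrable (fun z => |(D u : ℝ)| * |Real.log ‖z - u‖|) 0 s :=
    fun u hu => ci_const_mul _ (avg_abs_log u ((hS u hu).trans hρ.le) (by linarith) (by linarith)).1
  have hIs := circleIntegrable_finset_sum S hterm
  have hsub : sphere (0:ℂ) |s| ⊆ closedBall 0 ρ := by
    intro z hz; rw [abs_of_pos hs] at hz; simp at *; linarith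
  calc mm h s ≤ circleAverage (fun z => |M| + ∑ u ∈ S, |(D u : ℝ)| * |Real.log ‖z - u‖|) 0 s := by
        refine avg_mono_cod hs.ne' (hh.ciP hs (by linarith)) (ci_const_add _ hIs) ?_
        filter_upwards [sphere_cod hsub hlog, self_mem_codiscreteWithin _] with z hz hzs
        have e1 : log⁺ ‖h z‖ ≤ |Real.log ‖h z‖| := by
          rw [posLog_apply]; exact max_le (abs_nonneg _) (le_abs_self _)
        refine e1.trans ?_
        rw [hz]
        refine (abs_add_le _ _).trans ?_
        have e2 : |Real.log ‖g z‖| ≤ |M| := by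
          have := hM z (hsub hzs)
          rw [Real.norm_eq_abs, abs_abs] at this
          exact this.trans (le_abs_self M)
        have e3 : |∑ u ∈ S, (D u : ℝ) * Real.log ‖z - u‖| ≤ ∑ u ∈ S, |(D u : ℝ)| * |Real.log ‖z - u‖| := by
          refine (Finset.abs_sum_le_sum_abs _ _).trans (Finset.sum_le_sum fun u hu => ?_)
          rw [abs_mul]
        linarith
    _ ≤ _ := by
        rw [avg_const_add _ hIs, avg_finset_sum S hterm]
        gcongr with u hu
        rw [avg_const_mul]
        exact mul_le_mul_of_nonneg_left (avg_abs_log u ((hS u hu).trans hρ.le) (by linarith) (by linarith)).2 (abs_nonneg _)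

lemma FP.meanlog_le {h : ℂ → ℂ} (hh : FP h) {r : ℝ} (hr : 0 < r) (hr1 : r < 1) :
    circleAverage (fun z => Real.log ‖h z‖) 0 r ≤ mm h r := by
  refine circleAverage_mono (hh.ciL hr hr1) (hh.ciP hr hr1) fun z _ => ?_
  change Real.log ‖h z‖ ≤ log⁺ ‖h z‖
  rw [posLog_apply]; exact le_max_right _ _

lemma FP.jensen0 {h : ℂ → ℂ} (hh : FP h) (hN : NZ h) : ∃ C : ℝ, 0 ≤ C ∧ ∀ r : ℝ, 1/2 ≤ r → r < 1 →
    - C ≤ circleAverage (fun z => Real.log ‖h z‖) 0 r := by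
  obtain ⟨C, hC, h⟩ := hh.jensen hN
  refine ⟨C, hC, fun r h1 h2 => ?_⟩
  simpa using h r 0 h1 h2 (by linarith) ∅ (by simp)

lemma FP.mean_abs {h : ℂ → ℂ} (hh : FP h) {r : ℝ} (hr : 0 < r) (hr1 : r < 1) :
    CircleIntegrable (fun z => |Real.log ‖h z‖|) 0 r ∧
    circleAverage (fun z => |Real.log ‖h z‖|) 0 r = 2 * mm h r - circleAverage (fun z => Real.log ‖h z‖) 0 r := by
  simp only [abs_eq_posLog]
  refine ⟨(ci_const_mul 2 (hh.ciP hr hr1)).sub (hh.ciL hr hr1), ?_⟩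
  rw [circleAverage_fun_sub (ci_const_mul 2 (hh.ciP hr hr1)) (hh.ciL hr hr1), avg_const_mul]
  rfl

set_option maxHeartbeats 1000000 in
/-- Raw LDL in the disc. -/
lemma FP.ldl_aux {h : ℂ → ℂ} (hh : FP h) (hN : NZ h) : ∃ C : ℝ, 0 ≤ C ∧ ∀ r ρ B : ℝ, 1/2 ≤ r → r < ρ → ρ < 1 → 0 ≤ B →
    mm h ρ ≤ B → mm h ((r + ρ)/2) ≤ B →
    mm (fun z => _root_.deriv h z / h z) r ≤ C * (1 + Real.log (1 + B) + Real.log (1 / (ρ - r))) := by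
  obtain ⟨c, hc, hJ⟩ := hh.jensen hN
  have hK := Ksin_nonneg
  set A : ℝ := 1 + 1 + 256 * 8 * (2 + c + 8 * (1 + c) + 1) + 2 * Ksin * (2 * (1 + c)) with hA
  have hA1 : 1 ≤ A := by rw [hA]; nlinarith [mul_nonneg hK hc]
  have hlA := Real.log_nonneg hA1
  refine ⟨2 * (Real.log A + 4), by positivity, fun r ρ B h1 h2 h3 hB hm1 hm2 => ?_⟩
  set R := (r + ρ) / 2 with hR
  have hRr : r < R := by rw [hR]; linarith
  have hRρ : R < ρ := by rw [hR]; linarith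
  set d := ρ - r with hd
  have hd0 : 0 < d := by rw [hd]; linarith
  have hd1 : d ≤ 1/2 := by rw [hd]; linarith
  have hr0 : 0 < r := by linarith
  have hR0 : 0 < R := by linarith
  have hR1 : R < 1 := by linarith
  obtain ⟨S, D, g, hS, hg, hg0, hDo, -, he⟩ := factor (hh.meroOn hR1) (fun u hu => hN u (closedBall_subset_ball hR1 hu))
  have hlog := log_factor hg0 he
  set n := 2 * (B + c) / d with hn
  have hsum : ∑ u ∈ S, |(D u : ℝ)| ≤ n := by
    have := hJ ρ R (by linarith) h3 hRρ S hS
    have h4 := hh.meanlog_le (by linarith : 0 < ρ) h3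
    have h5 : ∑ u ∈ S, |((meromorphicOrderAt h u).untop₀ : ℝ)| = ∑ u ∈ S, |(D u : ℝ)| :=
      Finset.sum_congr rfl fun u hu => by rw [hDo u hu]
    rw [h5] at this
    rw [hn, le_div_iff₀ hd0]
    have h6 : ρ - R = d / 2 := by rw [hR, hd]; ring
    rw [h6] at this
    nlinarith
  have hn0 : 0 ≤ n := by positivity
  set M := 2 * B + c + 4 * n with hM
  have hterm : ∀ u ∈ S, CircleIntegrable (fun z => |(D u : ℝ)| * |Real.log ‖z - u‖|) 0 R :=
    fun u hu => ci_const_mul _ (avg_abs_log u ((hS u hu).trans hR1.le) (by linarith) (by linarith)).1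
  have hIs := circleIntegrable_finset_sum S hterm
  have hsub : sphere (0:ℂ) |R| ⊆ closedBall 0 R := by
    rw [abs_of_pos hR0]; exact sphere_subset_closedBall
  have hgint : CircleIntegrable (fun z => |Real.log ‖g z‖|) 0 R := by
    refine ContinuousOn.circleIntegrable hR0.le ?_
    apply ContinuousOn.abs
    apply ContinuousOn.log
    · exact (hg.continuousOn.mono sphere_subset_closedBall).norm
    · intro w hw; simpa using hg0 w (sphere_subset_closedBall hw)
  have hMg : circleAverage (fun z => |Real.log ‖g z‖|) 0 R ≤ M := by
    have hma := hh.mean_abs hR0 hR1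
    calc _ ≤ circleAverage (fun z => |Real.log ‖h z‖| + ∑ u ∈ S, |(D u : ℝ)| * |Real.log ‖z - u‖|) 0 R := by
          refine avg_mono_cod hR0.ne' hgint (hma.1.add hIs) ?_
          filter_upwards [sphere_cod hsub hlog] with z hz
          have e3 : |∑ u ∈ S, (D u : ℝ) * Real.log ‖z - u‖| ≤ ∑ u ∈ S, |(D u : ℝ)| * |Real.log ‖z - u‖| := by
            refine (Finset.abs_sum_le_sum_abs _ _).trans (Finset.sum_le_sum fun u hu => ?_)
            rw [abs_mul]
          have e4 : Real.log ‖g z‖ = Real.log ‖h z‖ - ∑ u ∈ S, (D u : ℝ) * Real.log ‖z - u‖ := by linarith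
          rw [e4]
          refine (abs_sub _ _).trans ?_
          linarith
      _ ≤ M := by
          rw [circleAverage_fun_add hma.1 hIs, hma.2, avg_finset_sum S hterm]
          have e5 := hJ R 0 (by linarith) hR1 hR0 ∅ (by simp)
          simp only [Finset.sum_empty, mul_zero, zero_sub] at e5
          have e6 : ∑ u ∈ S, circleAverage (fun z => |(D u : ℝ)| * |Real.log ‖z - u‖|) 0 R ≤ 4 * n := by
            calc _ ≤ ∑ u ∈ S, |(D u : ℝ)| * 4 := by
                  refine Finset.sum_le_sum fun u hu => ?_
                  rw [avg_const_mul]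
                  exact mul_le_mul_of_nonneg_left (avg_abs_log u ((hS u hu).trans hR1.le) (by linarith) (by linarith)).2 (abs_nonneg _)
              _ = 4 * ∑ u ∈ S, |(D u : ℝ)| := by rw [← Finset.sum_mul, mul_comm]
              _ ≤ _ := by gcongr
          linarith
  have hG : ∀ w : ℂ, ‖w‖ = r → ‖_root_.deriv g w / g w‖ ≤ 256 * R^2 * (M + 1) / (R - r)^3 := by
    intro w hw
    exact zf_deriv_bound hg hg0 hr0.le hRr hMg hw.le
  have hfin := ldl_raw h1 hRr (hh.meroOn hR1) hg hg0 he hsum hG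
  refine hfin.trans ?_
  set G := 256 * R^2 * (M + 1) / (R - r)^3 with hGdef
  have hM0 : 0 ≤ M := by positivity
  have hRd : R - r = d / 2 := by rw [hR, hd]; ring
  have hnb : n ≤ 2 * (1 + c) * (1 + B) / d := by
    rw [hn]
    apply div_le_div_of_nonneg_right _ hd0.le
    nlinarith [mul_nonneg hc hB]
  have hMb : M + 1 ≤ (2 + c + 8 * (1 + c) + 1) * (1 + B) / d := by
    have e1 : 2 * B + c + 1 ≤ (2 + c + 1) * (1 + B) / d := by
      rw [le_div_iff₀ hd0]
      nlinarith [mul_nonneg hc hB]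
    have e2 : (2 + c + 8 * (1 + c) + 1) * (1 + B) / d = (2 + c + 1) * (1 + B) / d + 4 * (2 * (1 + c) * (1 + B) / d) := by
      ring
    rw [e2, hM]; linarith
  have hGb : G ≤ 256 * 8 * (2 + c + 8 * (1 + c) + 1) * (1 + B) / d ^ 4 := by
    rw [hGdef, hRd]
    calc _ ≤ 256 * 1^2 * ((2 + c + 8 * (1 + c) + 1) * (1 + B) / d) / (d/2)^3 := by gcongr
      _ = _ := by field_simp; norm_num
  have hG0 : 0 ≤ G := by rw [hGdef, hRd]; positivity
  have hsq : Real.sqrt G ≤ 1 + G := by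
    rw [Real.sqrt_le_left (by linarith)]; nlinarith
  have hd4 : d ^ 4 ≤ d := by
    have := pow_le_pow_of_le_one hd0.le (by linarith) (show 1 ≤ 4 by norm_num)
    simpa using this
  have hd41 : d^4 ≤ 1 := by linarith
  have htot : 1 + Real.sqrt G + 2 * Ksin * n ≤ A * (1 + B) / d ^ 4 := by
    have e1 : (1:ℝ) ≤ (1 + B) / d^4 := by rw [le_div_iff₀ (by positivity)]; nlinarith
    have e2 : 2 * Ksin * n ≤ 2 * Ksin * (2 * (1 + c)) * (1 + B) / d^4 := by
      calc 2 * Ksin * n ≤ 2 * Ksin * (2 * (1 + c) * (1 + B) / d) := by gcongr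
        _ ≤ 2 * Ksin * (2 * (1 + c) * (1 + B) / d^4) := by gcongr
        _ = _ := by ring
    have e3 : A * (1 + B) / d ^ 4 = (1 + B) / d^4 + (1 + B) / d^4 + 256 * 8 * (2 + c + 8 * (1 + c) + 1) * (1 + B) / d ^ 4 + 2 * Ksin * (2 * (1 + c)) * (1 + B) / d^4 := by
      rw [hA]; ring
    rw [e3]; linarith
  have hL : Real.log (1 + Real.sqrt G + 2 * Ksin * n) ≤ Real.log A + Real.log (1 + B) + 4 * Real.log (1 / d) := by
    refine (Real.log_le_log (by positivity) htot).trans (le_of_eq ?_)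
    rw [Real.log_div (by positivity) (by positivity), Real.log_mul (by positivity) (by positivity), Real.log_pow,
      one_div, Real.log_inv]
    push_cast; ring
  have hl1 := Real.log_nonneg (x := 1 + B) (by linarith)
  have hl2 : 0 ≤ Real.log (1 / d) := log_inv_nonneg h1 h2 h3
  nlinarith [mul_nonneg hlA hl1, mul_nonneg hlA hl2]

lemma FP.ldl {h : ℂ → ℂ} {μ : ℝ → ℝ} (hh : FP h) (hL : LC μ (mm h)) : SC μ (mm fun z => _root_.deriv h z / h z) := by
  rcases hh.dich with hN | h0
  swap
  · refine (SC.const μ 0).mono fun r h1 h2 => ?_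
    rw [mm_zero (by linarith) h2]
    filter_upwards [h0] with z hz
    simp [hz]
  obtain ⟨C, hC, H⟩ := hh.ldl_aux hN
  obtain ⟨c, hc, hL⟩ := hL
  have hlc : 0 ≤ Real.log (1 + c) := Real.log_nonneg (by linarith)
  refine ⟨C * (8 + Real.log (1 + c)), by positivity, fun r ρ B h1 h2 h3 h4 h5 => ?_⟩
  set σ := (r + ρ) / 2 with hσ
  have hd0 : 0 < ρ - r := by linarith
  have hl2 : 0 ≤ Real.log (1 / (ρ - r)) := log_inv_nonneg h1 h2 h3
  have hl1 := Real.log_nonneg (x := 1 + B) (by linarith)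
  set x := Real.log (1 / (ρ - r)) with hx
  have hlog2 : Real.log 2 ≤ 1 := by have := Real.log_two_lt_d9; linarith
  have hhalf : ρ - σ = (ρ - r) / 2 := by rw [hσ]; ring
  have e0 : Real.log (1 / ((ρ - r) / 2)) ≤ x + 1 := by
    have : 1 / ((ρ - r) / 2) = 2 * (1 / (ρ - r)) := by field_simp
    rw [this, Real.log_mul (by norm_num) (by positivity)]; linarith
  have hb : ∀ s, 1/2 ≤ s → s ≤ σ → mm h s ≤ c * (2 + B + x) := by
    intro s hs1 hs2
    refine (hL s ρ B hs1 (by linarith) h3 h4 h5).trans ?_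
    have : Real.log (1 / (ρ - s)) ≤ x + 1 := by
      refine le_trans ?_ e0
      apply Real.log_le_log (by apply one_div_pos.2; linarith)
      apply one_div_le_one_div_of_le (by linarith)
      rw [← hhalf]; linarith
    exact mul_le_mul_of_nonneg_left (by linarith) hc
  have := H r σ (c * (2 + B + x)) h1 (by linarith) (by linarith) (by positivity) (hb σ (by linarith) le_rfl)
    (hb _ (by linarith) (by linarith))
  refine this.trans ?_
  rw [mul_assoc]
  refine mul_le_mul_of_nonneg_left ?_ hC
  have e1 : Real.log (1 / (σ - r)) ≤ x + 1 := by
    have : σ - r = (ρ - r)/2 := by rw [hσ]; ring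
    rw [this]; exact e0
  have e2 : Real.log (1 + c * (2 + B + x)) ≤ Real.log (1 + c) + Real.log (1 + B) + (x + 1) := by
    have h6 : 1 + c * (2 + B + x) ≤ (1 + c) * (1 + B) * (2 + x) := by
      have := mul_nonneg hc h4
      have := mul_nonneg h4 hl2
      have := mul_nonneg (mul_nonneg hc h4) hl2
      nlinarith
    refine (Real.log_le_log (by positivity) h6).trans ?_
    rw [Real.log_mul (by positivity) (by positivity), Real.log_mul (by positivity) (by positivity)]
    have := Real.log_le_sub_one_of_pos (x := 2 + x) (by linarith)
    linarith
  nlinarith [mul_nonneg hlc hl1, mul_nonneg hlc hl2]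

end NV

open Complex Filter Topology MeasureTheory
open scoped Classical

namespace NV
open Metric Real

def Me (h : ℂ → ℂ) : Prop := ∀ z ∈ ball (0:ℂ) 1, MeromorphicAt h z

lemma FP.me {h : ℂ → ℂ} (hh : FP h) : Me h := fun _ hz => hh.mero hz

lemma Ev.mono {p q : ℂ → Prop} (h : Ev p) (hpq : ∀ z, p z → q z) : Ev q := Filter.Eventually.mono h hpq

lemma Ev.and {p q : ℂ → Prop} (h : Ev p) (h' : Ev q) : Ev fun z => p z ∧ q z := Filter.Eventually.and h h'

lemma Ev_ball : Ev (fun z => z ∈ ball (0:ℂ) 1) := self_mem_codiscreteWithin _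

lemma Ev_of {p : ℂ → Prop} (h : ∀ z, p z) : Ev p := Filter.Eventually.of_forall h

lemma mm_gen {h k₁ k₂ k₃ : ℂ → ℂ} (hh : Me h) (h1 : Me k₁) (h2 : Me k₂) (h3 : Me k₃) {N : ℝ} 
    (he : Ev fun z => log⁺ ‖h z‖ ≤ N * (1 + log⁺ ‖k₁ z‖ + log⁺ ‖k₂ z‖ + log⁺ ‖k₃ z‖)) {r : ℝ} (hr : 1/2 ≤ r) (hr1 : r < 1) :
    mm h r ≤ N * (1 + mm k₁ r + mm k₂ r + mm k₃ r) := by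
  have hr0 : 0 < r := by linarith
  have i1 := mero_ciP h1 hr0 hr1
  have i2 := mero_ciP h2 hr0 hr1
  have i3 := mero_ciP h3 hr0 hr1
  have j1 := ci_const_add 1 i1
  have j2 := j1.add i2
  have j3 := j2.add i3
  refine (avg_mono_ev hr0 hr1 (mero_ciP hh hr0 hr1) (ci_const_mul N j3) he).trans (le_of_eq ?_)
  rw [avg_const_mul]
  congr 1
  refine (circleAverage_fun_add (f₁ := fun z => 1 + log⁺ ‖k₁ z‖ + log⁺ ‖k₂ z‖) j2 i3).trans ?_
  congr 1
  refine (circleAverage_fun_add (f₁ := fun z => 1 + log⁺ ‖k₁ z‖) j1 i2).trans ?_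
  congr 1
  exact avg_const_add 1 i1

lemma SC.cmul {μ φ : ℝ → ℝ} {N : ℝ} (hN : 0 ≤ N) (h : SC μ φ) : SC μ (fun r => N * φ r) := by
  obtain ⟨C, hC, h⟩ := h
  refine ⟨N * C, by positivity, fun r ρ B h1 h2 h3 h4 h5 => ?_⟩
  have := mul_le_mul_of_nonneg_left (h r ρ B h1 h2 h3 h4 h5) hN
  linarith

lemma LC.cmul {μ φ : ℝ → ℝ} {N : ℝ} (hN : 0 ≤ N) (h : LC μ φ) : LC μ (fun r => N * φ r) := by
  obtain ⟨C, hC, h⟩ := h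
  refine ⟨N * C, by positivity, fun r ρ B h1 h2 h3 h4 h5 => ?_⟩
  have := mul_le_mul_of_nonneg_left (h r ρ B h1 h2 h3 h4 h5) hN
  linarith

lemma SC.gen {μ : ℝ → ℝ} {h k₁ k₂ k₃ : ℂ → ℂ} (N : ℝ) (hN : 0 ≤ N) (hh : Me h) (h1 : Me k₁) (h2 : Me k₂) (h3 : Me k₃) 
    (s1 : SC μ (mm k₁)) (s2 : SC μ (mm k₂)) (s3 : SC μ (mm k₃))
    (he : Ev fun z => log⁺ ‖h z‖ ≤ N * (1 + log⁺ ‖k₁ z‖ + log⁺ ‖k₂ z‖ + log⁺ ‖k₃ z‖)) : SC μ (mm h) :=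
  (((((SC.const μ 1).add s1).add s2).add s3).cmul hN).mono fun _ hr hr1 => mm_gen hh h1 h2 h3 he hr hr1

lemma LC.gen {μ : ℝ → ℝ} {h k₁ k₂ k₃ : ℂ → ℂ} (N : ℝ) (hN : 0 ≤ N) (hh : Me h) (h1 : Me k₁) (h2 : Me k₂) (h3 : Me k₃) 
    (s1 : LC μ (mm k₁)) (s2 : LC μ (mm k₂)) (s3 : LC μ (mm k₃))
    (he : Ev fun z => log⁺ ‖h z‖ ≤ N * (1 + log⁺ ‖k₁ z‖ + log⁺ ‖k₂ z‖ + log⁺ ‖k₃ z‖)) : LC μ (mm h) :=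
  (((((LC.const μ 1).add s1).add s2).add s3).cmul hN).mono fun _ hr hr1 => mm_gen hh h1 h2 h3 he hr hr1

lemma Me.const (c : ℂ) : Me (fun _ => c) := fun z _ => MeromorphicAt.const c z

lemma SC.mconst (μ : ℝ → ℝ) (c : ℂ) : SC μ (mm fun _ => c) :=
  (SC.const μ (log⁺ ‖c‖)).mono fun r _ _ => by simp [mm, circleAverage_const]

/-- multiplicative bound via maxima -/
lemma posLog_le_of_le {x y : ℝ} (hx : 0 ≤ x) (h : x ≤ y) : log⁺ x ≤ log⁺ y := posLog_le_posLog hx h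

lemma le_exp_posLog {x : ℝ} : x ≤ Real.exp (log⁺ x) := by
  rcases le_or_gt x 0 with h | h
  · exact h.trans (Real.exp_pos _).le
  · have : Real.log x ≤ log⁺ x := by rw [posLog_apply]; exact le_max_right _ _
    calc x = Real.exp (Real.log x) := (Real.exp_log h).symm
      _ ≤ _ := Real.exp_le_exp.2 this

lemma posLog_le_of_exp {x y : ℝ} (hy : 0 ≤ y) (hx : 0 ≤ x) (h : x ≤ Real.exp y) : log⁺ x ≤ y := by
  rcases hx.eq_or_lt with h0 | h0
  · rw [← h0]; simpa using hy
  rw [posLog_apply]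
  exact max_le hy (by rwa [Real.log_le_iff_le_exp h0])

lemma one_le_exp_posLog (x : ℝ) : 1 ≤ Real.exp (log⁺ x) := Real.one_le_exp posLog_nonneg

/-- main pointwise tool: if `x ≤ N * X₁ X₂ X₃` with `Xᵢ = max 1 kᵢ` -/
lemma posLog_prod3 {x a b c : ℝ} (n : ℝ) (hn : 0 ≤ n) (hx : 0 ≤ x)
    (h : x ≤ Real.exp n * (Real.exp (log⁺ a) * Real.exp (log⁺ b) * Real.exp (log⁺ c))) :
    log⁺ x ≤ n + log⁺ a + log⁺ b + log⁺ c := by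
  apply posLog_le_of_exp _ hx
  · refine h.trans (le_of_eq ?_)
    rw [← Real.exp_add, ← Real.exp_add, ← Real.exp_add]; congr 1; ring
  · have := posLog_nonneg (x := a)
    have := posLog_nonneg (x := b)
    have := posLog_nonneg (x := c)
    positivity

lemma fp_const_of_deriv {c : ℂ → ℂ} (hc : FP c) (h : Ev fun z => deriv c z = 0) : ∃ k : ℂ, Ev fun z => c z = k := by
  obtain ⟨z0, hz0b, hz0⟩ : ∃ z0 ∈ ball (0:ℂ) 1, AnalyticAt ℂ c z0 := by
    have := Ev_iff.1 (hc.evAn.and Ev_ball) 0 (by simp)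
    obtain ⟨z, hz⟩ := this.exists
    exact ⟨z, hz.2, hz.1⟩
  refine ⟨c z0, ?_⟩
  have hd : ∀ᶠ z in 𝓝 z0, deriv c z = 0 := by
    have h1 := Ev_iff.1 h z0 hz0b
    exact (hz0.deriv.frequently_zero_iff_eventually_zero).1 h1.frequently
  have hconst : ∀ᶠ z in 𝓝 z0, c z = c z0 := by
    obtain ⟨ε, hε, hb⟩ := Metric.eventually_nhds_iff_ball.1 (hd.and hz0.eventually_analyticAt)
    filter_upwards [ball_mem_nhds z0 hε] with z hz
    have hdo : DifferentiableOn ℂ c (ball z0 ε) := fun w hw => (hb w hw).2.differentiableAt.differentiableWithinAt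
    exact isOpen_ball.is_const_of_deriv_eq_zero (convex_ball z0 ε).isPreconnected hdo
      (fun w hw => (hb w hw).1) hz (mem_ball_self hε)
  have hsub : FP (fun z => c z - c z0) := hc.sub (FP.const _)
  rcases hsub.dich with hN | h0
  · exfalso
    apply hN z0 hz0b
    rw [meromorphicOrderAt_eq_top_iff]
    exact (hconst.mono fun z hz => by simp [hz]).filter_mono nhdsWithin_le_nhds
  · exact h0.mono fun z hz => by simpa [sub_eq_zero] using hz

end NV

open Complex Filter Topology MeasureTheory
open scoped Classical

namespace NV
open Metric Real

lemma pl_mul (x y : ℂ) : log⁺ ‖x * y‖ ≤ log⁺ ‖x‖ + log⁺ ‖y‖ := by rw [norm_mul]; exact posLog_mul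
lemma pl_add (x y : ℂ) : log⁺ ‖x + y‖ ≤ log⁺ ‖x‖ + log⁺ ‖y‖ + 1 := by
  have := posLog_norm_add_le x y
  have := Real.log_two_lt_d9
  linarith
lemma pl_neg (x : ℂ) : log⁺ ‖-x‖ = log⁺ ‖x‖ := by rw [norm_neg]
lemma pl_sub (x y : ℂ) : log⁺ ‖x - y‖ ≤ log⁺ ‖x‖ + log⁺ ‖y‖ + 1 := by
  have := pl_add x (-y)
  rw [pl_neg] at this
  rwa [sub_eq_add_neg]
lemma pl_small (x : ℂ) (hx : ‖x‖ ≤ 2) : log⁺ ‖x‖ ≤ 1 := by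
  refine (posLog_le_posLog (norm_nonneg x) hx).trans ?_
  rw [posLog_apply]
  have := Real.log_two_lt_d9
  exact max_le (by norm_num) (by linarith)

lemma mm_inv {h : ℂ → ℂ} (hh : Me h) {r : ℝ} (hr : 1/2 ≤ r) (hr1 : r < 1) : 
    mm h r = circleAverage (fun z => Real.log ‖h z‖) 0 r + mm (fun z => (h z)⁻¹) r := by
  have hr0 : 0 < r := by linarith
  have hI : CircleIntegrable (fun z => Real.log ‖h z‖) 0 r :=
    MeromorphicOn.circleIntegrable_log_norm fun z hz => hh z (sph_sub hr0 hr1 hz)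
  have hinv : Me fun z => (h z)⁻¹ := fun z hz => (hh z hz).inv
  have := circleAverage_fun_add hI (mero_ciP hinv hr0 hr1)
  rw [mm, mm, ← this]
  congr 1
  funext z
  have := posLog_sub_posLog_inv (x := ‖h z‖)
  rw [norm_inv]; linarith

lemma SC.inv {μ : ℝ → ℝ} {h : ℂ → ℂ} (hh : FP h) (hN : NZ h) (hS : SC μ (mm h)) : SC μ (mm fun z => (h z)⁻¹) := by
  obtain ⟨C, hC, hJ⟩ := hh.jensen0 hN
  refine (hS.add (SC.const μ C)).mono fun r h1 h2 => ?_
  have := mm_inv hh.me h1 h2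
  have := hJ r h1 h2
  linarith

section
variable {q ℓ : ℂ → ℂ}

/-- Clunie type argument. -/
theorem clunie (hq : ∀ z ∈ ball (0:ℂ) 1, AnalyticAt ℂ q z) (hq2 : ∀ z ∈ ball (0:ℂ) 1, ‖q z‖ ≤ 2)
    (hq0 : ∀ z ∈ ball (0:ℂ) 1, q z ≠ 0) (hl : FP ℓ) (haN : NZ fun z => q z * deriv ℓ z + ℓ z ^ 2)
    (hai : FP fun z => (q z * deriv ℓ z + ℓ z ^ 2)⁻¹) : 
    SC (mm ℓ) (mm ℓ) ∧ LC (mm ℓ) (mm fun z => q z * deriv ℓ z + ℓ z ^ 2) := by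
  set μ := mm ℓ with hμ
  have hqF : FP q := FP.of_analytic hq
  set dl : ℂ → ℂ := fun z => q z * deriv ℓ z with hdl
  have hdlF : FP dl := hqF.mul hl.deriv
  set ddl : ℂ → ℂ := fun z => q z * deriv dl z with hddl
  have hddlF : FP ddl := hqF.mul hdlF.deriv
  set a : ℂ → ℂ := fun z => q z * deriv ℓ z + ℓ z ^ 2 with ha
  have haF : FP a := hdlF.add (hl.pow 2)
  set b : ℂ → ℂ := fun z => q z * deriv a z * (a z)⁻¹ with hb
  have hbF : FP b := (hqF.mul haF.deriv).mul hai
  have hane := haN.ev haF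
  -- ℓ is not identically zero
  have hlN : NZ ℓ := by
    rcases hl.dich with h | h
    · exact h
    exfalso
    have hd : Ev fun z => deriv ℓ z = 0 := by
      rw [Ev_iff] at h ⊢
      intro x hx
      have : ℓ =ᶠ[𝓝[≠] x] fun _ => 0 := h x hx
      have := this.nhdsNE_deriv
      filter_upwards [this] with z hz
      rw [hz]; simp
    refine not_ev_both (p := fun z => a z = 0) ?_ hane
    exact (h.and hd).mono fun z hz => by simp [ha, hz.1, hz.2]
  have hlne := hlN.ev hl
  -- LDL with δ
  have ldl : ∀ h : ℂ → ℂ, FP h → LC μ (mm h) → SC μ (mm fun z => (q z * deriv h z) / h z) := by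
    intro h hh hL
    have hm : Me fun z => deriv h z / h z := fun z hz => (hh.mero hz).deriv.div (hh.mero hz)
    refine SC.gen (k₁ := fun z => deriv h z / h z) (k₂ := fun _ => 0) (k₃ := fun _ => 0) 1 (by norm_num) 
      (fun z hz => ((hq z hz).meromorphicAt.mul (hh.mero hz).deriv).div (hh.mero hz)) hm (Me.const 0) (Me.const 0) 
      (hh.ldl hL) (SC.mconst μ 0) (SC.mconst μ 0) ?_
    refine Ev_ball.mono fun z hz => ?_
    have := pl_mul (q z) (deriv h z / h z)
    have := pl_small _ (hq2 z hz)
    rw [mul_div_assoc]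
    simp only [norm_zero, posLog_zero]; linarith
  have hmdiv : ∀ h k : ℂ → ℂ, FP h → FP k → Me fun z => h z / k z := fun h k hh hk z hz => (hh.mero hz).div (hk.mero hz)
  set x : ℂ → ℂ := fun z => dl z / ℓ z with hx
  have hxS : SC μ (mm x) := ldl ℓ hl LC.self
  have hxM : Me x := hmdiv _ _ hdlF hl
  have hdlL : LC μ (mm dl) := by
    refine LC.gen (k₁ := x) (k₂ := ℓ) (k₃ := fun _ => 0) 1 (by norm_num) hdlF.me hxM hl.me (Me.const 0) hxS.toLC LC.self
      (SC.mconst μ 0).toLC ?_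
    refine hlne.mono fun z hz => ?_
    have := pl_mul (x z) (ℓ z)
    have e : x z * ℓ z = dl z := by simp only [hx]; field_simp
    rw [e] at this
    simp; linarith
  set y : ℂ → ℂ := fun z => ddl z / dl z with hy
  have hyS : SC μ (mm y) := ldl dl hdlF hdlL
  have hyM : Me y := hmdiv _ _ hddlF hdlF
  have haL : LC μ (mm a) := by
    refine LC.gen (k₁ := dl) (k₂ := ℓ) (k₃ := fun _ => 0) 2 (by norm_num) haF.me hdlF.me hl.me (Me.const 0) hdlL LC.self
      (SC.mconst μ 0).toLC ?_
    refine Ev_of fun z => ?_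
    have h1 := pl_add (dl z) (ℓ z ^ 2)
    rw [norm_pow, posLog_pow] at h1
    have e : dl z + ℓ z ^ 2 = a z := rfl
    rw [e] at h1
    have := posLog_nonneg (x := ‖dl z‖)
    push_cast at h1
    simp; linarith
  have hbS : SC μ (mm b) := by
    have := ldl a haF haL
    refine this.mono fun r _ _ => le_of_eq ?_
    congr 1
  refine ⟨?_, haL⟩
  -- Φ
  set Φ : ℂ → ℂ := fun z => b z * ℓ z - 2 * dl z with hΦ
  have hΦF : FP Φ := (hbF.mul hl).sub (hdlF.cmul 2)
  have hda : Ev fun z => q z * deriv a z = ddl z + 2 * ℓ z * dl z := by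
    refine (hdlF.evAn.and hl.evAn).mono fun z hz => ?_
    have h1 : HasDerivAt a (deriv dl z + 2 * ℓ z ^ 1 * deriv ℓ z) z := 
      hz.1.differentiableAt.hasDerivAt.add ((hz.2.differentiableAt.hasDerivAt.pow 2).congr_deriv (by simp))
    rw [h1.deriv]
    simp only [hddl, hdl]; ring
  have hba : Ev fun z => q z * deriv a z = b z * a z := by
    refine hane.mono fun z hz => ?_
    simp only [hb]; field_simp
  have hlΦ : Ev fun z => ℓ z * Φ z = ddl z - b z * dl z := by
    refine (hda.and hba).mono fun z hz => ?_
    have h1 := hz.1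
    rw [hz.2] at h1
    have h2 : a z = dl z + ℓ z ^ 2 := rfl
    rw [h2] at h1
    simp only [hΦ]
    linear_combination h1
  have hddl0 : Ev fun z => ddl z = y z * dl z := by
    rcases hdlF.dich with h | h
    · refine (h.ev hdlF).mono fun z hz => ?_
      simp only [hy]; field_simp
    · have hd : Ev fun z => deriv dl z = 0 := by
        rw [Ev_iff] at h ⊢
        intro x hx
        have : dl =ᶠ[𝓝[≠] x] fun _ => 0 := h x hx
        have := this.nhdsNE_deriv
        filter_upwards [this] with z hz
        rw [hz]; simp
      exact (h.and hd).mono fun z hz => by simp [hddl, hz.1, hz.2]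
  have hΦS : SC μ (mm Φ) := by
    refine SC.gen (k₁ := b) (k₂ := x) (k₃ := y) 2 (by norm_num) hΦF.me hbF.me hxM hyM hbS hxS hyS ?_
    refine ((hlΦ.and hddl0).and hlne).mono fun z hz => ?_
    obtain ⟨⟨h1, h2⟩, h3⟩ := hz
    have hxl : dl z = x z * ℓ z := by simp only [hx]; field_simp
    have e1 := one_le_exp_posLog ‖b z‖
    have e2 := one_le_exp_posLog ‖x z‖
    have e3 := one_le_exp_posLog ‖y z‖
    have f1 := le_exp_posLog (x := ‖b z‖)
    have f2 := le_exp_posLog (x := ‖x z‖)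
    have f3 := le_exp_posLog (x := ‖y z‖)
    set X := Real.exp (log⁺ ‖b z‖)
    set Y := Real.exp (log⁺ ‖x z‖)
    set Z := Real.exp (log⁺ ‖y z‖)
    have n1 := norm_nonneg (b z)
    have n2 := norm_nonneg (x z)
    have n3 := norm_nonneg (y z)
    have hXY : X ≤ X * Y * Z := by
      have : 1 ≤ Y * Z := one_le_mul_of_one_le_of_one_le e2 e3
      nlinarith
    have hYZ : Y ≤ X * Y * Z := by
      have : 1 ≤ X * Z := one_le_mul_of_one_le_of_one_le e1 e3
      nlinarith
    have key : ‖Φ z‖ ≤ 3 * (X * Y * Z) := by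
      rcases le_total ‖ℓ z‖ 1 with hle | hle
      · have : ‖Φ z‖ ≤ ‖b z‖ * ‖ℓ z‖ + 2 * (‖x z‖ * ‖ℓ z‖) := by
          simp only [hΦ]
          refine (norm_sub_le _ _).trans ?_
          rw [hxl, norm_mul, norm_mul, norm_mul]; simp
        have g1 : ‖b z‖ * ‖ℓ z‖ ≤ X := by nlinarith [norm_nonneg (ℓ z)]
        have g2 : ‖x z‖ * ‖ℓ z‖ ≤ Y := by nlinarith [norm_nonneg (ℓ z)]
        linarith
      · have : Φ z = y z * x z - b z * x z := by
          have : ℓ z * Φ z = ℓ z * (y z * x z - b z * x z) := by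
            rw [h1, h2, hxl]; ring
          exact mul_left_cancel₀ h3 this
        rw [this]
        refine (norm_sub_le _ _).trans ?_
        rw [norm_mul, norm_mul]
        have g1 : ‖y z‖ * ‖x z‖ ≤ X * Y * Z := by
          calc ‖y z‖ * ‖x z‖ ≤ Z * Y := by gcongr
            _ ≤ X * Y * Z := by nlinarith [mul_nonneg (zero_le_one.trans e2) (zero_le_one.trans e3)]
        have g2 : ‖b z‖ * ‖x z‖ ≤ X * Y * Z := by
          calc ‖b z‖ * ‖x z‖ ≤ X * Y := by gcongr
            _ ≤ X * Y * Z := by nlinarith [mul_nonneg (zero_le_one.trans e2) (zero_le_one.trans e1)]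
        have : 0 ≤ X * Y * Z := by positivity
        linarith
    have h3e : (3:ℝ) ≤ Real.exp 2 := by
      have := Real.add_one_le_exp (2:ℝ)
      linarith
    have := posLog_prod3 (x := ‖Φ z‖) (a := ‖b z‖) (b := ‖x z‖) (c := ‖y z‖) 2 (by norm_num) (norm_nonneg _) 
      (key.trans (by gcongr))
    have p1 := posLog_nonneg (x := ‖b z‖)
    have p2 := posLog_nonneg (x := ‖x z‖)
    have p3 := posLog_nonneg (x := ‖y z‖)
    linarith
  -- D
  set D : ℂ → ℂ := fun z => (1/2) * Φ z + (1/16) * b z ^ 2 with hD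
  have hDF : FP D := (hΦF.cmul _).add ((hbF.pow 2).cmul _)
  have hDS : SC μ (mm D) := by
    refine SC.gen (k₁ := Φ) (k₂ := b) (k₃ := fun _ => 0) 4 (by norm_num) hDF.me hΦF.me hbF.me (Me.const 0) hΦS hbS
      (SC.mconst μ 0) (Ev_of fun z => ?_)
    have h1 := pl_add ((1/2) * Φ z) ((1/16) * b z ^ 2)
    have h2 := pl_mul (1/2) (Φ z)
    have h3 := pl_mul (1/16) (b z ^ 2)
    have h4 := pl_small (1/2) (by simp; norm_num)
    have h5 := pl_small (1/16) (by simp; norm_num)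
    rw [norm_pow, posLog_pow] at h3
    have := posLog_nonneg (x := ‖Φ z‖)
    have := posLog_nonneg (x := ‖b z‖)
    push_cast at h3
    have e : D z = (1/2) * Φ z + (1/16) * b z ^ 2 := rfl
    rw [e]
    simp only [norm_zero, posLog_zero]
    linarith
  set V : ℂ → ℂ := fun z => ℓ z + (1/4) * b z with hV
  have hVF : FP V := hl.add (hbF.cmul _)
  have hV2 : ∀ z, V z ^ 2 = a z + D z := by
    intro z
    have h2 : a z = dl z + ℓ z ^ 2 := rfl
    rw [h2]
    simp only [hV, hD, hΦ]; ring
  set E : ℂ → ℂ := fun z => q z * deriv D z - b z * D z with hE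
  have hEF : FP E := (hqF.mul hDF.deriv).sub (hbF.mul hDF)
  set U : ℂ → ℂ := fun z => 2 * (q z * deriv V z) - b z * V z with hU
  have hUF : FP U := ((hqF.mul hVF.deriv).cmul 2).sub (hbF.mul hVF)
  have hdV : Ev fun z => 2 * V z * (q z * deriv V z) = b z * a z + q z * deriv D z := by
    refine ((hVF.evAn.and (haF.evAn.and hDF.evAn)).and hba).mono fun z hz => ?_
    obtain ⟨⟨h1, h2, h3⟩, h4⟩ := hz
    have d1 : HasDerivAt (fun z => V z ^ 2) (2 * V z ^ 1 * deriv V z) z :=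
      (h1.differentiableAt.hasDerivAt.pow 2).congr_deriv (by simp)
    have d2 : HasDerivAt (fun z => a z + D z) (deriv a z + deriv D z) z := 
      h2.differentiableAt.hasDerivAt.add h3.differentiableAt.hasDerivAt
    have e : (fun z => V z ^ 2) = fun z => a z + D z := funext hV2
    rw [e] at d1
    have := d1.unique d2
    linear_combination q z * this + h4
  have hVU : Ev fun z => V z * U z = E z := by
    refine hdV.mono fun z hz => ?_
    have := hV2 z
    simp only [hU, hE]
    linear_combination hz - b z * this
  have hES : SC μ (mm E) := by
    have hdD := ldl D hDF hDS.toLC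
    refine SC.gen (k₁ := fun z => q z * deriv D z / D z) (k₂ := b) (k₃ := D) 2 (by norm_num) hEF.me 
      (hmdiv _ _ (hqF.mul hDF.deriv) hDF) hbF.me hDF.me hdD hbS hDS ?_
    rcases hDF.dich with h | h
    · refine (h.ev hDF).mono fun z hz => ?_
      have e : E z = (q z * deriv D z / D z - b z) * D z := by simp only [hE]; field_simp
      rw [e]
      have h1 := pl_mul (q z * deriv D z / D z - b z) (D z)
      have h2 := pl_sub (q z * deriv D z / D z) (b z)
      have := posLog_nonneg (x := ‖q z * deriv D z / D z‖)
      have := posLog_nonneg (x := ‖b z‖)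
      have := posLog_nonneg (x := ‖D z‖)
      linarith
    · have hd : Ev fun z => deriv D z = 0 := by
        rw [Ev_iff] at h ⊢
        intro x hx
        have : D =ᶠ[𝓝[≠] x] fun _ => 0 := h x hx
        have := this.nhdsNE_deriv
        filter_upwards [this] with z hz
        rw [hz]; simp
      refine (h.and hd).mono fun z hz => ?_
      have e : E z = 0 := by simp [hE, hz.1, hz.2]
      rw [e, norm_zero, posLog_zero]
      have := posLog_nonneg (x := ‖q z * deriv D z / D z‖)
      have := posLog_nonneg (x := ‖b z‖)
      have := posLog_nonneg (x := ‖D z‖)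
      linarith
  rcases hEF.dich with hEN | hE0
  · -- E not identically zero
    have hEne := hEN.ev hEF
    have hUN : NZ U := NZ.of_ev hUF ((hVU.and hEne).mono fun z hz h0 => hz.2 (by rw [← hz.1, h0, mul_zero]))
    have hVN : NZ V := NZ.of_ev hVF ((hVU.and hEne).mono fun z hz h0 => hz.2 (by rw [← hz.1, h0, zero_mul]))
    obtain ⟨C, hC, hJ⟩ := hUF.jensen0 hUN
    have hmean : SC μ (fun r => circleAverage (fun z => Real.log ‖V z‖) 0 r) := by
      refine (hES.add (SC.const μ C)).mono fun r h1 h2 => ?_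
      have hr0 : 0 < r := by linarith
      have e1 : circleAverage (fun z => Real.log ‖E z‖) 0 r = 
          circleAverage (fun z => Real.log ‖V z‖ + Real.log ‖U z‖) 0 r := by
        refine circleAverage_congr_codiscreteWithin ?_ hr0.ne'
        refine sphere_cod (sph_sub hr0 h2) ?_
        refine (hVU.and ((hVN.ev hVF).and (hUN.ev hUF))).mono fun z hz => ?_
        change Real.log ‖E z‖ = Real.log ‖V z‖ + Real.log ‖U z‖
        rw [← hz.1, norm_mul, Real.log_mul (by simpa using hz.2.1) (by simpa using hz.2.2)]
      rw [circleAverage_fun_add (hVF.ciL hr0 h2) (hUF.ciL hr0 h2)] at e1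
      have := hEF.meanlog_le hr0 h2
      have := hJ r h1 h2
      linarith
    have hVL : LC μ (mm V) := by
      refine LC.gen (k₁ := ℓ) (k₂ := b) (k₃ := fun _ => 0) 2 (by norm_num) hVF.me hl.me hbF.me (Me.const 0) LC.self
        hbS.toLC (SC.mconst μ 0).toLC (Ev_of fun z => ?_)
      have h1 := pl_add (ℓ z) ((1/4) * b z)
      have h2 := pl_mul (1/4) (b z)
      have h3 := pl_small (1/4) (by simp; norm_num)
      have := posLog_nonneg (x := ‖ℓ z‖)
      have := posLog_nonneg (x := ‖b z‖)
      have e : V z = ℓ z + (1/4) * b z := rfl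
      rw [e]
      simp only [norm_zero, posLog_zero]
      linarith
    have hdV' := ldl V hVF hVL
    have hVi : SC μ (mm fun z => (V z)⁻¹) := by
      refine SC.gen (k₁ := fun z => q z * deriv V z / V z) (k₂ := b) (k₃ := fun z => (E z)⁻¹) 2 (by norm_num) 
        (fun z hz => (hVF.mero hz).inv) (hmdiv _ _ (hqF.mul hVF.deriv) hVF) hbF.me (fun z hz => (hEF.mero hz).inv)
        hdV' hbS (SC.inv hEF hEN hES) ?_
      refine (hVU.and (hEne.and (hVN.ev hVF))).mono fun z hz => ?_
      obtain ⟨h1, h2, h3⟩ := hz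
      have e : (V z)⁻¹ ^ 2 = (2 * (q z * deriv V z / V z) - b z) * (E z)⁻¹ := by
        have h4 : (2 * (q z * deriv V z / V z) - b z) = U z / V z := by
          simp only [hU]; field_simp
        have h5 : U z ≠ 0 := by rintro h; apply h2; rw [← h1, h, mul_zero]
        rw [h4, ← h1]; field_simp
      have h6 : log⁺ ‖(V z)⁻¹ ^ 2‖ = 2 * log⁺ ‖(V z)⁻¹‖ := by rw [norm_pow, posLog_pow]; norm_num
      have h7 := pl_mul (2 * (q z * deriv V z / V z) - b z) (E z)⁻¹
      have h8 := pl_sub (2 * (q z * deriv V z / V z)) (b z)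
      have h9 := pl_mul 2 (q z * deriv V z / V z)
      have h10 := pl_small 2 (by simp)
      rw [← e, h6] at h7
      have := posLog_nonneg (x := ‖q z * deriv V z / V z‖)
      have := posLog_nonneg (x := ‖b z‖)
      have := posLog_nonneg (x := ‖(E z)⁻¹‖)
      linarith
    have hVS : SC μ (mm V) := (hmean.add hVi).mono fun r h1 h2 => (mm_inv hVF.me h1 h2).le
    refine SC.gen (k₁ := V) (k₂ := b) (k₃ := fun _ => 0) 2 (by norm_num) hl.me hVF.me hbF.me (Me.const 0) hVS hbS
      (SC.mconst μ 0) (Ev_of fun z => ?_)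
    have h1 := pl_sub (V z) ((1/4) * b z)
    have h2 := pl_mul (1/4) (b z)
    have h3 := pl_small (1/4) (by simp; norm_num)
    have := posLog_nonneg (x := ‖V z‖)
    have := posLog_nonneg (x := ‖b z‖)
    have e : V z - (1/4) * b z = ℓ z := by simp [hV]
    rw [e] at h1
    simp only [norm_zero, posLog_zero]
    linarith
  · -- E identically zero
    have hex : ∃ D₀ : ℂ → ℂ, FP D₀ ∧ NZ D₀ ∧ SC μ (mm D₀) ∧ Ev fun z => q z * deriv D₀ z = b z * D₀ z := by
      rcases hDF.dich with hDN | hD0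
      · exact ⟨D, hDF, hDN, hDS, hE0.mono fun z hz => by simpa [hE, sub_eq_zero] using hz⟩
      rcases hbF.dich with hbN | hb0
      · have hbne := hbN.ev hbF
        refine ⟨fun z => b z ^ 4, hbF.pow 4, NZ.of_ev (hbF.pow 4) (hbne.mono fun z hz => pow_ne_zero 4 hz), ?_, ?_⟩
        · refine SC.gen (k₁ := b) (k₂ := fun _ => 0) (k₃ := fun _ => 0) 4 (by norm_num) (hbF.pow 4).me hbF.me (Me.const 0)
            (Me.const 0) hbS (SC.mconst μ 0) (SC.mconst μ 0) (Ev_of fun z => ?_)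
          rw [norm_pow, posLog_pow]; push_cast; simp
        · have hdD : Ev fun z => deriv D z = 0 := by
            have h := hD0
            rw [Ev_iff] at h ⊢
            intro x hx
            have : D =ᶠ[𝓝[≠] x] fun _ => 0 := h x hx
            have := this.nhdsNE_deriv
            filter_upwards [this] with z hz
            rw [hz]; simp
          refine (((hD0.and hdD).and (hdV.and hane)).and (hl.evAn.and hbF.evAn)).mono fun z hz => ?_
          obtain ⟨⟨⟨h1, h2⟩, h3, h4⟩, h5, h6⟩ := hz
          have hVz : V z ^ 2 = a z := by rw [hV2 z, h1, add_zero]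
          have hVne : V z ≠ 0 := by rintro h; apply h4; rw [← hVz, h]; simp
          rw [h2, mul_zero, add_zero, ← hVz] at h3
          have h7 : q z * deriv V z = b z * V z / 2 := by
            have : V z * (2 * (q z * deriv V z)) = V z * (b z * V z) := by linear_combination h3
            have := mul_left_cancel₀ hVne this
            linear_combination this / 2
          have h8 : deriv V z = deriv ℓ z + (1/4) * deriv b z := 
            (h5.differentiableAt.hasDerivAt.add (h6.differentiableAt.hasDerivAt.const_mul (1/4))).deriv
          rw [h8] at h7
          have h9 : HasDerivAt (fun z => b z ^ 4) (4 * b z ^ 3 * deriv b z) z := 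
            (h6.differentiableAt.hasDerivAt.pow 4).congr_deriv (by simp)
          rw [h9.deriv]
          have h10 : (1/2) * (b z * ℓ z - 2 * (q z * deriv ℓ z)) + (1/16) * b z ^ 2 = 0 := h1
          have h11 : q z * deriv b z = b z ^ 2 / 4 := by
            have h12 : V z = ℓ z + (1/4) * b z := rfl
            rw [h12] at h7
            linear_combination 4 * h7 + 4 * h10
          linear_combination 4 * b z ^ 3 * h11
      · refine ⟨fun _ => 1, FP.const 1, NZ.of_ev (FP.const 1) (Ev_of fun z => one_ne_zero), SC.mconst μ 1, ?_⟩
        exact hb0.mono fun z hz => by simp [hz]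
    obtain ⟨D₀, hF, hN, hS, hder⟩ := hex
    have hcF : FP fun z => D₀ z * (a z)⁻¹ := hF.mul hai
    obtain ⟨k, hk⟩ := fp_const_of_deriv hcF (by
      refine (((hder.and hba).and (hF.evAn.and haF.evAn)).and (hane.and Ev_ball)).mono fun z hz => ?_
      obtain ⟨⟨⟨h1, h2⟩, h3, h4⟩, h5, h6⟩ := hz
      have h7 := (h3.differentiableAt.hasDerivAt.fun_mul (h4.differentiableAt.hasDerivAt.fun_inv h5)).deriv
      rw [h7]
      have h8 := hq0 z h6
      have h9 : q z * (deriv D₀ z * (a z)⁻¹ + D₀ z * (-deriv a z / a z ^ 2)) = 0 := by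
        have : q z * (deriv D₀ z * (a z)⁻¹ + D₀ z * (-deriv a z / a z ^ 2)) = 
          (q z * deriv D₀ z) * (a z)⁻¹ - D₀ z * (q z * deriv a z) * ((a z)⁻¹ * (a z)⁻¹) := by ring
        rw [this, h1, h2]
        have : a z * (a z)⁻¹ = 1 := mul_inv_cancel₀ h5
        linear_combination (- D₀ z * b z * (a z)⁻¹) * this
      exact (mul_eq_zero.1 h9).resolve_left h8)
    have haS : SC μ (mm a) := by
      refine SC.gen (k₁ := D₀) (k₂ := fun _ => k⁻¹) (k₃ := fun _ => 0) 1 (by norm_num) haF.me hF.me (Me.const _) (Me.const 0)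
        hS (SC.mconst μ _) (SC.mconst μ 0) ?_
      refine (hk.and (hane.and (hN.ev hF))).mono fun z hz => ?_
      obtain ⟨h1, h2, h3⟩ := hz
      have hk0 : k ≠ 0 := by rw [← h1]; exact mul_ne_zero h3 (inv_ne_zero h2)
      have e : a z = D₀ z * k⁻¹ := by rw [← h1]; field_simp
      have := pl_mul (D₀ z) k⁻¹
      rw [e]
      simp only [norm_zero, posLog_zero]
      linarith
    refine SC.gen (k₁ := a) (k₂ := x) (k₃ := fun _ => 0) 1 (by norm_num) hl.me haF.me hxM (Me.const 0) haS hxS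
      (SC.mconst μ 0) ?_
    refine hlne.mono fun z hz => ?_
    have p1 := posLog_nonneg (x := ‖a z‖)
    have p2 := posLog_nonneg (x := ‖x z‖)
    simp only [norm_zero, posLog_zero, one_mul, add_zero]
    rcases le_total ‖ℓ z‖ 1 with h1 | h1
    · have : log⁺ ‖ℓ z‖ = 0 := by rw [posLog_eq_zero_iff]; rwa [abs_norm]
      linarith
    · have e : ℓ z = a z * (ℓ z)⁻¹ - x z := by
        have h2 : a z = dl z + ℓ z ^ 2 := rfl
        rw [h2]; simp only [hx]; field_simp; ring
      have h3 := pl_sub (a z * (ℓ z)⁻¹) (x z)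
      rw [← e] at h3
      have h4 : log⁺ ‖a z * (ℓ z)⁻¹‖ ≤ log⁺ ‖a z‖ := by
        apply posLog_le_posLog (norm_nonneg _)
        rw [norm_mul, norm_inv]
        exact mul_le_of_le_one_right (norm_nonneg _) (inv_le_one_of_one_le₀ h1)
      linarith
end

end NV

open Complex Filter Topology MeasureTheory
open scoped Classical

namespace NV
open Metric Real

def GR (φ : ℝ → ℝ) : Prop := ∃ C : ℝ, 0 ≤ C ∧ ∀ r : ℝ, 1/2 ≤ r → r < 1 → φ r ≤ C * (1 + Real.log (1 / (1 - r)))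

lemma half_log {r : ℝ} (hr1 : r < 1) : Real.log (1 / ((1 - r) / 2)) ≤ 1 + Real.log (1 / (1 - r)) := by
  have h0 : 0 < 1 - r := by linarith
  have : 1 / ((1 - r) / 2) = 2 * (1 / (1 - r)) := by field_simp
  rw [this, Real.log_mul (by norm_num) (by positivity)]
  have := Real.log_two_lt_d9
  linarith

lemma log_inv1_nonneg {r : ℝ} (hr : 1/2 ≤ r) (hr1 : r < 1) : 0 ≤ Real.log (1 / (1 - r)) := by
  apply Real.log_nonneg
  rw [le_div_iff₀ (by linarith)]; linarith

lemma LC.toGR {μ φ : ℝ → ℝ} (h : LC μ φ) (hμ : GR μ) : GR φ := by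
  obtain ⟨C, hC, h⟩ := h
  obtain ⟨c, hc, hμ⟩ := hμ
  refine ⟨C * (2 + 2 * c), by positivity, fun r h1 h2 => ?_⟩
  have hl := log_inv1_nonneg h1 h2
  set x := Real.log (1 / (1 - r)) with hx
  have hh := half_log h2
  have := h r ((1 + r)/2) (c * (2 + x)) h1 (by linarith) (by linarith) (by positivity) (by
    intro s hs1 hs2
    refine (hμ s hs1 (by linarith)).trans ?_
    apply mul_le_mul_of_nonneg_left _ hc
    have : Real.log (1 / (1 - s)) ≤ Real.log (1 / ((1 - r) / 2)) := by
      apply Real.log_le_log (by apply one_div_pos.2; linarith)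
      apply one_div_le_one_div_of_le <;> linarith
    linarith)
  refine this.trans ?_
  rw [mul_assoc]
  apply mul_le_mul_of_nonneg_left _ hC
  have e : (1 + r) / 2 - r = (1 - r) / 2 := by ring
  rw [e]
  nlinarith [mul_nonneg hc hl]

lemma iterate {μ : ℝ → ℝ} (h : SC μ μ) (h0 : ∀ s, 0 ≤ μ s)
    (hb : ∀ ρ : ℝ, ρ < 1 → ∃ B : ℝ, 0 ≤ B ∧ ∀ s, 1/2 ≤ s → s ≤ ρ → μ s ≤ B) : GR μ := by
  obtain ⟨C, hC, h⟩ := h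
  -- the universal bound
  set Λ₀ : ℝ := 2 * C * (5 + Real.log (4 * C + 1)) + 1 with hΛ₀
  have hl4 : 0 ≤ Real.log (4 * C + 1) := Real.log_nonneg (by linarith)
  have hΛ0 : 0 ≤ Λ₀ := by positivity
  have key : ∀ σ : ℝ, 1/2 < σ → σ < 1 → ∀ s, 1/2 ≤ s → s < σ → μ s ≤ Λ₀ * (1 + Real.log (1 / (σ - s))) := by
    intro σ hσ hσ1
    have hxpos : ∀ s, 1/2 ≤ s → s < σ → 0 ≤ Real.log (1 / (σ - s)) := fun s h1 h2 => log_inv_nonneg h1 h2 hσ1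
    set Q : Set ℝ := (fun s => μ s / (1 + Real.log (1 / (σ - s)))) '' Set.Ico (1/2) σ with hQ
    have hQb : BddAbove Q := by
      obtain ⟨B, hB, hb⟩ := hb σ hσ1
      refine ⟨B, ?_⟩
      rintro _ ⟨s, hs, rfl⟩
      have := hxpos s hs.1 hs.2
      change μ s / (1 + Real.log (1 / (σ - s))) ≤ B
      rw [div_le_iff₀ (by linarith)]
      have := hb s hs.1 hs.2.le
      nlinarith
    have hQn : Q.Nonempty := ⟨_, ⟨1/2, ⟨le_rfl, hσ⟩, rfl⟩⟩
    set Λ := sSup Q with hΛ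
    have hle : ∀ s, 1/2 ≤ s → s < σ → μ s ≤ Λ * (1 + Real.log (1 / (σ - s))) := by
      intro s h1 h2
      have h3 := hxpos s h1 h2
      rw [← div_le_iff₀ (by linarith)]
      exact le_csSup hQb ⟨s, ⟨h1, h2⟩, rfl⟩
    have hΛnn : 0 ≤ Λ := by
      have h1 := hle (1/2) le_rfl hσ
      have h2 := hxpos (1/2) le_rfl hσ
      have h3 := h0 (1/2)
      by_contra hneg
      push Not at hneg
      nlinarith
    have hself : Λ ≤ C * (5 + Real.log (1 + 2 * Λ)) := by
      refine csSup_le hQn ?_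
      rintro _ ⟨r, ⟨hr1, hr2⟩, rfl⟩
      have hx := hxpos r hr1 hr2
      change μ r / (1 + Real.log (1 / (σ - r))) ≤ _
      rw [div_le_iff₀ (by linarith)]
      set x := Real.log (1 / (σ - r)) with hxd
      have hhalf : Real.log (1 / ((σ - r) / 2)) ≤ 1 + x := by
        have h0 : 0 < σ - r := by linarith
        have : 1 / ((σ - r) / 2) = 2 * (1 / (σ - r)) := by field_simp
        rw [this, Real.log_mul (by norm_num) (by positivity)]
        have := Real.log_two_lt_d9
        linarith
      have := h r ((σ + r)/2) (Λ * (2 + x)) hr1 (by linarith) (by linarith) (by positivity) (by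
        intro s hs1 hs2
        refine (hle s hs1 (by linarith)).trans ?_
        apply mul_le_mul_of_nonneg_left _ hΛnn
        have : Real.log (1 / (σ - s)) ≤ Real.log (1 / ((σ - r) / 2)) := by
          apply Real.log_le_log (by apply one_div_pos.2; linarith)
          apply one_div_le_one_div_of_le <;> linarith
        linarith)
      refine this.trans ?_
      rw [mul_assoc]
      apply mul_le_mul_of_nonneg_left _ hC
      have e : (σ + r) / 2 - r = (σ - r) / 2 := by ring
      rw [e]
      have h5 : Real.log (1 + Λ * (2 + x)) ≤ Real.log (1 + 2 * Λ) + x := by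
        have : 1 + Λ * (2 + x) ≤ (1 + 2 * Λ) * (1 + x) := by nlinarith [mul_nonneg hΛnn hx]
        refine (Real.log_le_log (by positivity) this).trans ?_
        rw [Real.log_mul (by positivity) (by positivity)]
        have := Real.log_le_sub_one_of_pos (x := 1 + x) (by linarith)
        linarith
      have h6 : 0 ≤ Real.log (1 + 2 * Λ) := Real.log_nonneg (by linarith)
      nlinarith [mul_nonneg h6 hx]
    have hfin : Λ ≤ Λ₀ := by
      have h7 := Real.log_le_sub_one_of_pos (x := (1 + 2 * Λ) / (4 * C + 1)) (by positivity)
      rw [Real.log_div (by positivity) (by positivity)] at h7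
      have h8 : C * ((1 + 2 * Λ) / (4 * C + 1)) ≤ (1 + 2 * Λ) / 4 := by
        rw [← mul_div_assoc, div_le_div_iff₀ (by positivity) (by norm_num)]
        nlinarith
      have h9 : C * Real.log (1 + 2 * Λ) ≤ C * (Real.log (4 * C + 1)) + (1 + 2 * Λ) / 4 := by nlinarith
      rw [hΛ₀]; nlinarith
    intro s h1 h2
    refine (hle s h1 h2).trans ?_
    have := hxpos s h1 h2
    gcongr
  refine ⟨2 * Λ₀, by positivity, fun r h1 h2 => ?_⟩
  have := key ((1 + r)/2) (by linarith) (by linarith) r h1 (by linarith)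
  refine this.trans ?_
  have e : (1 + r) / 2 - r = (1 - r) / 2 := by ring
  rw [e]
  have := half_log h2
  have := log_inv1_nonneg h1 h2
  nlinarith

/-- growth in the disc -/
theorem disc_growth {q ℓ : ℂ → ℂ} (hq : ∀ z ∈ ball (0:ℂ) 1, AnalyticAt ℂ q z) (hq2 : ∀ z ∈ ball (0:ℂ) 1, ‖q z‖ ≤ 2)
    (hq0 : ∀ z ∈ ball (0:ℂ) 1, q z ≠ 0) (hl : FP ℓ) (haN : NZ fun z => q z * deriv ℓ z + ℓ z ^ 2)
    (hai : FP fun z => (q z * deriv ℓ z + ℓ z ^ 2)⁻¹) : 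
    GR (mm ℓ) ∧ GR (mm fun z => q z * deriv ℓ z + ℓ z ^ 2) ∧ GR (mm fun z => (q z * deriv ℓ z + ℓ z ^ 2)⁻¹) := by
  obtain ⟨h1, h2⟩ := clunie hq hq2 hq0 hl haN hai
  have g1 : GR (mm ℓ) := iterate h1 (mm_nonneg ℓ) fun ρ hρ => hl.mm_bdd hρ
  have g2 := h2.toGR g1
  refine ⟨g1, g2, ?_⟩
  have haF : FP fun z => q z * deriv ℓ z + ℓ z ^ 2 := ((FP.of_analytic hq).mul hl.deriv).add (hl.pow 2)
  obtain ⟨C, hC, hJ⟩ := haF.jensen0 haN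
  obtain ⟨c, hc, g2⟩ := g2
  refine ⟨c + C, by positivity, fun r h1 h2 => ?_⟩
  have e1 := mm_inv haF.me h1 h2
  have e2 := hJ r h1 h2
  have e3 := g2 r h1 h2
  have e4 := log_inv1_nonneg h1 h2
  nlinarith

end NV

open Complex Filter Topology MeasureTheory
open scoped Classical

namespace NV
open Metric Real

/-- conformal map of the unit disc onto the half-plane `Im > Y`. -/
noncomputable def zz (Y : ℝ) (w : ℂ) : ℂ := I * (Y + (1 + w) / (1 - w))
noncomputable def ww (Y : ℝ) (z : ℂ) : ℂ := (z - I * Y - I) / (z - I * Y + I)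
noncomputable def qq (w : ℂ) : ℂ := (1 - w) ^ 2 / (2 * I)

lemma one_sub_ne {w : ℂ} (hw : w ∈ ball (0:ℂ) 1) : 1 - w ≠ 0 := by
  intro h
  have : w = 1 := (sub_eq_zero.1 h).symm
  subst this
  simp at hw

lemma im_zz (Y : ℝ) {w : ℂ} (hw : w ∈ ball (0:ℂ) 1) : (zz Y w).im = Y + (1 - ‖w‖ ^ 2) / ‖1 - w‖ ^ 2 := by
  have h := one_sub_ne hw
  have hn : normSq (1 - w) ≠ 0 := by simpa using h
  rw [← Complex.normSq_eq_norm_sq, ← Complex.normSq_eq_norm_sq, zz, Complex.mul_im, Complex.add_re, Complex.div_re]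
  simp only [I_re, I_im, zero_mul, one_mul, zero_add, ofReal_re]
  congr 1
  rw [← add_div]
  congr 1
  simp [Complex.normSq_apply]
  ring

lemma im_zz_gt (Y : ℝ) {w : ℂ} (hw : w ∈ ball (0:ℂ) 1) : Y < (zz Y w).im := by
  rw [im_zz Y hw]
  have h := norm_pos_iff.2 (one_sub_ne hw)
  have h2 : ‖w‖ < 1 := by simpa using hw
  have : 0 < 1 - ‖w‖ ^ 2 := by nlinarith [norm_nonneg w]
  have := div_pos this (by positivity : 0 < ‖1 - w‖ ^ 2)
  linarith

lemma hasDerivAt_zz (Y : ℝ) {w : ℂ} (hw : w ∈ ball (0:ℂ) 1) : HasDerivAt (zz Y) (2 * I / (1 - w) ^ 2) w := by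
  have h := one_sub_ne hw
  have h1 : HasDerivAt (fun w : ℂ => (1:ℂ) + w) 1 w := (hasDerivAt_id w).const_add 1
  have h2 : HasDerivAt (fun w : ℂ => (1:ℂ) - w) (-1) w := (hasDerivAt_id w).const_sub 1
  have h3 := ((h1.div h2 h).const_add (Y:ℂ)).const_mul I
  refine h3.congr_deriv ?_
  field_simp
  ring

lemma analyticAt_zz (Y : ℝ) {w : ℂ} (hw : w ∈ ball (0:ℂ) 1) : AnalyticAt ℂ (zz Y) w := by
  have h := one_sub_ne hw
  unfold zz
  fun_prop (disch := assumption)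

lemma zz_ww (Y : ℝ) {z : ℂ} (hz : Y < z.im) : zz Y (ww Y z) = z := by
  have h : z - I * Y + I ≠ 0 := by
    intro h; have := congrArg Complex.im h; simp at this; linarith
  have h1 : 1 - ww Y z = 2 * I / (z - I * Y + I) := by unfold ww; field_simp; ring
  have h2 : 1 + ww Y z = 2 * (z - I * Y) / (z - I * Y + I) := by unfold ww; field_simp; ring
  rw [zz, h1, h2]
  have := I_ne_zero
  field_simp
  ring

lemma ww_zz (Y : ℝ) {w : ℂ} (hw : w ∈ ball (0:ℂ) 1) : ww Y (zz Y w) = w := by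
  have h := one_sub_ne hw
  have e : zz Y w - I * Y = I * ((1 + w) / (1 - w)) := by unfold zz; ring
  have e1 : zz Y w - I * Y - I = I * (2 * w) / (1 - w) := by rw [e]; field_simp; ring
  have e2 : zz Y w - I * Y + I = I * 2 / (1 - w) := by rw [e]; field_simp; ring
  have := I_ne_zero
  rw [ww, e1, e2]
  field_simp

lemma one_sub_ww {Y : ℝ} {z : ℂ} (hz : Y < z.im) : ‖1 - ww Y z‖ = 2 / ‖z - I * Y + I‖ := by
  have h : z - I * Y + I ≠ 0 := by
    intro h; have := congrArg Complex.im h; simp at this; linarith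
  have h1 : 1 - ww Y z = 2 * I / (z - I * Y + I) := by unfold ww; field_simp; ring
  rw [h1]; simp

lemma norm_ww {Y : ℝ} {z : ℂ} (hz : Y < z.im) : 1 - ‖ww Y z‖ ^ 2 = 4 * (z.im - Y) / ‖z - I * Y + I‖ ^ 2 := by
  have h : z - I * Y + I ≠ 0 := by
    intro h; have := congrArg Complex.im h; simp at this; linarith
  have hn : normSq (z - I * Y + I) ≠ 0 := by simpa using h
  rw [ww, norm_div, div_pow, ← Complex.normSq_eq_norm_sq, ← Complex.normSq_eq_norm_sq, eq_div_iff hn, sub_mul, div_mul_cancel₀ _ hn]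
  simp [Complex.normSq_apply]
  ring

lemma ww_mem {Y : ℝ} {z : ℂ} (hz : Y < z.im) : ww Y z ∈ ball (0:ℂ) 1 := by
  have h : z - I * Y + I ≠ 0 := by
    intro h; have := congrArg Complex.im h; simp at this; linarith
  have h1 := norm_ww hz
  have h2 : 0 < 4 * (z.im - Y) / ‖z - I * Y + I‖ ^ 2 := by
    have := norm_pos_iff.2 h
    have : 0 < z.im - Y := by linarith
    positivity
  rw [← h1] at h2
  simp only [mem_ball_zero_iff]
  nlinarith [norm_nonneg (ww Y z)]

/-- meromorphic for `Im > Y` with finitely many poles, transferred to the disc. -/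
lemma fp_zz {Y : ℝ} {H : ℂ → ℂ} (P : Finset ℂ)
    (h : ∀ z : ℂ, Y < z.im → MeromorphicAt H z ∧ (z ∉ P → AnalyticAt ℂ H z)) : FP fun w => H (zz Y w) := by
  refine ⟨P.image (ww Y), fun w hw => ?_⟩
  have h1 := h _ (im_zz_gt Y hw)
  refine ⟨h1.1.comp_analyticAt (analyticAt_zz Y hw), fun hP => ?_⟩
  refine (h1.2 ?_).comp (analyticAt_zz Y hw)
  intro h2
  exact hP (Finset.mem_image.2 ⟨_, h2, ww_zz Y hw⟩)

lemma deriv_zz {Y : ℝ} {H : ℂ → ℂ} {w : ℂ} (hw : w ∈ ball (0:ℂ) 1) (hH : AnalyticAt ℂ H (zz Y w)) :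
    qq w * deriv (fun w => H (zz Y w)) w = deriv H (zz Y w) := by
  have h := one_sub_ne hw
  have := (hH.differentiableAt.hasDerivAt.comp w (hasDerivAt_zz Y hw)).deriv
  have e : deriv (fun w => H (zz Y w)) w = deriv H (zz Y w) * (2 * I / (1 - w) ^ 2) := this
  rw [e, qq]
  have := I_ne_zero
  field_simp

lemma qq_an {w : ℂ} : AnalyticAt ℂ qq w := by
  unfold qq; fun_prop (disch := simp)

lemma qq_ne {w : ℂ} (hw : w ∈ ball (0:ℂ) 1) : qq w ≠ 0 := by
  have h := one_sub_ne hw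
  unfold qq
  exact div_ne_zero (pow_ne_zero _ h) (mul_ne_zero two_ne_zero I_ne_zero)

lemma qq_le {w : ℂ} (hw : w ∈ ball (0:ℂ) 1) : ‖qq w‖ ≤ 2 := by
  have h2 : ‖w‖ < 1 := by simpa using hw
  have h3 : ‖1 - w‖ ≤ 2 := (norm_sub_le _ _).trans (by simp; linarith)
  unfold qq
  simp only [norm_div, norm_pow, norm_mul, norm_I, Complex.norm_ofNat]
  nlinarith [norm_nonneg (1 - w)]

lemma nz_of_fin {h : ℂ → ℂ} (hm : ∀ z ∈ ball (0:ℂ) 1, MeromorphicAt h z) (P : Finset ℂ)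
    (hP : ∀ z ∈ ball (0:ℂ) 1, z ∉ P → h z ≠ 0) : NZ h := by
  intro z hz
  rw [meromorphicOrderAt_ne_top_iff_eventually_ne_zero (hm z hz)]
  have h1 : ∀ᶠ w in 𝓝[≠] z, w ∈ ball (0:ℂ) 1 := nhdsWithin_le_nhds (isOpen_ball.mem_nhds hz)
  have h2 : ∀ᶠ w in 𝓝[≠] z, w ∉ P := by
    have : ((P : Set ℂ) \ {z})ᶜ ∈ 𝓝 z := ((P.finite_toSet.subset Set.diff_subset).isClosed.isOpen_compl).mem_nhds (by simp)
    filter_upwards [nhdsWithin_le_nhds this, self_mem_nhdsWithin] with w h1 h2 h3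
    exact h1 ⟨h3, h2⟩
  filter_upwards [h1, h2] with w h1 h2 using hP w h1 h2

lemma mm_congr_fin {h g : ℂ → ℂ} (P : Finset ℂ)
    (hP : ∀ z ∈ ball (0:ℂ) 1, z ∉ P → h z = g z) : Ev fun z => h z = g z := by
  unfold Ev
  rw [ev_open_iff isOpen_ball]
  intro z hz
  have h1 : ∀ᶠ w in 𝓝[≠] z, w ∈ ball (0:ℂ) 1 := nhdsWithin_le_nhds (isOpen_ball.mem_nhds hz)
  have h2 : ∀ᶠ w in 𝓝[≠] z, w ∉ P := by
    have : ((P : Set ℂ) \ {z})ᶜ ∈ 𝓝 z := ((P.finite_toSet.subset Set.diff_subset).isClosed.isOpen_compl).mem_nhds (by simp)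
    filter_upwards [nhdsWithin_le_nhds this, self_mem_nhdsWithin] with w h1 h2 h3
    exact h1 ⟨h3, h2⟩
  filter_upwards [h1, h2] with w h1 h2 using hP w h1 h2

/-- the growth theorem in a half-plane. -/
theorem UH {Y : ℝ} {F : ℂ → ℂ} (P : Finset ℂ)
    (h : ∀ z : ℂ, Y < z.im → MeromorphicAt F z ∧ (z ∉ P → AnalyticAt ℂ F z ∧ F z ≠ 0 ∧ deriv (deriv F) z ≠ 0)) :
    GR (mm fun w => deriv F (zz Y w) / F (zz Y w)) ∧ GR (mm fun w => deriv (deriv F) (zz Y w) / F (zz Y w)) ∧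
    GR (mm fun w => F (zz Y w) / deriv (deriv F) (zz Y w)) := by
  have hl : FP fun w => deriv F (zz Y w) / F (zz Y w) := by
    refine fp_zz (H := fun z => deriv F z / F z) P fun z hz => ?_
    obtain ⟨h1, h2⟩ := h z hz
    refine ⟨h1.deriv.fun_div h1, fun hP => ?_⟩
    obtain ⟨h3, h4, h5⟩ := h2 hP
    exact h3.deriv.fun_div h3 h4
  have key : ∀ w ∈ ball (0:ℂ) 1, w ∉ P.image (ww Y) → 
      qq w * deriv (fun w => deriv F (zz Y w) / F (zz Y w)) w + (deriv F (zz Y w) / F (zz Y w)) ^ 2 = 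
        deriv (deriv F) (zz Y w) / F (zz Y w) := by
    intro w hw hP
    have hP' : zz Y w ∉ P := fun h2 => hP (Finset.mem_image.2 ⟨_, h2, ww_zz Y hw⟩)
    obtain ⟨h3, h4, h5⟩ := (h _ (im_zz_gt Y hw)).2 hP'
    have := deriv_zz (Y := Y) (H := fun z => deriv F z / F z) hw (h3.deriv.fun_div h3 h4)
    rw [this, deriv_fun_div h3.deriv.differentiableAt h3.differentiableAt h4]
    field_simp
    ring
  have hm : FP fun w => deriv (deriv F) (zz Y w) / F (zz Y w) := by
    refine fp_zz (H := fun z => deriv (deriv F) z / F z) P fun z hz => ?_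
    obtain ⟨h1, h2⟩ := h z hz
    refine ⟨h1.deriv.deriv.fun_div h1, fun hP => ?_⟩
    obtain ⟨h3, h4, h5⟩ := h2 hP
    exact h3.deriv.deriv.fun_div h3 h4
  have hm' : FP fun w => F (zz Y w) / deriv (deriv F) (zz Y w) := by
    refine fp_zz (H := fun z => F z / deriv (deriv F) z) P fun z hz => ?_
    obtain ⟨h1, h2⟩ := h z hz
    refine ⟨h1.fun_div h1.deriv.deriv, fun hP => ?_⟩
    obtain ⟨h3, h4, h5⟩ := h2 hP
    exact h3.fun_div h3.deriv.deriv h5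
  have haF : FP fun w => qq w * deriv (fun w => deriv F (zz Y w) / F (zz Y w)) w + (deriv F (zz Y w) / F (zz Y w)) ^ 2 :=
    ((FP.of_analytic fun z _ => qq_an).mul hl.deriv).add (hl.pow 2)
  have hne : ∀ w ∈ ball (0:ℂ) 1, w ∉ P.image (ww Y) → 
      qq w * deriv (fun w => deriv F (zz Y w) / F (zz Y w)) w + (deriv F (zz Y w) / F (zz Y w)) ^ 2 ≠ 0 := by
    intro w hw hP
    rw [key w hw hP]
    have hP' : zz Y w ∉ P := fun h2 => hP (Finset.mem_image.2 ⟨_, h2, ww_zz Y hw⟩)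
    obtain ⟨h3, h4, h5⟩ := (h _ (im_zz_gt Y hw)).2 hP'
    exact div_ne_zero h5 h4
  have haN := nz_of_fin (fun z hz => haF.mero hz) _ hne
  have hai : FP fun w => (qq w * deriv (fun w => deriv F (zz Y w) / F (zz Y w)) w + (deriv F (zz Y w) / F (zz Y w)) ^ 2)⁻¹ := by
    refine ⟨P.image (ww Y), fun w hw => ⟨(haF.mero hw).fun_inv, fun hP => ?_⟩⟩
    have hP' : zz Y w ∉ P := fun h2 => hP (Finset.mem_image.2 ⟨_, h2, ww_zz Y hw⟩)
    obtain ⟨h3, h4, h5⟩ := (h _ (im_zz_gt Y hw)).2 hP'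
    refine AnalyticAt.fun_inv ?_ (hne w hw hP)
    have := (h3.deriv.fun_div h3 h4).comp (analyticAt_zz Y hw)
    exact (qq_an.mul this.deriv).add (this.pow 2)
  obtain ⟨g1, g2, g3⟩ := disc_growth (fun z _ => qq_an) (fun z hz => qq_le hz) (fun z hz => qq_ne hz) hl haN hai
  refine ⟨g1, ?_, ?_⟩
  · obtain ⟨C, hC, g2⟩ := g2
    refine ⟨C, hC, fun r h1 h2 => ?_⟩
    rw [← mm_congr (by linarith) h2 (mm_congr_fin _ key)]
    exact g2 r h1 h2
  · obtain ⟨C, hC, g2⟩ := g3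
    refine ⟨C, hC, fun r h1 h2 => ?_⟩
    rw [← mm_congr (by linarith) h2 (mm_congr_fin (h := fun w => (qq w * deriv (fun w => deriv F (zz Y w) / F (zz Y w)) w + (deriv F (zz Y w) / F (zz Y w)) ^ 2)⁻¹) (P.image (ww Y)) fun w hw hP => ?_)]
    · exact g2 r h1 h2
    · exact (congrArg (·⁻¹) (key w hw hP)).trans (inv_div _ _)

end NV

open Complex Filter Topology MeasureTheory
open scoped Classical

namespace NV
open Metric Real

lemma polar_cm (p : ℝ × ℝ) : Complex.polarCoord.symm p = circleMap 0 p.1 p.2 := by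
  rw [Complex.polarCoord_symm_apply, circleMap, zero_add, Complex.exp_mul_I]
  push_cast; rfl

lemma polar_le {a b : ℝ} (ha : 0 ≤ a) (G : ℂ → ENNReal) :
    ∫⁻ z in {z : ℂ | a < ‖z‖ ∧ ‖z‖ < b}, G z ≤
      ∫⁻ ρ in Set.Ioo a b, ENNReal.ofReal ρ * ∫⁻ θ in Set.Ioo (-π) π, G (circleMap 0 ρ θ) := by
  have hms : MeasurableSet {z : ℂ | a < ‖z‖ ∧ ‖z‖ < b} := by measurability
  rw [← lintegral_indicator hms, ← Complex.lintegral_comp_polarCoord_symm, polarCoord_target,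
    Measure.volume_eq_prod, ← Measure.prod_restrict]
  refine (lintegral_prod_le _).trans ?_
  rw [← lintegral_indicator measurableSet_Ioo, ← lintegral_indicator measurableSet_Ioi]
  refine lintegral_mono fun ρ => ?_
  by_cases hρ : ρ ∈ Set.Ioi (0:ℝ)
  · rw [Set.indicator_of_mem hρ]
    have hρ0 : (0:ℝ) < ρ := hρ
    by_cases h2 : ρ ∈ Set.Ioo a b
    · rw [Set.indicator_of_mem h2, ← lintegral_const_mul' _ _ ENNReal.ofReal_ne_top]
      refine lintegral_mono fun θ => ?_
      simp only [smul_eq_mul, polar_cm]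
      gcongr
      exact Set.indicator_le_self _ _ _
    · rw [Set.indicator_of_notMem h2]
      refine le_of_eq ?_
      rw [← lintegral_zero (μ := volume.restrict (Set.Ioo (-π) π))]
      refine lintegral_congr fun θ => ?_
      simp only [smul_eq_mul, polar_cm]
      rw [Set.indicator_of_notMem, mul_zero]
      simpa [abs_of_pos hρ0] using h2
  · rw [Set.indicator_of_notMem hρ]; exact zero_le

lemma circ_shift {F : ℂ → ℝ} {r : ℝ} : 2 * π * circleAverage F 0 r = ∫ θ in (-π)..π, F (circleMap 0 r θ) := by
  rw [circleAverage_def, smul_eq_mul, ← mul_assoc, mul_inv_cancel₀ (by positivity), one_mul]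
  have hp : Function.Periodic (fun θ => F (circleMap 0 r θ)) (2 * π) := (periodic_circleMap 0 r).comp F
  have := hp.intervalIntegral_add_eq 0 (-π)
  rw [zero_add] at this
  rw [this]; congr 1; ring

lemma ii_shift {F : ℂ → ℝ} {r : ℝ} (hF : CircleIntegrable F 0 r) (a b : ℝ) :
    IntervalIntegrable (fun θ => F (circleMap 0 r θ)) volume a b := by
  have hp : Function.Periodic (fun θ => F (circleMap 0 r θ)) (2 * π) := (periodic_circleMap 0 r).comp F
  have h0 : IntervalIntegrable (fun θ => F (circleMap 0 r θ)) volume 0 (0 + 2 * π) := by rw [zero_add]; exact hF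
  exact hp.intervalIntegrable (by positivity) h0 a b

lemma lint_interval {G : ℝ → ℝ} {a b : ℝ} (hab : a ≤ b) (hG : ∀ x, 0 ≤ G x) (hi : IntervalIntegrable G volume a b) :
    ∫⁻ θ in Set.Ioo a b, ENNReal.ofReal (G θ) = ENNReal.ofReal (∫ θ in a..b, G θ) := by
  rw [intervalIntegral.integral_of_le hab, restrict_Ioo_eq_restrict_Ioc, ofReal_integral_eq_lintegral_ofReal]
  · exact (intervalIntegrable_iff_integrableOn_Ioc_of_le hab).1 hi
  · exact Eventually.of_forall hG

lemma disc_area {F : ℂ → ℝ} {φ : ℝ → ℝ} {ε : ℝ} (hε : ε ≤ 1) (hF : ∀ z, 0 ≤ F z)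
    (hci : ∀ r : ℝ, 1 - ε < r → r < 1 → CircleIntegrable F 0 r)
    (hφ : ∀ r : ℝ, 1 - ε < r → r < 1 → circleAverage F 0 r ≤ φ r) :
    ∫⁻ z in {z : ℂ | 1 - ε < ‖z‖ ∧ ‖z‖ < 1}, ENNReal.ofReal (F z) ≤
      ∫⁻ ρ in Set.Ioo (1 - ε) 1, ENNReal.ofReal (2 * π * φ ρ) := by
  refine (polar_le (by linarith) _).trans ?_
  refine setLIntegral_mono' measurableSet_Ioo fun ρ hρ => ?_
  rw [lint_interval (by linarith [pi_pos]) (fun θ => hF _) (ii_shift (hci ρ hρ.1 hρ.2) _ _), ← circ_shift]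
  calc _ ≤ 1 * ENNReal.ofReal (2 * π * circleAverage F 0 ρ) := by
        gcongr
        rw [ENNReal.ofReal_le_one]; exact hρ.2.le
    _ ≤ _ := by
        rw [one_mul]
        apply ENNReal.ofReal_le_ofReal
        have := hφ ρ hρ.1 hρ.2
        gcongr

lemma log_area {C ε : ℝ} (hC : 0 ≤ C) (h0 : 0 < ε) (h1 : ε ≤ 1) :
    ∫⁻ ρ in Set.Ioo (1 - ε) 1, ENNReal.ofReal (2 * π * (C * (1 + Real.log (1 / (1 - ρ))))) ≤
      ENNReal.ofReal (2 * π * (C * (ε * (2 + Real.log (1 / ε))))) := by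
  have hnn : ∀ x, (0:ℝ) ≤ max 0 (2 * π * (C * (1 + Real.log (1 / (1 - x))))) := fun x => le_max_left _ _
  have hi : IntervalIntegrable (fun x => 2 * π * (C * (1 + Real.log (1 / (1 - x))))) volume (1 - ε) 1 := by
    have e : (fun x => 2 * π * (C * (1 + Real.log (1 / (1 - x))))) = fun x => 2 * π * (C * (1 + -Real.log (1 - x))) := by
      ext x; rw [one_div, Real.log_inv]
    rw [e]
    refine IntervalIntegrable.const_mul (IntervalIntegrable.const_mul ?_ _) _
    refine IntervalIntegrable.add intervalIntegrable_const (IntervalIntegrable.neg ?_)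
    have := (intervalIntegral.intervalIntegrable_log' (a := ε) (b := 0)).comp_sub_left 1
    simpa using this
  have hv : ∫ x in (1-ε)..1, 2 * π * (C * (1 + Real.log (1 / (1 - x)))) = 2 * π * (C * (ε * (2 + Real.log (1 / ε)))) := by
    have e : (fun x => 2 * π * (C * (1 + Real.log (1 / (1 - x))))) = fun x => (fun y => 2 * π * (C * (1 - Real.log y))) (1 - x) := by
      ext x; rw [one_div, Real.log_inv]; ring
    rw [e, intervalIntegral.integral_comp_sub_left (fun y => 2 * π * (C * (1 - Real.log y)))]
    rw [intervalIntegral.integral_const_mul, intervalIntegral.integral_const_mul, intervalIntegral.integral_sub (by simp) intervalIntegral.intervalIntegrable_log', integral_log, one_div, Real.log_inv]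
    simp
    left; ring
  rw [← hv, intervalIntegral.integral_of_le (by linarith), ← restrict_Ioo_eq_restrict_Ioc]
  rw [← ofReal_integral_eq_lintegral_ofReal]
  · rw [restrict_Ioo_eq_restrict_Ioc]; exact (intervalIntegrable_iff_integrableOn_Ioc_of_le (by linarith)).1 hi
  · rw [EventuallyLE, ae_restrict_iff' measurableSet_Ioo]
    refine Eventually.of_forall fun x hx => ?_
    have : 0 ≤ Real.log (1 / (1 - x)) := by
      apply Real.log_nonneg
      rw [le_div_iff₀ (by linarith [hx.2])]; linarith [hx.1]
    change 0 ≤ 2 * π * (C * (1 + Real.log (1 / (1 - x))))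
    positivity

/-- change of variables -/
lemma zz_area {Y δ ε : ℝ} (hδ : 0 < δ) (Ω : Set ℂ) (hΩ : ∀ z ∈ Ω, Y < z.im ∧ δ ≤ ‖1 - ww Y z‖ ∧ 1 - ε < ‖ww Y z‖)
    (G : ℂ → ENNReal) :
    ∫⁻ z in Ω, G z ≤ ENNReal.ofReal (4 / δ ^ 4) * ∫⁻ w in {w : ℂ | 1 - ε < ‖w‖ ∧ ‖w‖ < 1}, G (zz Y w) := by
  set s : Set ℂ := {w | 1 - ε < ‖w‖ ∧ ‖w‖ < 1 ∧ δ ≤ ‖1 - w‖} with hs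
  have hsm : MeasurableSet s := by
    have : s = {w : ℂ | 1 - ε < ‖w‖} ∩ ({w | ‖w‖ < 1} ∩ {w | δ ≤ ‖1 - w‖}) := by ext; simp [hs]
    rw [this]
    refine (measurableSet_lt measurable_const measurable_norm).inter ((measurableSet_lt measurable_norm measurable_const).inter (measurableSet_le measurable_const (by fun_prop)))
  have hsb : ∀ w ∈ s, w ∈ ball (0:ℂ) 1 := fun w hw => by simpa using hw.2.1
  have hsub : Ω ⊆ zz Y '' s := by
    intro z hz
    obtain ⟨h1, h2, h3⟩ := hΩ z hz
    have := ww_mem h1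
    exact ⟨ww Y z, ⟨h3, by simpa using this, h2⟩, zz_ww Y h1⟩
  have hinj : Set.InjOn (zz Y) s := by
    intro a ha b hb hab
    rw [← ww_zz Y (hsb a ha), hab, ww_zz Y (hsb b hb)]
  have hd : ∀ w ∈ s, HasFDerivWithinAt (zz Y) ((ContinuousLinearMap.toSpanSingleton ℂ (2 * I / (1 - w) ^ 2)).restrictScalars ℝ) s w := by
    intro w hw
    have := (hasDerivAt_zz Y (hsb w hw)).hasFDerivAt.restrictScalars ℝ
    exact this.hasFDerivWithinAt
  have hdet : ∀ w : ℂ, ((ContinuousLinearMap.toSpanSingleton ℂ (2 * I / (1 - w) ^ 2)).restrictScalars ℝ).det = 4 / ‖1 - w‖ ^ 4 := by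
    intro w
    simp [ContinuousLinearMap.det, LinearMap.det_restrictScalars,
      Algebra.norm_complex_eq, Complex.normSq_eq_norm_sq, ← pow_mul]
    ring
  calc ∫⁻ z in Ω, G z ≤ ∫⁻ z in zz Y '' s, G z := lintegral_mono_set hsub
    _ = ∫⁻ w in s, ENNReal.ofReal |((ContinuousLinearMap.toSpanSingleton ℂ (2 * I / (1 - w) ^ 2)).restrictScalars ℝ).det| * G (zz Y w) :=
        lintegral_image_eq_lintegral_abs_det_fderiv_mul volume hsm hd hinj G
    _ ≤ ∫⁻ w in s, ENNReal.ofReal (4 / δ ^ 4) * G (zz Y w) := by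
        refine setLIntegral_mono' hsm fun w hw => ?_
        rw [hdet]
        gcongr
        rw [abs_of_nonneg (by positivity)]
        have := hw.2.2
        gcongr
    _ = ENNReal.ofReal (4 / δ ^ 4) * ∫⁻ w in s, G (zz Y w) := lintegral_const_mul' _ _ ENNReal.ofReal_ne_top
    _ ≤ _ := by
        gcongr
        intro w hw
        exact ⟨hw.1, hw.2.1⟩

lemma geo {Y R : ℝ} (hR : 10 * (1 + |Y|) ≤ R) {z : ℂ} (hz : Y < z.im) (h1 : R < ‖z‖) (h2 : ‖z‖ < 2 * R) :
    2 / (3 * R) ≤ ‖1 - ww Y z‖ ∧ 1 - 5 / R < ‖ww Y z‖ ∧ ∀ S, z.im - Y < S → 1 - 16 * S / R ^ 2 < ‖ww Y z‖ := by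
  have hY := abs_nonneg Y
  have hR0 : 0 < R := by linarith
  have hn : ‖I * (Y:ℂ)‖ = |Y| := by simp
  have hup : ‖z - I * Y + I‖ ≤ 3 * R := by
    have a1 := norm_add_le (z - I * Y) I
    have a2 := norm_sub_le z (I * Y)
    rw [hn] at a2
    rw [norm_I] at a1
    linarith
  have hlo : R / 2 ≤ ‖z - I * Y + I‖ := by
    have a1 : ‖z‖ ≤ ‖z - I * Y + I‖ + (‖I * (Y:ℂ)‖ + ‖I‖) := by
      calc ‖z‖ = ‖(z - I * Y + I) + (I * Y - I)‖ := by congr 1; ring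
        _ ≤ _ := (norm_add_le _ _).trans (by gcongr; exact norm_sub_le _ _)
    rw [hn, norm_I] at a1
    linarith
  have hpos : 0 < ‖z - I * Y + I‖ := by linarith
  have hw1 : ‖ww Y z‖ < 1 := by simpa using ww_mem hz
  refine ⟨?_, ?_, fun S hS => ?_⟩
  · rw [one_sub_ww hz]; gcongr
  · have a1 : 1 - ‖ww Y z‖ ≤ ‖1 - ww Y z‖ := by simpa using norm_sub_norm_le (1:ℂ) (ww Y z)
    rw [one_sub_ww hz] at a1
    have a2 : 2 / ‖z - I * Y + I‖ ≤ 2 / (R / 2) := by gcongr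
    have a3 : 2 / (R / 2) = 4 / R := by field_simp; norm_num
    have a4 : 4 / R < 5 / R := by gcongr; norm_num
    linarith
  · have a1 := norm_ww hz
    have a2 : 4 * (z.im - Y) / ‖z - I * Y + I‖ ^ 2 ≤ 4 * (z.im - Y) / (R / 2) ^ 2 := by
      have : 0 < z.im - Y := by linarith
      gcongr
    have a3 : 4 * (z.im - Y) / (R / 2) ^ 2 = 16 * (z.im - Y) / R ^ 2 := by field_simp; ring
    have a4 : 16 * (z.im - Y) / R ^ 2 < 16 * S / R ^ 2 := by gcongr
    nlinarith [norm_nonneg (ww Y z)]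

def GRF (Y : ℝ) (F : ℂ → ℝ) : Prop := (∀ z, 0 ≤ F z) ∧ (∀ r : ℝ, 1/2 ≤ r → r < 1 → CircleIntegrable (fun w => F (zz Y w)) 0 r) ∧
  GR fun r => circleAverage (fun w => F (zz Y w)) 0 r

lemma area_half {Y : ℝ} {F : ℂ → ℝ} (h : GRF Y F) : ∃ C R₀ : ℝ, 0 ≤ C ∧ ∀ R, R₀ ≤ R →
    ∫⁻ z in {z : ℂ | R < ‖z‖ ∧ ‖z‖ < 2 * R ∧ Y < z.im}, ENNReal.ofReal (F z) ≤ ENNReal.ofReal (C * (R ^ 3 * Real.log R)) := by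
  obtain ⟨h0, hi, C, hC, hg⟩ := h
  refine ⟨81 / 4 * (2 * π * (C * (5 * 3))), 10 * (1 + |Y|), by positivity, fun R hR => ?_⟩
  have hR10 : 10 ≤ R := by linarith [abs_nonneg Y]
  have hR0 : 0 < R := by linarith
  have he : 0 < 5 / R := by positivity
  have he2 : 5 / R ≤ 1/2 := by rw [div_le_iff₀ hR0]; linarith
  refine (zz_area (Y := Y) (δ := 2 / (3 * R)) (ε := 5 / R) (by positivity) _ (fun z hz => ?_) _).trans ?_
  · have := geo hR hz.2.2 hz.1 hz.2.1
    exact ⟨hz.2.2, this.1, this.2.1⟩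
  have h2 := (disc_area (F := fun w => F (zz Y w)) (ε := 5 / R) (by linarith) (fun z => h0 _) (fun r h1 h2 => hi r (by linarith) h2)
    (fun r h1 h2 => hg r (by linarith) h2)).trans (log_area hC he (by linarith))
  refine (mul_le_mul_right h2 _).trans ?_
  rw [← ENNReal.ofReal_mul (by positivity)]
  apply ENNReal.ofReal_le_ofReal
  have hl : 2 ≤ Real.log R := by
    rw [Real.le_log_iff_exp_le hR0]
    have := Real.exp_one_lt_d9
    have e : Real.exp 2 = Real.exp 1 * Real.exp 1 := by rw [← Real.exp_add]; norm_num
    rw [e]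
    nlinarith [Real.exp_pos 1]
  have hl2 : Real.log (1 / (5 / R)) ≤ Real.log R := by
    apply Real.log_le_log (by positivity)
    rw [one_div, inv_div]; exact div_le_self hR0.le (by norm_num)
  calc 4 / (2 / (3 * R)) ^ 4 * (2 * π * (C * (5 / R * (2 + Real.log (1 / (5 / R))))))
      ≤ 4 / (2 / (3 * R)) ^ 4 * (2 * π * (C * (5 / R * (3 * Real.log R)))) := by
        gcongr; linarith
    _ = _ := by field_simp; ring

lemma area_strip {S : ℝ} (hS : 1 ≤ S) {F : ℂ → ℝ} (h : GRF 0 F) : ∃ C R₀ : ℝ, 0 ≤ C ∧ ∀ R, R₀ ≤ R →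
    ∫⁻ z in {z : ℂ | R < ‖z‖ ∧ ‖z‖ < 2 * R ∧ 0 < z.im ∧ z.im < S}, ENNReal.ofReal (F z) ≤ ENNReal.ofReal (C * R ^ 3) := by
  obtain ⟨h0, hi, C, hC, hg⟩ := h
  refine ⟨81 / 4 * (2 * π * (C * (16 * S * 4))), 32 * S, by positivity, fun R hR => ?_⟩
  have hR10 : 32 ≤ R := by linarith
  have hR0 : 0 < R := by linarith
  have he : 0 < 16 * S / R ^ 2 := by positivity
  have he2 : 16 * S / R ^ 2 ≤ 1/2 := by rw [div_le_iff₀ (by positivity)]; nlinarith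
  refine (zz_area (Y := 0) (δ := 2 / (3 * R)) (ε := 16 * S / R ^ 2) (by positivity) _ (fun z hz => ?_) _).trans ?_
  · have := geo (Y := 0) (by simp; linarith) hz.2.2.1 hz.1 hz.2.1
    exact ⟨hz.2.2.1, this.1, this.2.2 S (by simpa using hz.2.2.2)⟩
  have h2 := (disc_area (F := fun w => F (zz 0 w)) (ε := 16 * S / R ^ 2) (by linarith) (fun z => h0 _) (fun r h1 h2 => hi r (by linarith) h2)
    (fun r h1 h2 => hg r (by linarith) h2)).trans (log_area hC he (by linarith))
  refine (mul_le_mul_right h2 _).trans ?_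
  rw [← ENNReal.ofReal_mul (by positivity)]
  apply ENNReal.ofReal_le_ofReal
  have hl2 : Real.log (1 / (16 * S / R ^ 2)) ≤ 2 * Real.log R := by
    rw [← Real.log_rpow hR0]
    apply Real.log_le_log (by positivity)
    rw [one_div, inv_div, Real.rpow_two]; exact div_le_self (by positivity) (by linarith)
  have hl3 : Real.log R ≤ R - 1 := Real.log_le_sub_one_of_pos hR0
  calc 4 / (2 / (3 * R)) ^ 4 * (2 * π * (C * (16 * S / R ^ 2 * (2 + Real.log (1 / (16 * S / R ^ 2))))))
      ≤ 4 / (2 / (3 * R)) ^ 4 * (2 * π * (C * (16 * S / R ^ 2 * (4 * R)))) := by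
        gcongr; linarith
    _ = _ := by field_simp; ring

lemma area_bdd {Y B : ℝ} {F : ℂ → ℝ} (hB : 0 ≤ B) (h0 : ∀ z, 0 ≤ F z) (hi : ∀ r : ℝ, 1/2 ≤ r → r < 1 → CircleIntegrable (fun w => F (zz Y w)) 0 r)
    (hg : ∀ r : ℝ, 1/2 ≤ r → r < 1 → circleAverage (fun w => F (zz Y w)) 0 r ≤ B) : ∃ C R₀ : ℝ, 0 ≤ C ∧ ∀ R, R₀ ≤ R →
    ∫⁻ z in {z : ℂ | R < ‖z‖ ∧ ‖z‖ < 2 * R ∧ Y < z.im}, ENNReal.ofReal (F z) ≤ ENNReal.ofReal (C * R ^ 3) := by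
  refine ⟨81 / 4 * (2 * π * B * 5), 10 * (1 + |Y|), by positivity, fun R hR => ?_⟩
  have hR10 : 10 ≤ R := by linarith [abs_nonneg Y]
  have hR0 : 0 < R := by linarith
  have he : 0 < 5 / R := by positivity
  have he2 : 5 / R ≤ 1/2 := by rw [div_le_iff₀ hR0]; linarith
  refine (zz_area (Y := Y) (δ := 2 / (3 * R)) (ε := 5 / R) (by positivity) _ (fun z hz => ?_) _).trans ?_
  · have := geo hR hz.2.2 hz.1 hz.2.1
    exact ⟨hz.2.2, this.1, this.2.1⟩
  have h2 := (disc_area (F := fun w => F (zz Y w)) (ε := 5 / R) (by linarith) (fun z => h0 _) (fun r h1 h2 => hi r (by linarith) h2)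
    (fun r h1 h2 => hg r (by linarith) h2))
  refine (mul_le_mul_right h2 _).trans ?_
  rw [setLIntegral_const, Real.volume_Ioo, ← ENNReal.ofReal_mul (by positivity), ← ENNReal.ofReal_mul (by positivity)]
  apply ENNReal.ofReal_le_ofReal
  refine le_of_eq ?_
  field_simp; ring

/-- existence of a good radius -/
lemma good_radius {F : ℂ → ℝ} (h0 : ∀ z, 0 ≤ F z) (hm : Measurable F) (hs : ∀ z, F ((starRingEnd ℂ) z) = F z)
    (hi : ∀ r : ℝ, 0 < r → CircleIntegrable F 0 r) {R X : ℝ} (hR : 0 < R) (hX : 0 ≤ X)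
    (hA : ∫⁻ z in {z : ℂ | R < ‖z‖ ∧ ‖z‖ < 2 * R ∧ 0 < z.im}, ENNReal.ofReal (F z) ≤ ENNReal.ofReal X) :
    ∃ t, R < t ∧ t < 2 * R ∧ circleAverage F 0 t ≤ X / R ^ 2 := by
  have hms : MeasurableSet {z : ℂ | R < ‖z‖ ∧ ‖z‖ < 2 * R ∧ 0 < z.im} := by
    refine (measurableSet_lt measurable_const measurable_norm).inter ((measurableSet_lt measurable_norm measurable_const).inter (measurableSet_lt measurable_const Complex.measurable_im))
  have hcm : Measurable fun p : ℝ × ℝ => circleMap 0 p.1 p.2 := by unfold circleMap; fun_prop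
  set G : ℝ → ENNReal := fun t => ∫⁻ θ in Set.Ioo 0 π, ENNReal.ofReal (F (circleMap 0 t θ)) with hG
  have hGm : Measurable G := by
    apply Measurable.lintegral_prod_right' (f := fun p : ℝ × ℝ => ENNReal.ofReal (F (circleMap 0 p.1 p.2)))
    exact (hm.comp hcm).ennreal_ofReal
  have key : ∫⁻ t in Set.Ioo R (2 * R), ENNReal.ofReal t * G t ≤ ENNReal.ofReal X := by
    refine le_trans ?_ hA
    rw [← lintegral_indicator hms, ← Complex.lintegral_comp_polarCoord_symm]
    have hsub : Set.Ioo R (2 * R) ×ˢ Set.Ioo 0 π ⊆ polarCoord.target := by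
      rw [polarCoord_target]
      apply Set.prod_mono
      · intro x hx; exact hR.trans hx.1
      · intro x hx; exact ⟨by linarith [hx.1, pi_pos], hx.2⟩
    refine le_trans ?_ (lintegral_mono_set hsub)
    have e : ∫⁻ p in Set.Ioo R (2 * R) ×ˢ Set.Ioo 0 π, ENNReal.ofReal p.1 • ({z : ℂ | R < ‖z‖ ∧ ‖z‖ < 2 * R ∧ 0 < z.im}.indicator (fun z => ENNReal.ofReal (F z)) (Complex.polarCoord.symm p)) =
        ∫⁻ p in Set.Ioo R (2 * R) ×ˢ Set.Ioo 0 π, ENNReal.ofReal p.1 * ENNReal.ofReal (F (circleMap 0 p.1 p.2)) := by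
      refine setLIntegral_congr_fun (measurableSet_Ioo.prod measurableSet_Ioo) ?_
      rintro ⟨t, θ⟩ ⟨h1, h2⟩
      have ht : 0 < t := hR.trans h1.1
      simp only [smul_eq_mul, polar_cm]
      rw [Set.indicator_of_mem]
      refine ⟨?_, ?_, ?_⟩
      · rw [norm_circleMap_zero, abs_of_pos ht]; exact h1.1
      · rw [norm_circleMap_zero, abs_of_pos ht]; exact h1.2
      · have : (circleMap 0 t θ).im = t * Real.sin θ := by
          simp [circleMap, Complex.exp_mul_I, ← Complex.ofReal_cos, ← Complex.ofReal_sin]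
        rw [this]
        exact mul_pos ht (Real.sin_pos_of_mem_Ioo h2)
    rw [e, Measure.volume_eq_prod, ← Measure.prod_restrict, lintegral_prod]
    · refine le_of_eq (lintegral_congr fun t => ?_)
      rw [hG, ← lintegral_const_mul' _ _ ENNReal.ofReal_ne_top]
    · exact (measurable_fst.ennreal_ofReal.mul (hm.comp hcm).ennreal_ofReal).aemeasurable
  obtain ⟨t, ht, hle⟩ := exists_le_setLAverage (μ := volume) (s := Set.Ioo R (2 * R)) (f := fun t => ENNReal.ofReal t * G t)
    (by rw [Real.volume_Ioo]; simp; linarith) (by rw [Real.volume_Ioo]; exact ENNReal.ofReal_ne_top)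
    (ENNReal.measurable_ofReal.mul hGm).aemeasurable
  refine ⟨t, ht.1, ht.2, ?_⟩
  have ht0 : 0 < t := hR.trans ht.1
  rw [setLAverage_eq, Real.volume_Ioo] at hle
  have hle2 := hle.trans (ENNReal.div_le_div_right key _)
  rw [← ENNReal.ofReal_div_of_pos (by linarith)] at hle2
  have hGt : G t = ENNReal.ofReal (∫ θ in (0:ℝ)..π, F (circleMap 0 t θ)) :=
    lint_interval pi_pos.le (fun θ => h0 _) (ii_shift (hi t ht0) _ _)
  have hJ : 0 ≤ ∫ θ in (0:ℝ)..π, F (circleMap 0 t θ) := intervalIntegral.integral_nonneg pi_pos.le fun θ _ => h0 _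
  rw [hGt, ← ENNReal.ofReal_mul ht0.le, ENNReal.ofReal_le_ofReal_iff (by apply div_nonneg hX; linarith)] at hle2
  have hsym : ∫ θ in (-π)..0, F (circleMap 0 t θ) = ∫ θ in (0:ℝ)..π, F (circleMap 0 t θ) := by
    have e : ∀ θ, F (circleMap 0 t θ) = F (circleMap 0 t (-θ)) := by
      intro θ
      rw [← hs]
      congr 1
      simp [circleMap, ← Complex.exp_conj]
    have := intervalIntegral.integral_comp_neg (a := -π) (b := 0) (f := fun θ => F (circleMap 0 t θ))
    rw [neg_zero, neg_neg] at this
    rw [← this]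
    exact intervalIntegral.integral_congr fun θ _ => e θ
  have h3 := circ_shift (F := F) (r := t)
  rw [← intervalIntegral.integral_add_adjacent_intervals (ii_shift (hi t ht0) (-π) 0) (ii_shift (hi t ht0) 0 π), hsym] at h3
  set J := ∫ θ in (0:ℝ)..π, F (circleMap 0 t θ) with hJd
  have h4 : circleAverage F 0 t = J / π := by
    rw [eq_div_iff pi_pos.ne']; linarith
  rw [h4]
  have h5 : R * J ≤ X / R := by
    refine le_trans (mul_le_mul_of_nonneg_right ht.1.le hJ) (hle2.trans (le_of_eq ?_))
    congr 1; ring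
  have h6 : J ≤ X / R ^ 2 := by
    rw [le_div_iff₀ hR] at h5
    rw [le_div_iff₀ (by positivity)]
    nlinarith
  refine le_trans (div_le_self hJ ?_) h6
  linarith [Real.pi_gt_three]

end NV

open Complex Filter Topology MeasureTheory
open scoped Classical

namespace NV
open Metric Real

def til (f : ℂ → ℂ) : ℂ → ℂ := fun z => (starRingEnd ℂ) (f ((starRingEnd ℂ) z))

lemma til_til (f : ℂ → ℂ) : til (til f) = f := by ext z; simp [til]

lemma deriv_til (f : ℂ → ℂ) : deriv (til f) = til (deriv f) := deriv_conj_conj (f := f)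

lemma til_an {f : ℂ → ℂ} {z : ℂ} (h : AnalyticAt ℂ f ((starRingEnd ℂ) z)) : AnalyticAt ℂ (til f) z := by
  rw [Complex.analyticAt_iff_eventually_differentiableAt] at h ⊢
  have hc : Tendsto (starRingEnd ℂ) (𝓝 z) (𝓝 ((starRingEnd ℂ) z)) := Complex.continuous_conj.tendsto z
  filter_upwards [hc.eventually h] with w hw
  exact differentiableAt_conj_conj_iff.2 hw

lemma tendsto_conj_ne (z : ℂ) : Tendsto (starRingEnd ℂ) (𝓝[≠] z) (𝓝[≠] ((starRingEnd ℂ) z)) := by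
  refine tendsto_nhdsWithin_iff.2 ⟨(Complex.continuous_conj.tendsto z).mono_left nhdsWithin_le_nhds, ?_⟩
  filter_upwards [self_mem_nhdsWithin] with w hw h
  exact hw ((starRingEnd ℂ).injective h)

lemma til_mero {f : ℂ → ℂ} {z : ℂ} (h : MeromorphicAt f ((starRingEnd ℂ) z)) : MeromorphicAt (til f) z := by
  obtain ⟨n, hn⟩ := h
  refine ⟨n, ?_⟩
  have := til_an hn
  have e : (fun w => (w - z) ^ n • til f w) = til (fun w => (w - (starRingEnd ℂ) z) ^ n • f w) := by
    funext w
    simp [til]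
  rw [e]; exact this

lemma til_order {f : ℂ → ℂ} {z : ℂ} (h : MeromorphicAt f ((starRingEnd ℂ) z)) :
    meromorphicOrderAt (til f) z = meromorphicOrderAt f ((starRingEnd ℂ) z) := by
  by_cases ht : meromorphicOrderAt f ((starRingEnd ℂ) z) = ⊤
  · rw [ht]
    rw [meromorphicOrderAt_eq_top_iff] at ht ⊢
    filter_upwards [(tendsto_conj_ne z).eventually ht] with w hw
    simp [til, hw]
  · lift meromorphicOrderAt f ((starRingEnd ℂ) z) to ℤ using ht with n hn
    obtain ⟨g, h1, h2, h3⟩ := (meromorphicOrderAt_eq_int_iff h).1 hn.symm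
    rw [meromorphicOrderAt_eq_int_iff (til_mero h)]
    refine ⟨til g, til_an h1, by simpa [til] using h2, ?_⟩
    filter_upwards [(tendsto_conj_ne z).eventually h3] with w hw
    simp [til, hw]

/-- form of the logarithmic derivative near a point -/
lemma logderiv_form {h : ℂ → ℂ} {x : ℂ} (hh : MeromorphicAt h x) {n : ℤ} (hn : meromorphicOrderAt h x = n) :
    ∃ k : ℂ → ℂ, AnalyticAt ℂ k x ∧ ∀ᶠ z in 𝓝[≠] x, deriv h z / h z = n / (z - x) + k z := by
  obtain ⟨g, h1, h2, h3⟩ := (meromorphicOrderAt_eq_int_iff hh).1 hn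
  refine ⟨fun z => deriv g z / g z, h1.deriv.fun_div h1 h2, ?_⟩
  have h4 : ∀ᶠ z in 𝓝[≠] x, g z ≠ 0 := nhdsWithin_le_nhds (h1.continuousAt.eventually_ne h2)
  have h5 : ∀ᶠ z in 𝓝[≠] x, AnalyticAt ℂ g z := nhdsWithin_le_nhds h1.eventually_analyticAt
  have h6 : deriv h =ᶠ[𝓝[≠] x] deriv (fun z => (z - x) ^ n * g z) := EventuallyEq.nhdsNE_deriv h3
  filter_upwards [h3, h4, h5, h6, self_mem_nhdsWithin] with z h3 h4 h5 h6 h7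
  have hz : z - x ≠ 0 := sub_ne_zero.2 h7
  have hd : HasDerivAt (fun z => (z - x) ^ n * g z) (n * (z - x) ^ (n - 1) * g z + (z - x) ^ n * deriv g z) z := by
    have a1 : HasDerivAt (fun z => (z - x) ^ n) (n * (z - x) ^ (n - 1)) z := by
      have := (hasDerivAt_zpow n (z - x) (Or.inl hz)).comp z ((hasDerivAt_id z).sub_const x)
      exact this.congr_deriv (by simp)
    exact a1.mul h5.differentiableAt.hasDerivAt
  rw [h6, hd.deriv, h3, smul_eq_mul, zpow_sub_one₀ hz]
  have hzn : (z - x) ^ n ≠ 0 := zpow_ne_zero _ hz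
  field_simp

structure Core (f : ℂ → ℂ) (P : Finset ℂ) : Prop where
  nf : ∀ z, MeromorphicNFAt f z
  ne : ∀ z, meromorphicOrderAt f z ≠ ⊤
  ne2 : ∀ z, meromorphicOrderAt (deriv (deriv f)) z ≠ ⊤
  cj : ∀ z ∈ P, (starRingEnd ℂ) z ∈ P
  im : ∀ z ∈ P, z.im ≠ 0
  good : ∀ z : ℂ, z.im ≠ 0 → z ∉ P → AnalyticAt ℂ f z ∧ f z ≠ 0 ∧ deriv (deriv f) z ≠ 0
  snr : ¬ ∃ c : ℂ, ∀ z, ∀ᶠ w in 𝓝[≠] z, til f w = c * f w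

noncomputable def LL (f : ℂ → ℂ) : ℂ → ℂ := fun z => deriv f z / f z
noncomputable def AA (f : ℂ → ℂ) : ℂ → ℂ := fun z => deriv (deriv f) z / f z

lemma til_LL (f : ℂ → ℂ) : til (LL f) = LL (til f) := by
  ext z; simp only [LL, deriv_til]; simp [til, LL]
lemma til_AA (f : ℂ → ℂ) : til (AA f) = AA (til f) := by
  ext z; simp only [AA, deriv_til]; simp [til, AA]

variable {f : ℂ → ℂ} {P : Finset ℂ}

lemma Core.mero (h : Core f P) (z : ℂ) : MeromorphicAt f z := (h.nf z).meromorphicAt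
lemma Core.meroL (h : Core f P) (z : ℂ) : MeromorphicAt (LL f) z := (h.mero z).deriv.fun_div (h.mero z)
lemma Core.meroA (h : Core f P) (z : ℂ) : MeromorphicAt (AA f) z := (h.mero z).deriv.deriv.fun_div (h.mero z)
lemma Core.neA (h : Core f P) (z : ℂ) : meromorphicOrderAt (AA f) z ≠ ⊤ := by
  have e : AA f = (deriv (deriv f)) * f⁻¹ := by ext z; simp [AA, div_eq_mul_inv]
  rw [e, meromorphicOrderAt_mul (h.mero z).deriv.deriv (h.mero z).inv, meromorphicOrderAt_inv]
  have h1 := h.ne z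
  have h2 := h.ne2 z
  lift meromorphicOrderAt f z to ℤ using h1 with a
  lift meromorphicOrderAt (deriv (deriv f)) z to ℤ using h2 with b
  exact WithTop.coe_ne_top (a := b + -a)

lemma conj_im_ne {z : ℂ} (h : z.im ≠ 0) : ((starRingEnd ℂ) z).im ≠ 0 := by simpa using h

lemma Core.til_nf (h : Core f P) (z : ℂ) : MeromorphicNFAt (til f) z := by
  rw [meromorphicNFAt_iff_analyticAt_or]
  rcases meromorphicNFAt_iff_analyticAt_or.1 (h.nf ((starRingEnd ℂ) z)) with h1 | ⟨h1, h2, h3⟩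
  · exact Or.inl (til_an h1)
  · exact Or.inr ⟨til_mero h1, by rwa [til_order h1], by simp [til, h3]⟩

lemma Core.til (h : Core f P) : Core (til f) P where
  nf := h.til_nf
  ne z := by rw [til_order (h.mero _)]; exact h.ne _
  ne2 z := by rw [deriv_til, deriv_til, til_order (h.mero _).deriv.deriv]; exact h.ne2 _
  cj := h.cj
  im := h.im
  good z h1 h2 := by
    have h3 : (starRingEnd ℂ) z ∉ P := fun h3 => h2 (by simpa using h.cj _ h3)
    obtain ⟨a, b, c⟩ := h.good _ (conj_im_ne h1) h3
    refine ⟨til_an a, by simpa [NV.til] using b, ?_⟩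
    rw [deriv_til, deriv_til]
    simpa [NV.til] using c
  snr := by
    rintro ⟨c, hc⟩
    rw [til_til] at hc
    refine h.snr ⟨((starRingEnd ℂ) c), fun z => ?_⟩
    filter_upwards [(tendsto_conj_ne z).eventually (hc ((starRingEnd ℂ) z))] with w hw
    have := congrArg (starRingEnd ℂ) hw
    simpa [NV.til] using this

lemma Core.UH (h : Core f P) {Y : ℝ} (hY : 0 ≤ Y) : GR (mm fun w => LL f (zz Y w)) ∧ GR (mm fun w => AA f (zz Y w)) ∧
    GR (mm fun w => (AA f (zz Y w))⁻¹) := by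
  obtain ⟨a, b, c⟩ := NV.UH (Y := Y) (F := f) P fun z hz => ⟨h.mero z, fun hP => h.good z (by linarith) hP⟩
  refine ⟨a, b, ?_⟩
  simpa only [AA, inv_div] using c

lemma grf_of {Y : ℝ} {H : ℂ → ℂ} (hm : ∀ z, MeromorphicAt H z) (hg : GR (mm fun w => H (zz Y w))) :
    GRF Y fun z => log⁺ ‖H z‖ := by
  refine ⟨fun z => posLog_nonneg, fun r h1 h2 => ?_, hg⟩
  exact mero_ciP (h := fun w => H (zz Y w)) (fun w hw => (hm _).comp_analyticAt (analyticAt_zz Y hw)) (by linarith) h2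

lemma GRF.add {Y : ℝ} {F G : ℂ → ℝ} (hF : GRF Y F) (hG : GRF Y G) : GRF Y fun z => F z + G z := by
  obtain ⟨a1, a2, C, hC, a3⟩ := hF
  obtain ⟨b1, b2, D, hD, b3⟩ := hG
  refine ⟨fun z => add_nonneg (a1 z) (b1 z), fun r h1 h2 => (a2 r h1 h2).add (b2 r h1 h2), C + D, by positivity, fun r h1 h2 => ?_⟩
  have := circleAverage_add (a2 r h1 h2) (b2 r h1 h2)
  change circleAverage ((fun w => F (zz Y w)) + (fun w => G (zz Y w))) 0 r ≤ _
  rw [this, add_mul]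
  exact add_le_add (a3 r h1 h2) (b3 r h1 h2)

lemma meas_pl {H : ℂ → ℂ} (hm : ∀ z, MeromorphicAt H z) : Measurable fun z => log⁺ ‖H z‖ := by
  have h1 : Measurable H := Meromorphic.measurable hm
  have : (fun z => log⁺ ‖H z‖) = fun z => max 0 (Real.log ‖H z‖) := by ext z; rw [posLog_apply]
  rw [this]
  exact measurable_const.max (Real.measurable_log.comp h1.norm)

lemma ci_pl {H : ℂ → ℂ} (hm : ∀ z, MeromorphicAt H z) (r : ℝ) : CircleIntegrable (fun z => log⁺ ‖H z‖) 0 r :=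
  MeromorphicOn.circleIntegrable_posLog_norm fun z _ => hm z

noncomputable def FF (f : ℂ → ℂ) : ℂ → ℝ := fun z => ((log⁺ ‖AA f z‖ + log⁺ ‖(AA f z)⁻¹‖) + (log⁺ ‖AA (til f) z‖ + log⁺ ‖(AA (til f) z)⁻¹‖))
   + (log⁺ ‖LL f z‖ + log⁺ ‖LL (til f) z‖)

lemma Core.ciF (h : Core f P) (r : ℝ) : CircleIntegrable (FF f) 0 r :=
  (((ci_pl h.meroA r).add (ci_pl (fun z => (h.meroA z).fun_inv) r)).add ((ci_pl h.til.meroA r).add (ci_pl (fun z => (h.til.meroA z).fun_inv) r))).add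
   ((ci_pl h.meroL r).add (ci_pl h.til.meroL r))

lemma Core.good1 (h : Core f P) : ∃ C R₀ : ℝ, 0 ≤ C ∧ ∀ R, R₀ ≤ R → ∃ t, R < t ∧ t < 2 * R ∧ circleAverage (FF f) 0 t ≤ C * (R * Real.log R) := by
  obtain ⟨a1, a2, a3⟩ := h.UH le_rfl
  obtain ⟨b1, b2, b3⟩ := h.til.UH le_rfl
  have hg : GRF 0 (FF f) := (((grf_of h.meroA a2).add (grf_of (fun z => (h.meroA z).fun_inv) a3)).add ((grf_of h.til.meroA b2).add (grf_of (fun z => (h.til.meroA z).fun_inv) b3))).add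
   ((grf_of h.meroL a1).add (grf_of h.til.meroL b1))
  have hms : Measurable (FF f) := (((meas_pl h.meroA).add (meas_pl (fun z => (h.meroA z).fun_inv))).add ((meas_pl h.til.meroA).add (meas_pl (fun z => (h.til.meroA z).fun_inv)))).add
   ((meas_pl h.meroL).add (meas_pl h.til.meroL))
  obtain ⟨C, R₀, hC, hA⟩ := area_half hg
  refine ⟨C, max R₀ 1, hC, fun R hR => ?_⟩
  have hR0 : R₀ ≤ R := (le_max_left _ _).trans hR
  have hR1 : 1 ≤ R := (le_max_right _ _).trans hR
  have hl := Real.log_nonneg hR1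
  have hs : ∀ z, FF f ((starRingEnd ℂ) z) = FF f z := by
    intro z
    simp only [FF, ← til_AA, ← til_LL]
    simp only [NV.til, RingHomCompTriple.comp_apply, RingHom.id_apply, norm_inv, Complex.norm_conj, ← map_inv₀]
    ring
  obtain ⟨t, h1, h2, h3⟩ := good_radius hg.1 hms hs (fun r _ => h.ciF r) (by linarith) (by positivity) (hA R hR0)
  refine ⟨t, h1, h2, h3.trans (le_of_eq ?_)⟩
  have : R ≠ 0 := by linarith
  field_simp

end NV

open Complex Filter Topology MeasureTheory
open scoped Classical

namespace NV
open Metric Real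

/-- An entire zero-free function with `|log|G||` of growth `R log R` in the mean is an exponential. -/
lemma entire_lin {G : ℂ → ℂ} (hG : ∀ z, AnalyticAt ℂ G z) (h0 : ∀ z, G z ≠ 0) {C R₀ : ℝ} (hC : 0 ≤ C)
    (hm : ∀ R, R₀ ≤ R → ∃ t, R < t ∧ t < 2 * R ∧ circleAverage (fun z => |Real.log ‖G z‖|) 0 t ≤ C * (R * Real.log R)) :
    ∃ c : ℂ, ∀ z, G z = G 0 * Complex.exp (c * z) := by
  set h : ℂ → ℂ := fun z => deriv G z / G z with hh
  have hd : Differentiable ℂ h := fun z => ((hG z).deriv.fun_div (hG z) (h0 z)).differentiableAt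
  have hbd : ∀ w0 : ℂ, ∀ R, max R₀ 1 ≤ R → 4 * ‖w0‖ ≤ R → ‖deriv h w0‖ ≤ 8192 * C * (Real.log R / R) + 8192 * R⁻¹ ^ 2 := by
    intro w0 R hR hw0
    have hR0 : R₀ ≤ R := (le_max_left _ _).trans hR
    have hR1 : 1 ≤ R := (le_max_right _ _).trans hR
    have hl := Real.log_nonneg hR1
    obtain ⟨t, h1, h2, h3⟩ := hm R hR0
    have ht : 0 < t := by linarith
    have hb : ∀ w : ℂ, ‖w‖ ≤ R / 2 → ‖h w‖ ≤ 2048 * (C * (R * Real.log R) + 1) / R := by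
      intro w hw
      have := zf_deriv_bound (fun z _ => hG z) (fun z _ => h0 z) (r := t / 2) (by linarith) (by linarith) h3 (w := w) (by linarith)
      refine this.trans ?_
      have e : 256 * t ^ 2 * (C * (R * Real.log R) + 1) / (t - t / 2) ^ 3 = 2048 * (C * (R * Real.log R) + 1) / t := by
        have : t - t / 2 = t / 2 := by ring
        rw [this]; field_simp; ring
      rw [e]
      exact div_le_div_of_nonneg_left (by positivity) (by linarith) h1.le
    have := Complex.norm_deriv_le_of_forall_mem_sphere_norm_le (c := w0) (R := R / 4) (by linarith) hd.diffContOnCl (C := 2048 * (C * (R * Real.log R) + 1) / R) (by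
      intro z hz
      refine hb z ?_
      have h5 : ‖z - w0‖ = R / 4 := by simpa [dist_eq_norm] using hz
      have := norm_sub_norm_le z w0
      linarith)
    refine this.trans (le_of_eq ?_)
    have : R ≠ 0 := by linarith
    field_simp
    ring
  have hz : ∀ w, deriv h w = 0 := by
    intro w
    have hlim : Tendsto (fun R : ℝ => 8192 * C * (Real.log R / R) + 8192 * R⁻¹ ^ 2) atTop (𝓝 (8192 * C * 0 + 8192 * 0 ^ 2)) := by
      refine Tendsto.add (Tendsto.const_mul _ ?_) (Tendsto.const_mul _ (tendsto_inv_atTop_zero.pow 2))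
      have := Real.isLittleO_log_id_atTop.tendsto_div_nhds_zero
      simpa using this
    have : ‖deriv h w‖ ≤ 8192 * C * 0 + 8192 * 0 ^ 2 := by
      refine ge_of_tendsto hlim ?_
      filter_upwards [eventually_ge_atTop (max R₀ 1), eventually_ge_atTop (4 * ‖w‖)] with R h1 h2 using hbd w R h1 h2
    have h3 : ‖deriv h w‖ ≤ 0 := by simpa using this
    simpa using h3
  have hc : ∀ z, h z = h 0 := fun z => is_const_of_deriv_eq_zero hd hz z 0
  refine ⟨h 0, ?_⟩
  have hdG : ∀ z, HasDerivAt G (h 0 * G z) z := by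
    intro z
    refine (hG z).differentiableAt.hasDerivAt.congr_deriv ?_
    rw [← hc z, hh]; field_simp [h0 z]
  have hE : ∀ z, HasDerivAt (fun z => G z * Complex.exp (-(h 0 * z))) 0 z := by
    intro z
    have h1 : HasDerivAt (fun z : ℂ => Complex.exp (-(h 0 * z))) (Complex.exp (-(h 0 * z)) * (-(h 0 * 1))) z :=
      (((hasDerivAt_id z).const_mul (h 0)).neg).cexp
    refine ((hdG z).mul h1).congr_deriv ?_
    ring
  intro z
  have := is_const_of_deriv_eq_zero (f := fun z => G z * Complex.exp (-(h 0 * z))) (fun z => (hE z).differentiableAt) (fun z => (hE z).deriv) z 0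
  simp only [mul_zero, neg_zero, Complex.exp_zero, mul_one] at this
  rw [← this, mul_assoc, ← Complex.exp_add]; simp

variable {f : ℂ → ℂ} {P : Finset ℂ}

lemma order_zero_of_an {g : ℂ → ℂ} {z : ℂ} (h : AnalyticAt ℂ g z) (h0 : g z ≠ 0) : meromorphicOrderAt g z = 0 :=
  (h.meromorphicNFAt.meromorphicOrderAt_eq_zero_iff).2 h0

lemma Core.anA (h : Core f P) {z : ℂ} (h1 : z.im ≠ 0) (h2 : z ∉ P) : AnalyticAt ℂ (AA f) z ∧ AA f z ≠ 0 := by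
  obtain ⟨a, b, c⟩ := h.good z h1 h2
  exact ⟨a.deriv.deriv.fun_div a b, div_ne_zero c b⟩

lemma Core.ordAB (h : Core f P) {z : ℂ} (h2 : z ∉ P) : meromorphicOrderAt (AA f) z = meromorphicOrderAt (AA (NV.til f)) z := by
  by_cases h1 : z.im = 0
  · rw [← til_AA, til_order (h.meroA _)]
    congr 1
    exact (Complex.conj_eq_iff_im.2 h1).symm
  · rw [order_zero_of_an (h.anA h1 h2).1 (h.anA h1 h2).2, order_zero_of_an (h.til.anA h1 h2).1 (h.til.anA h1 h2).2]

/-- the rational-exponential function K -/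
noncomputable def KK (b c0 : ℂ) (n : ℂ → ℤ) (P : Finset ℂ) : ℂ → ℂ := fun z => b * Complex.exp (c0 * z) * ∏ s ∈ P, (z - s) ^ n s

lemma ev_fin (S : Finset ℂ) (z : ℂ) : ∀ᶠ w in 𝓝[≠] z, w ∉ S := by
  have := (ev_open_iff (p := fun w => w ∉ S) isOpen_univ).1 (finset_cod S Set.univ) z trivial
  exact this

lemma Core.K (h : Core f P) : ∃ b c0 : ℂ, ∃ n : ℂ → ℤ, b ≠ 0 ∧ ∀ z, ∀ᶠ w in 𝓝[≠] z, AA f w = KK b c0 n P w * AA (NV.til f) w := by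
  set k0 : ℂ → ℂ := AA f * (AA (NV.til f))⁻¹ with hk
  have hkm : ∀ z, MeromorphicAt k0 z := fun z => (h.meroA z).mul (h.til.meroA z).inv
  have hord : ∀ z, meromorphicOrderAt k0 z ≠ ⊤ := by
    intro z
    rw [hk, meromorphicOrderAt_mul (h.meroA z) (h.til.meroA z).inv, meromorphicOrderAt_inv]
    have h1 := h.neA z
    have h2 := h.til.neA z
    lift meromorphicOrderAt (AA f) z to ℤ using h1 with a
    lift meromorphicOrderAt (AA (NV.til f)) z to ℤ using h2 with b
    exact WithTop.coe_ne_top (a := a + -b)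
  have hord0 : ∀ z, z ∉ P → meromorphicOrderAt k0 z = 0 := by
    intro z hz
    rw [hk, meromorphicOrderAt_mul (h.meroA z) (h.til.meroA z).inv, meromorphicOrderAt_inv, ← h.ordAB hz]
    have h1 := h.neA z
    lift meromorphicOrderAt (AA f) z to ℤ using h1 with a
    change ((a + -a : ℤ) : WithTop ℤ) = 0
    simp
  have hMO : MeromorphicOn k0 Set.univ := fun z _ => hkm z
  set n : ℂ → ℤ := fun z => MeromorphicOn.divisor k0 Set.univ z with hn
  have hn0 : ∀ z, z ∉ P → n z = 0 := by
    intro z hz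
    simp only [hn]
    rw [MeromorphicOn.divisor_apply hMO trivial, hord0 z hz]; rfl
  have hsub : (MeromorphicOn.divisor k0 Set.univ).support ⊆ (P : Set ℂ) := by
    intro z hz
    by_contra hc
    exact hz (hn0 z (by simpa using hc))
  obtain ⟨G, hG, hG0, hkG⟩ := MeromorphicOn.extract_zeros_poles hMO (fun u => hord u) (P.finite_toSet.subset hsub)
  have hprod : (∏ᶠ u, (fun x : ℂ => x - u) ^ MeromorphicOn.divisor k0 Set.univ u) = fun z => ∏ s ∈ P, (z - s) ^ n s := by
    rw [finprod_eq_prod_of_mulSupport_subset (s := P)]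
    · ext z; simp [hn]
    · intro u hu
      by_contra hc
      refine hu ?_
      have := hn0 u (by simpa using hc)
      simp only [hn] at this
      simp [this]
  rw [hprod] at hkG
  have hk1 : ∀ᶠ z in codiscreteWithin (Set.univ : Set ℂ), k0 z = (∏ s ∈ P, (z - s) ^ n s) * G z := by
    filter_upwards [hkG] with z hz
    simpa using hz
  have hA0 : ∀ᶠ z in codiscreteWithin (Set.univ : Set ℂ), AA f z ≠ 0 :=
    (ev_open_iff isOpen_univ).2 fun z _ => (meromorphicOrderAt_ne_top_iff_eventually_ne_zero (h.meroA z)).1 (h.neA z)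
  have hB0 : ∀ᶠ z in codiscreteWithin (Set.univ : Set ℂ), AA (NV.til f) z ≠ 0 :=
    (ev_open_iff isOpen_univ).2 fun z _ => (meromorphicOrderAt_ne_top_iff_eventually_ne_zero (h.til.meroA z)).1 (h.til.neA z)
  -- growth
  obtain ⟨C, R₀, hC, hgood⟩ := h.good1
  set D : ℝ := ∑ s ∈ P, |(n s : ℝ)| with hD
  have hD0 : 0 ≤ D := Finset.sum_nonneg fun s _ => abs_nonneg _
  obtain ⟨m, hm1, hm⟩ : ∃ m : ℝ, 1 ≤ m ∧ ∀ s ∈ P, ‖s‖ ≤ m := by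
    refine ⟨1 + ∑ s ∈ P, ‖s‖, by linarith [Finset.sum_nonneg (fun (s : ℂ) (_ : s ∈ P) => norm_nonneg s)], fun s hs => ?_⟩
    have := Finset.single_le_sum (fun (s : ℂ) (_ : s ∈ P) => norm_nonneg s) hs
    linarith
  have hGrow : ∀ R, max R₀ (2 * m + 4) ≤ R → ∃ t, R < t ∧ t < 2 * R ∧ circleAverage (fun z => |Real.log ‖G z‖|) 0 t ≤ (C + 2 * D) * (R * Real.log R) := by
    intro R hR
    have hR0 : R₀ ≤ R := (le_max_left _ _).trans hR
    have hR1 : 2 * m + 4 ≤ R := (le_max_right _ _).trans hR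
    obtain ⟨t, h1, h2, h3⟩ := hgood R hR0
    refine ⟨t, h1, h2, ?_⟩
    have ht : 0 < t := by linarith
    have hlR : Real.log 4 ≤ Real.log R := Real.log_le_log (by norm_num) (by linarith)
    have hl4 : 1 ≤ Real.log 4 := by
      rw [show (4:ℝ) = 2 ^ 2 by norm_num, Real.log_pow]; have := Real.log_two_gt_d9; push_cast; linarith
    have hcG : CircleIntegrable (fun z => |Real.log ‖G z‖|) 0 t := by
      refine ContinuousOn.circleIntegrable ht.le fun z _ => ?_
      have h5 : ContinuousAt G z := (hG z trivial).continuousAt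
      exact ((h5.norm.log (by simpa using hG0 ⟨z, trivial⟩)).abs).continuousWithinAt
    have hmon : circleAverage (fun z => |Real.log ‖G z‖|) 0 t ≤ circleAverage (fun z => D * (2 * Real.log R) + FF f z) 0 t := by
      refine avg_mono_cod ht.ne' hcG (ci_const_add _ (h.ciF t)) ?_
      have hsp : ∀ᶠ z in codiscreteWithin (sphere (0:ℂ) |t|), ‖z‖ = t := by
        filter_upwards [self_mem_codiscreteWithin (sphere (0:ℂ) |t|)] with z hz
        simpa [abs_of_pos ht] using hz
      filter_upwards [hsp, sphere_cod (Set.subset_univ _) hk1, sphere_cod (Set.subset_univ _) hA0, sphere_cod (Set.subset_univ _) hB0] with z hz e1 e2 e3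
      have hs : ∀ s ∈ P, 1 ≤ ‖z - s‖ ∧ ‖z - s‖ ≤ R ^ 2 := by
        intro s hs
        have := hm s hs
        have a1 := norm_sub_norm_le z s
        have a2 := norm_sub_le z s
        constructor
        · linarith
        · nlinarith
      have e4 : Real.log ‖G z‖ = Real.log ‖AA f z‖ - Real.log ‖AA (NV.til f) z‖ - ∑ s ∈ P, (n s : ℝ) * Real.log ‖z - s‖ := by
        have hpne : ∏ s ∈ P, (z - s) ^ n s ≠ 0 := Finset.prod_ne_zero_iff.2 fun s hs' => zpow_ne_zero _ (by
          intro h0; have := (hs s hs').1; rw [h0] at this; norm_num at this)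
        have e5 : AA f z = (∏ s ∈ P, (z - s) ^ n s) * G z * AA (NV.til f) z := by
          rw [← e1, hk]; simp [e3]
        have e6 := congrArg (fun x => Real.log ‖x‖) e5
        simp only [norm_mul] at e6
        rw [Real.log_mul (mul_ne_zero (norm_ne_zero_iff.2 hpne) (by simpa using hG0 ⟨z, trivial⟩)) (by simpa using e3),
          Real.log_mul (norm_ne_zero_iff.2 hpne) (by simpa using hG0 ⟨z, trivial⟩), norm_prod, Real.log_prod (fun s hs' => by
            rw [norm_ne_zero_iff]; exact (Finset.prod_ne_zero_iff.1 hpne) s hs')] at e6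
        simp only [norm_zpow, Real.log_zpow] at e6
        linarith
      have e7 : |∑ s ∈ P, (n s : ℝ) * Real.log ‖z - s‖| ≤ D * (2 * Real.log R) := by
        refine (Finset.abs_sum_le_sum_abs _ _).trans ?_
        rw [hD, Finset.sum_mul]
        refine Finset.sum_le_sum fun s hs' => ?_
        obtain ⟨b1, b2⟩ := hs s hs'
        rw [abs_mul, abs_of_nonneg (Real.log_nonneg b1)]
        refine mul_le_mul_of_nonneg_left ?_ (abs_nonneg _)
        have := Real.log_le_log (by linarith) b2
        rwa [Real.log_pow] at this
      have e8 : ∀ x : ℂ, |Real.log ‖x‖| = log⁺ ‖x‖ + log⁺ ‖x⁻¹‖ := by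
        intro x
        rw [posLog_apply, posLog_apply, norm_inv, Real.log_inv]
        rcases le_total 0 (Real.log ‖x‖) with h | h
        · rw [abs_of_nonneg h, max_eq_right h, max_eq_left (by linarith)]; ring
        · rw [abs_of_nonpos h, max_eq_left h, max_eq_right (by linarith)]; ring
      have e9 : 0 ≤ log⁺ ‖LL f z‖ := posLog_nonneg
      have e10 : 0 ≤ log⁺ ‖LL (NV.til f) z‖ := posLog_nonneg
      rw [e4]
      refine (abs_sub _ _).trans ?_
      have := abs_sub (Real.log ‖AA f z‖) (Real.log ‖AA (NV.til f) z‖)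
      rw [e8, e8] at this
      simp only [FF]
      linarith
    refine hmon.trans ?_
    rw [avg_const_add _ (h.ciF t)]
    have : D * (2 * Real.log R) ≤ 2 * D * (R * Real.log R) := by
      have : Real.log R ≤ R * Real.log R := by nlinarith
      nlinarith
    linarith
  obtain ⟨c0, hc0⟩ := entire_lin (fun z => hG z trivial) (fun z => hG0 ⟨z, trivial⟩) (C := C + 2 * D) (by positivity) hGrow
  refine ⟨G 0, c0, n, hG0 ⟨0, trivial⟩, fun z => ?_⟩
  have := (ev_open_iff isOpen_univ).1 (hk1.and hB0) z trivial
  filter_upwards [this] with w hw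
  have e5 : AA f w = (∏ s ∈ P, (w - s) ^ n s) * G w * AA (NV.til f) w := by
    rw [← hw.1, hk]; simp [hw.2]
  rw [e5, hc0 w, KK]; ring

end NV

open Complex Filter Topology MeasureTheory
open scoped Classical

namespace NV
open Metric Real

variable {f : ℂ → ℂ} {P : Finset ℂ}

noncomputable def dd (c0 : ℂ) (n : ℂ → ℤ) (P : Finset ℂ) : ℂ → ℂ := fun z => (c0 + ∑ s ∈ P, n s / (z - s)) / (2 * I)

lemma KK_an (b c0 : ℂ) (n : ℂ → ℤ) {z : ℂ} (hz : z ∉ P) : AnalyticAt ℂ (KK b c0 n P) z := by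
  have h1 : ∀ s ∈ P, AnalyticAt ℂ (fun z : ℂ => (z - s) ^ n s) z := by
    intro s hs
    have : z - s ≠ 0 := sub_ne_zero.2 fun h => hz (h ▸ hs)
    exact (analyticAt_id.sub analyticAt_const).fun_zpow this
  have h2 : AnalyticAt ℂ (fun z : ℂ => ∏ s ∈ P, (z - s) ^ n s) z := Finset.analyticAt_fun_prod _ h1
  have h3 : AnalyticAt ℂ (fun z : ℂ => b * Complex.exp (c0 * z)) z := by fun_prop
  exact h3.mul h2

lemma KK_ne {b : ℂ} (hb : b ≠ 0) (c0 : ℂ) (n : ℂ → ℤ) {z : ℂ} (hz : z ∉ P) : KK b c0 n P z ≠ 0 := by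
  refine mul_ne_zero (mul_ne_zero hb (Complex.exp_ne_zero _)) (Finset.prod_ne_zero_iff.2 fun s hs => zpow_ne_zero _ ?_)
  exact sub_ne_zero.2 fun h => hz (h ▸ hs)

lemma dd_an (c0 : ℂ) (n : ℂ → ℤ) {z : ℂ} (hz : z ∉ P) : AnalyticAt ℂ (dd c0 n P) z := by
  have h1 : ∀ s ∈ P, AnalyticAt ℂ (fun z : ℂ => (n s : ℂ) / (z - s)) z := by
    intro s hs
    have : z - s ≠ 0 := sub_ne_zero.2 fun h => hz (h ▸ hs)
    exact analyticAt_const.fun_div (analyticAt_id.sub analyticAt_const) this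
  have h2 : AnalyticAt ℂ (fun z : ℂ => ∑ s ∈ P, (n s : ℂ) / (z - s)) z := Finset.analyticAt_fun_sum _ h1
  exact (analyticAt_const.add h2).fun_div analyticAt_const (by simp)

lemma KK_deriv {b : ℂ} (hb : b ≠ 0) (c0 : ℂ) (n : ℂ → ℤ) {z : ℂ} (hz : z ∉ P) :
    HasDerivAt (KK b c0 n P) (2 * I * dd c0 n P z * KK b c0 n P z) z := by
  have hs : ∀ s ∈ P, z - s ≠ 0 := fun s hs => sub_ne_zero.2 fun h => hz (h ▸ hs)
  have h1 : logDeriv (KK b c0 n P) z = c0 + ∑ s ∈ P, n s / (z - s) := by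
    have e : KK b c0 n P = fun z => (b * Complex.exp (c0 * z)) * (∏ s ∈ P, (z - s) ^ n s) := rfl
    have hexp : HasDerivAt (fun z : ℂ => b * Complex.exp (c0 * z)) (b * (Complex.exp (c0 * z) * (c0 * 1))) z :=
      (((hasDerivAt_id z).const_mul c0).cexp).const_mul b
    rw [e, logDeriv_mul (f := fun z => b * Complex.exp (c0 * z)) (g := fun z => ∏ s ∈ P, (z - s) ^ n s) z (mul_ne_zero hb (Complex.exp_ne_zero _))
      (Finset.prod_ne_zero_iff.2 fun s h' => zpow_ne_zero _ (hs s h')) hexp.differentiableAt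
      (Finset.analyticAt_fun_prod _ fun s h' => (analyticAt_id.sub analyticAt_const).fun_zpow (hs s h')).differentiableAt,
      logDeriv_prod (f := fun s z => (z - s) ^ n s) (fun s h' => zpow_ne_zero _ (hs s h'))
      (fun s h' => ((analyticAt_id.sub analyticAt_const).fun_zpow (hs s h')).differentiableAt)]
    congr 1
    · rw [logDeriv_apply, hexp.deriv]; field_simp
    · refine Finset.sum_congr rfl fun s h' => ?_
      rw [logDeriv_fun_zpow (by fun_prop), logDeriv_apply]
      have : deriv (fun x : ℂ => x - s) z = 1 := ((hasDerivAt_id z).sub_const s).deriv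
      rw [this]; ring
  refine (KK_an b c0 n hz).differentiableAt.hasDerivAt.congr_deriv ?_
  rw [logDeriv_apply, div_eq_iff (KK_ne hb c0 n hz)] at h1
  rw [h1, dd]
  field_simp

lemma Core.real_notMem (h : Core f P) (x : ℝ) : (x : ℂ) ∉ P := fun hx => h.im _ hx (by simp)

lemma conj_real (x : ℝ) : (starRingEnd ℂ) (x : ℂ) = x := Complex.conj_ofReal x

/-- The standing data for step 3 onwards. -/
structure KData (f : ℂ → ℂ) (P : Finset ℂ) (b c0 : ℂ) (n : ℂ → ℤ) : Prop where
  core : Core f P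
  hb : b ≠ 0
  hK : ∀ z, ∀ᶠ w in 𝓝[≠] z, AA f w = KK b c0 n P w * AA (til f) w

variable {b c0 : ℂ} {n : ℂ → ℤ}

lemma KData.unit (k : KData f P b c0 n) (x : ℝ) : KK b c0 n P x * (starRingEnd ℂ) (KK b c0 n P x) = 1 := by
  have h := k.core
  have h1 := k.hK x
  have h2 := (tendsto_conj_ne (x:ℂ)).eventually (by rw [conj_real]; exact h1)
  have h3 := (meromorphicOrderAt_ne_top_iff_eventually_ne_zero (h.meroA x)).1 (h.neA x)
  have h4 : ∀ᶠ w in 𝓝[≠] (x:ℂ), KK b c0 n P w * til (KK b c0 n P) w = 1 := by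
    filter_upwards [h1, h2, h3] with w e1 e2 e3
    have e4 := congrArg (starRingEnd ℂ) e2
    rw [← til_AA] at e1 e4
    simp only [map_mul] at e4
    have e5 : til (AA f) w = til (KK b c0 n P) w * AA f w := by
      have : (starRingEnd ℂ) (til (AA f) ((starRingEnd ℂ) w)) = AA f w := by simp [til]
      rw [this] at e4
      exact e4
    rw [e5] at e1
    refine mul_right_cancel₀ e3 ?_
    rw [one_mul, mul_assoc]; exact e1.symm
  have hx := h.real_notMem x
  have hc : AnalyticAt ℂ (fun w => KK b c0 n P w * til (KK b c0 n P) w) x :=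
    (KK_an b c0 n hx).mul (til_an (by rw [conj_real]; exact KK_an b c0 n hx))
  have h5 := tendsto_nhds_unique (hc.continuousAt.tendsto.mono_left nhdsWithin_le_nhds) (tendsto_const_nhds.congr' (h4.mono fun w hw => hw.symm))
  simpa [til, conj_real] using h5

lemma ofReal_tendsto (x : ℝ) : Tendsto (fun t : ℝ => (t : ℂ)) (𝓝[≠] x) (𝓝[≠] (x : ℂ)) := by
  refine tendsto_nhdsWithin_iff.2 ⟨(Complex.continuous_ofReal.tendsto x).mono_left nhdsWithin_le_nhds, ?_⟩
  filter_upwards [self_mem_nhdsWithin] with t ht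
  simpa using ht

/-- `p = Re K`, `q = Im K`, `d` on the real line. -/
lemma KData.pq (k : KData f P b c0 n) (x : ℝ) : (KK b c0 n P x).re ^ 2 + (KK b c0 n P x).im ^ 2 = 1 := by
  have := k.unit x
  rw [Complex.mul_conj, Complex.normSq_apply] at this
  have h2 : (KK b c0 n P x).re * (KK b c0 n P x).re + (KK b c0 n P x).im * (KK b c0 n P x).im = 1 := by exact_mod_cast this
  nlinarith

lemma KData.d_real (k : KData f P b c0 n) (x : ℝ) : (dd c0 n P x).im = 0 := by
  have hx := k.core.real_notMem x
  have h1 : HasDerivAt (fun t : ℝ => (KK b c0 n P t).re) (2 * I * dd c0 n P x * KK b c0 n P x).re x := (KK_deriv k.hb c0 n hx).real_of_complex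
  have h2 : HasDerivAt (fun t : ℝ => (KK b c0 n P t).im) (2 * I * dd c0 n P x * KK b c0 n P x).im x := by
    have := ((KK_deriv k.hb c0 n hx).const_mul (-I)).real_of_complex
    simpa using this
  have h3 := (h1.pow 2).add (h2.pow 2)
  have h4 : HasDerivAt (fun t : ℝ => (KK b c0 n P t).re ^ 2 + (KK b c0 n P t).im ^ 2) 0 x := by
    have : (fun t : ℝ => (KK b c0 n P t).re ^ 2 + (KK b c0 n P t).im ^ 2) = fun _ => 1 := by funext t; exact k.pq t
    rw [this]; exact hasDerivAt_const _ _
  have h5 := h3.unique h4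
  have h6 := k.pq x
  simp at h5
  nlinarith

lemma KData.dp (k : KData f P b c0 n) (x : ℝ) : HasDerivAt (fun t : ℝ => (KK b c0 n P t).re) (-2 * (dd c0 n P x).re * (KK b c0 n P x).im) x := by
  have hx := k.core.real_notMem x
  have h1 : HasDerivAt (fun t : ℝ => (KK b c0 n P t).re) (2 * I * dd c0 n P x * KK b c0 n P x).re x := (KK_deriv k.hb c0 n hx).real_of_complex
  refine h1.congr_deriv ?_
  have := k.d_real x
  simp [this]

lemma KData.dq (k : KData f P b c0 n) (x : ℝ) : HasDerivAt (fun t : ℝ => (KK b c0 n P t).im) (2 * (dd c0 n P x).re * (KK b c0 n P x).re) x := by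
  have hx := k.core.real_notMem x
  have h2 : HasDerivAt (fun t : ℝ => (KK b c0 n P t).im) (2 * I * dd c0 n P x * KK b c0 n P x).im x := by
    have := ((KK_deriv k.hb c0 n hx).const_mul (-I)).real_of_complex
    simpa using this
  refine h2.congr_deriv ?_
  have := k.d_real x
  simp [this]

noncomputable def kap (b c0 : ℂ) (n : ℂ → ℤ) (P : Finset ℂ) (x : ℝ) : ℝ := (KK b c0 n P x).im / (1 - (KK b c0 n P x).re)

lemma KData.re_ne (k : KData f P b c0 n) {x : ℝ} (hx : KK b c0 n P x ≠ 1) : (0:ℝ) < 1 - (KK b c0 n P x).re := by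
  have h1 := k.pq x
  rcases lt_trichotomy (KK b c0 n P x).re 1 with h | h | h
  · linarith
  · exfalso; apply hx
    rw [h] at h1
    apply Complex.ext
    · simpa using h
    · have : (KK b c0 n P x).im ^ 2 = 0 := by linarith
      simpa using this
  · nlinarith [sq_nonneg (KK b c0 n P x).im]

lemma KData.dkap (k : KData f P b c0 n) {x : ℝ} (hx : KK b c0 n P x ≠ 1) :
    HasDerivAt (kap b c0 n P) (-2 * (dd c0 n P x).re / (1 - (KK b c0 n P x).re)) x := by
  have h0 := k.re_ne hx
  refine ((k.dq x).div ((k.dp x).const_sub 1) h0.ne').congr_deriv ?_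
  have := k.pq x
  field_simp
  linear_combination (-1 : ℝ) * (dd c0 n P x).re * this

/-- the real Riccati function -/
noncomputable def yy (f : ℂ → ℂ) (b c0 : ℂ) (n : ℂ → ℤ) (P : Finset ℂ) (x : ℝ) : ℝ := (LL f x).re - kap b c0 n P x * (LL f x).im

lemma AA_eq {z : ℂ} (hf : AnalyticAt ℂ f z) (h0 : f z ≠ 0) : HasDerivAt (LL f) (AA f z - LL f z ^ 2) z := by
  refine (hf.deriv.differentiableAt.hasDerivAt.div hf.differentiableAt.hasDerivAt h0).congr_deriv ?_
  simp only [AA, LL]; field_simp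

lemma KData.A_real (k : KData f P b c0 n) {x : ℝ} (hf : AnalyticAt ℂ f x) (h0 : f x ≠ 0) :
    AA f x = KK b c0 n P x * (starRingEnd ℂ) (AA f x) := by
  have hA : AnalyticAt ℂ (AA f) x := hf.deriv.deriv.fun_div hf h0
  have hB : AnalyticAt ℂ (fun w => KK b c0 n P w * AA (til f) w) x := by
    rw [← til_AA]
    exact (KK_an b c0 n (k.core.real_notMem x)).mul (til_an (by rw [conj_real]; exact hA))
  have := tendsto_nhds_unique (hB.continuousAt.tendsto.mono_left nhdsWithin_le_nhds)
    ((hA.continuousAt.tendsto.mono_left nhdsWithin_le_nhds).congr' (k.hK x))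
  have e : AA (til f) (x:ℂ) = (starRingEnd ℂ) (AA f x) := by rw [← til_AA]; simp [til, conj_real]
  rw [e] at this
  exact this.symm

lemma KData.dy (k : KData f P b c0 n) {x : ℝ} (hf : AnalyticAt ℂ f x) (h0 : f x ≠ 0) (hx : KK b c0 n P x ≠ 1) :
    ∃ y', HasDerivAt (yy f b c0 n P) y' x ∧ -((dd c0 n P x).re ^ 2 / (2 * (1 - (KK b c0 n P x).re))) ≤ y' + yy f b c0 n P x ^ 2 := by
  have hp := k.re_ne hx
  have hL := AA_eq hf h0
  have hN : HasDerivAt (fun t : ℝ => (LL f t).re) (AA f x - LL f x ^ 2).re x := hL.real_of_complex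
  have hT : HasDerivAt (fun t : ℝ => (LL f t).im) (AA f x - LL f x ^ 2).im x := by
    have := (hL.const_mul (-I)).real_of_complex
    simpa using this
  refine ⟨_, hN.sub ((k.dkap hx).mul hT), ?_⟩
  have hA := k.A_real hf h0
  have h1 := congrArg Complex.re hA
  have h2 := k.pq x
  simp only [Complex.mul_re, Complex.conj_re, Complex.conj_im] at h1
  simp only [yy, kap, Complex.sub_re, Complex.sub_im, sq, Complex.mul_re, Complex.mul_im]
  set p := (KK b c0 n P x).re
  set q := (KK b c0 n P x).im
  set d := (dd c0 n P x).re
  set N := (LL f x).re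
  set τ := (LL f x).im
  set α := (AA f x).re
  set β := (AA f x).im
  have h3 : α = q / (1 - p) * β := by field_simp; linarith
  have e : α - (N * N - τ * τ) - (-2 * d / (1 - p) * τ + q / (1 - p) * (β - (N * τ + τ * N))) + (N - q / (1 - p) * τ) * (N - q / (1 - p) * τ)
      + d * d / (2 * (1 - p)) = 2 * (τ + d / 2) ^ 2 / (1 - p) := by
    rw [h3]
    field_simp
    linear_combination (2 * τ ^ 2) * h2
  have : 0 ≤ 2 * (τ + d / 2) ^ 2 / (1 - p) := by positivity
  linarith

end NV

open Complex Filter Topology MeasureTheory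
open scoped Classical

namespace NV
open Metric Real

variable {f : ℂ → ℂ} {P : Finset ℂ} {b c0 : ℂ} {n : ℂ → ℤ}

lemma Core.an0 (h : Core f P) {z : ℂ} (h0 : meromorphicOrderAt f z = 0) : AnalyticAt ℂ f z ∧ f z ≠ 0 :=
  ⟨(h.nf z).meromorphicOrderAt_nonneg_iff_analyticAt.1 h0.ge, ((h.nf z).meromorphicOrderAt_eq_zero_iff).1 h0⟩

lemma Core.ev_an (h : Core f P) (z : ℂ) : ∀ᶠ w in 𝓝[≠] z, AnalyticAt ℂ f w ∧ f w ≠ 0 :=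
  (h.mero z).eventually_analyticAt.and ((meromorphicOrderAt_ne_top_iff_eventually_ne_zero (h.mero z)).1 (h.ne z))

lemma Core.A_lim (h : Core f P) {x : ℂ} {p : ℤ} (hp : meromorphicOrderAt f x = p) :
    Tendsto (fun z => (z - x) ^ 2 * AA f z) (𝓝[≠] x) (𝓝 ((p:ℂ) ^ 2 - p)) := by
  obtain ⟨k, hk, he⟩ := logderiv_form (h.mero x) hp
  have he' : LL f =ᶠ[𝓝[≠] x] fun z => p / (z - x) + k z := he
  have hd := he'.nhdsNE_deriv
  have hka : ∀ᶠ z in 𝓝[≠] x, AnalyticAt ℂ k z := hk.eventually_analyticAt.filter_mono nhdsWithin_le_nhds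
  have hF : ∀ᶠ z in 𝓝[≠] x, -(p:ℂ) + (z - x) ^ 2 * deriv k z + (p + (z - x) * k z) ^ 2 = (z - x) ^ 2 * AA f z := by
    filter_upwards [he', hd, hka, h.ev_an x, self_mem_nhdsWithin] with z e1 e2 e3 e4 e5
    have hz : z - x ≠ 0 := sub_ne_zero.2 (by simpa using e5)
    have h1 := (AA_eq e4.1 e4.2).deriv
    have h2 : HasDerivAt (fun z => p / (z - x) + k z) (-(p:ℂ) / (z - x) ^ 2 + deriv k z) z := by
      refine (((hasDerivAt_const z (p:ℂ)).div ((hasDerivAt_id z).sub_const x) hz).add e3.differentiableAt.hasDerivAt).congr_deriv ?_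
      simp
    rw [e2, h2.deriv] at h1
    have h3 : AA f z = -(p:ℂ) / (z - x) ^ 2 + deriv k z + (p / (z - x) + k z) ^ 2 := by
      rw [e1] at h1
      linear_combination -h1
    rw [h3]
    field_simp
  refine Tendsto.congr' hF ?_
  have hc : ContinuousAt (fun z => -(p:ℂ) + (z - x) ^ 2 * deriv k z + (p + (z - x) * k z) ^ 2) x := by
    have h1 := hk.continuousAt
    have h2 := hk.deriv.continuousAt
    fun_prop
  have := hc.tendsto.mono_left (nhdsWithin_le_nhds (s := {x}ᶜ))
  simp only [sub_self] at this
  convert this using 2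
  ring

lemma KData.simple (k : KData f P b c0 n) {x : ℝ} (h0 : meromorphicOrderAt f x ≠ 0) (hx : KK b c0 n P x ≠ 1) :
    meromorphicOrderAt f (x:ℂ) = (1:ℤ) := by
  have h := k.core
  obtain ⟨p, hp⟩ := WithTop.ne_top_iff_exists.1 (h.ne x)
  have hA := h.A_lim hp.symm
  have hp2 : meromorphicOrderAt (til f) (x:ℂ) = p := by rw [til_order (by rw [conj_real]; exact h.mero x), conj_real]; exact hp.symm
  have hB := h.til.A_lim hp2
  have hKc : Tendsto (KK b c0 n P) (𝓝[≠] (x:ℂ)) (𝓝 (KK b c0 n P x)) :=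
    (KK_an b c0 n (h.real_notMem x)).continuousAt.tendsto.mono_left nhdsWithin_le_nhds
  have h3 := tendsto_nhds_unique hA ((hKc.mul hB).congr' (by
    filter_upwards [k.hK x] with w hw
    rw [hw]; ring))
  have h4 : ((p:ℂ) ^ 2 - p) * (KK b c0 n P x - 1) = 0 := by linear_combination -h3
  rcases mul_eq_zero.1 h4 with h5 | h5
  · have h6 : (p:ℂ) * (p - 1) = 0 := by linear_combination h5
    have h7 : p * (p - 1) = 0 := by exact_mod_cast h6
    rcases mul_eq_zero.1 h7 with h8 | h8
    · exfalso; apply h0; rw [← hp, h8]; rfl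
    · rw [← hp, show p = 1 by omega]
  · exact absurd (sub_eq_zero.1 h5) hx

lemma KData.y_form (k : KData f P b c0 n) {x : ℝ} (h0 : meromorphicOrderAt f x ≠ 0) (hx : KK b c0 n P x ≠ 1) :
    ∃ g : ℝ → ℝ, ContinuousAt g x ∧ ∀ᶠ t in 𝓝[≠] x, yy f b c0 n P t = (t - x)⁻¹ + g t := by
  have h := k.core
  obtain ⟨g, hg, he⟩ := logderiv_form (h.mero x) (k.simple h0 hx)
  refine ⟨fun t => (g t).re - kap b c0 n P t * (g t).im, ?_, ?_⟩
  · have h1 : ContinuousAt (fun t : ℝ => g t) x := ContinuousAt.comp (f := fun t : ℝ => (t:ℂ)) hg.continuousAt Complex.continuous_ofReal.continuousAt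
    have h2 := (k.dkap hx).continuousAt
    exact (Complex.continuous_re.continuousAt.comp h1).sub (h2.mul (Complex.continuous_im.continuousAt.comp h1))
  · filter_upwards [(ofReal_tendsto x).eventually he] with t ht
    simp only [yy, LL]
    rw [ht]
    have : ((1:ℤ):ℂ) / ((t:ℂ) - x) = (((t - x)⁻¹ : ℝ) : ℂ) := by push_cast; simp
    rw [this]
    simp only [Complex.add_re, Complex.add_im, Complex.ofReal_re, Complex.ofReal_im, zero_add]
    ring

/-- comparison -/
lemma KData.gap0 (k : KData f P b c0 n) {x₁ x₂ : ℝ} (hlt : x₁ < x₂) (h1 : meromorphicOrderAt f x₁ ≠ 0) (h2 : meromorphicOrderAt f x₂ ≠ 0)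
    (hU : ∀ x ∈ Set.Icc x₁ x₂, KK b c0 n P x ≠ 1) (hZ : ∀ x ∈ Set.Ioo x₁ x₂, meromorphicOrderAt f (x:ℂ) = 0)
    {y0 y1 : ℝ → ℝ} (hy0 : ∀ x ∈ Set.Icc x₁ x₂, HasDerivAt y0 (y1 x) x)
    (hy : ∀ x ∈ Set.Icc x₁ x₂, y1 x + y0 x ^ 2 + (dd c0 n P x).re ^ 2 / (2 * (1 - (KK b c0 n P x).re)) < 0) : False := by
  obtain ⟨g, hg, hge⟩ := k.y_form h1 (hU _ ⟨le_rfl, hlt.le⟩)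
  obtain ⟨g', hg', hge'⟩ := k.y_form h2 (hU _ ⟨hlt.le, le_rfl⟩)
  have hd : ∀ x ∈ Set.Ioo x₁ x₂, ∃ y', HasDerivAt (yy f b c0 n P) y' x ∧ -((dd c0 n P x).re ^ 2 / (2 * (1 - (KK b c0 n P x).re))) ≤ y' + yy f b c0 n P x ^ 2 := by
    intro x hx
    obtain ⟨a1, a2⟩ := k.core.an0 (hZ x hx)
    exact k.dy a1 a2 (hU x ⟨hx.1.le, hx.2.le⟩)
  choose! y' hy' hyi using hd
  -- left point
  have hleft : ∀ᶠ t in 𝓝[>] x₁, y0 t ≤ yy f b c0 n P t := by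
    have t1 : Tendsto (fun t : ℝ => (t - x₁)⁻¹ + (g t - y0 t)) (𝓝[>] x₁) atTop := by
      refine Tendsto.atTop_add (C := g x₁ - y0 x₁) ?_ ?_
      · refine tendsto_inv_nhdsGT_zero.comp (tendsto_nhdsWithin_iff.2 ⟨?_, ?_⟩)
        · have : Tendsto (fun t : ℝ => t - x₁) (𝓝 x₁) (𝓝 (x₁ - x₁)) := by apply Continuous.tendsto; fun_prop
          rw [sub_self] at this
          exact this.mono_left nhdsWithin_le_nhds
        · filter_upwards [self_mem_nhdsWithin] with t ht using by simpa using ht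
      · exact (hg.tendsto.sub (hy0 _ ⟨le_rfl, hlt.le⟩).continuousAt.tendsto).mono_left nhdsWithin_le_nhds
    filter_upwards [t1.eventually_ge_atTop 0, hge.filter_mono (nhdsWithin_mono _ fun t (ht : x₁ < t) => ht.ne')] with t e1 e2
    rw [e2]; linarith
  have hright : ∀ᶠ t in 𝓝[<] x₂, yy f b c0 n P t < y0 t := by
    have t1 : Tendsto (fun t : ℝ => (t - x₂)⁻¹ + (g' t - y0 t)) (𝓝[<] x₂) atBot := by
      refine Tendsto.atBot_add (C := g' x₂ - y0 x₂) ?_ ?_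
      · refine tendsto_inv_nhdsLT_zero.comp (tendsto_nhdsWithin_iff.2 ⟨?_, ?_⟩)
        · have : Tendsto (fun t : ℝ => t - x₂) (𝓝 x₂) (𝓝 (x₂ - x₂)) := by apply Continuous.tendsto; fun_prop
          rw [sub_self] at this
          exact this.mono_left nhdsWithin_le_nhds
        · filter_upwards [self_mem_nhdsWithin] with t ht using by simpa using ht
      · exact (hg'.tendsto.sub (hy0 _ ⟨hlt.le, le_rfl⟩).continuousAt.tendsto).mono_left nhdsWithin_le_nhds
    filter_upwards [t1.eventually_lt_atBot 0, hge'.filter_mono (nhdsWithin_mono _ fun t (ht : t < x₂) => ht.ne)] with t e1 e2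
    rw [e2]; linarith
  set m := (x₁ + x₂) / 2 with hm
  obtain ⟨p, hp1, hp2⟩ := (hleft.and (Ioo_mem_nhdsGT (show x₁ < m by linarith))).exists
  obtain ⟨q, hq1, hq2⟩ := (hright.and (Ioo_mem_nhdsLT (show m < x₂ by linarith))).exists
  have hpq : p < q := hp2.2.trans hq2.1
  have hin : ∀ x ∈ Set.Icc p q, x ∈ Set.Ioo x₁ x₂ := fun x hx => ⟨by linarith [hp2.1, hx.1], by linarith [hq2.2, hx.2]⟩
  have := image_le_of_deriv_right_lt_deriv_boundary' (f := y0) (f' := y1) (a := p) (b := q) (B := yy f b c0 n P) (B' := y')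
    (fun x hx => (hy0 x ⟨(hin x hx).1.le, (hin x hx).2.le⟩).continuousAt.continuousWithinAt)
    (fun x hx => (hy0 x ⟨(hin x ⟨hx.1, hx.2.le⟩).1.le, (hin x ⟨hx.1, hx.2.le⟩).2.le⟩).hasDerivWithinAt) hp1
    (fun x hx => (hy' x (hin x hx)).continuousAt.continuousWithinAt)
    (fun x hx => (hy' x (hin x ⟨hx.1, hx.2.le⟩)).hasDerivWithinAt)
    (fun x hx hxe => by
      have i := hin x ⟨hx.1, hx.2.le⟩
      have a1 := hyi x i
      have a2 := hy x ⟨i.1.le, i.2.le⟩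
      rw [hxe] at a2
      linarith)
  have h9 := this (x := q) ⟨hpq.le, le_rfl⟩
  linarith

/-- the set of zeros and poles -/
def ZP (f : ℂ → ℂ) : Set ℂ := {z | meromorphicOrderAt f z ≠ 0}

lemma zp_fin (h : ∀ z, MeromorphicAt f z) (hne : ∀ z, meromorphicOrderAt f z ≠ ⊤) (t : ℝ) : (ZP f ∩ closedBall 0 t).Finite := by
  have hM : MeromorphicOn f (closedBall 0 t) := fun z _ => h z
  refine ((MeromorphicOn.divisor f (closedBall 0 t)).finiteSupport (isCompact_closedBall 0 t)).subset ?_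
  rintro z ⟨h1, h2⟩
  rw [Function.mem_support, MeromorphicOn.divisor_apply hM h2]
  intro h3
  rcases WithTop.untop₀_eq_zero.1 h3 with h4 | h4
  · exact h1 h4
  · exact hne z h4

/-- real zeros and poles -/
def ZR (f : ℂ → ℂ) : Set ℝ := {x | meromorphicOrderAt f (x:ℂ) ≠ 0}

lemma zr_fin (h : ∀ z, MeromorphicAt f z) (hne : ∀ z, meromorphicOrderAt f z ≠ ⊤) (a c : ℝ) : (ZR f ∩ Set.Icc a c).Finite := by
  have := zp_fin h hne (max |a| |c|)
  refine Set.Finite.of_finite_image (f := fun x : ℝ => (x:ℂ)) (this.subset ?_) (Complex.ofReal_injective.injOn)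
  rintro _ ⟨x, ⟨h1, h2⟩, rfl⟩
  refine ⟨h1, ?_⟩
  simp only [mem_closedBall, dist_zero_right, Complex.norm_real, Real.norm_eq_abs]
  exact abs_le_max_abs_abs h2.1 h2.2

lemma KData.gap (k : KData f P b c0 n) {x₁ x₂ : ℝ} (hlt : x₁ < x₂) (h1 : x₁ ∈ ZR f) (h2 : x₂ ∈ ZR f)
    (hU : ∀ x ∈ Set.Icc x₁ x₂, KK b c0 n P x ≠ 1) 
    {y0 y1 : ℝ → ℝ} (hy0 : ∀ x ∈ Set.Icc x₁ x₂, HasDerivAt y0 (y1 x) x)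
    (hy : ∀ x ∈ Set.Icc x₁ x₂, y1 x + y0 x ^ 2 + (dd c0 n P x).re ^ 2 / (2 * (1 - (KK b c0 n P x).re)) < 0) : False := by
  have hfin : (ZR f ∩ Set.Ioc x₁ x₂).Finite := (zr_fin k.core.mero k.core.ne x₁ x₂).subset (Set.inter_subset_inter_right _ Set.Ioc_subset_Icc_self)
  obtain ⟨m, hm, hmin⟩ := Set.exists_min_image (ZR f ∩ Set.Ioc x₁ x₂) id hfin ⟨x₂, h2, hlt, le_rfl⟩
  have hs : ∀ x ∈ Set.Icc x₁ m, x ∈ Set.Icc x₁ x₂ := fun x hx => ⟨hx.1, hx.2.trans hm.2.2⟩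
  refine k.gap0 (x₁ := x₁) (x₂ := m) hm.2.1 h1 hm.1 (fun x hx => hU x (hs x hx)) ?_ (fun x hx => hy0 x (hs x hx)) (fun x hx => hy x (hs x hx))
  intro x hx
  by_contra hc
  have := hmin x ⟨hc, hx.1, hx.2.le.trans hm.2.2⟩
  simp only [id] at this
  linarith [hx.2]

end NV

open Complex Filter Topology MeasureTheory
open scoped Classical

namespace NV
open Metric Real Bornology

variable {f : ℂ → ℂ} {P : Finset ℂ} {b c0 : ℂ} {n : ℂ → ℤ}

lemma inv_sub_tendsto (s : ℂ) : Tendsto (fun x : ℝ => ((x:ℂ) - s)⁻¹) (cobounded ℝ) (𝓝 0) :=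
  tendsto_inv₀_cobounded.comp ((tendsto_sub_const_cobounded s).comp (RCLike.tendsto_ofReal_cobounded_cobounded ℂ))

noncomputable def dd1 (n : ℂ → ℤ) (P : Finset ℂ) : ℂ → ℂ := fun z => (∑ s ∈ P, -(n s * ((z - s)⁻¹) ^ 2)) / (2 * I)
noncomputable def dd2 (n : ℂ → ℤ) (P : Finset ℂ) : ℂ → ℂ := fun z => (∑ s ∈ P, 2 * n s * ((z - s)⁻¹) ^ 3) / (2 * I)

lemma has_inv {z s : ℂ} (h : z - s ≠ 0) : HasDerivAt (fun z : ℂ => (z - s)⁻¹) (-((z - s)⁻¹) ^ 2) z := by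
  refine (((hasDerivAt_id z).sub_const s).inv h).congr_deriv ?_
  simp; field_simp

lemma dd_has (c0 : ℂ) (n : ℂ → ℤ) {z : ℂ} (hz : z ∉ P) : HasDerivAt (dd c0 n P) (dd1 n P z) z := by
  have : dd c0 n P = fun z => (c0 + ∑ s ∈ P, n s * (z - s)⁻¹) / (2 * I) := by funext z; simp [dd, div_eq_mul_inv]
  rw [this]
  refine (((HasDerivAt.fun_sum (u := P) (A' := fun s => (n s:ℂ) * (-((z - s)⁻¹) ^ 2)) fun s hs => (has_inv (show z - s ≠ 0 from sub_ne_zero.2 fun h => hz (h ▸ hs))).const_mul (n s : ℂ)).const_add c0).div_const (2 * I)).congr_deriv ?_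
  simp [dd1]

lemma dd1_has (n : ℂ → ℤ) {z : ℂ} (hz : z ∉ P) : HasDerivAt (dd1 n P) (dd2 n P z) z := by
  have h1 : ∀ s ∈ P, HasDerivAt (fun z : ℂ => -((n s:ℂ) * ((z - s)⁻¹) ^ 2)) (2 * n s * ((z - s)⁻¹) ^ 3) z := by
    intro s hs
    have h0 : z - s ≠ 0 := sub_ne_zero.2 fun h => hz (h ▸ hs)
    refine ((((has_inv h0).pow 2).const_mul (n s : ℂ)).neg).congr_deriv ?_
    simp only [Nat.cast_ofNat]
    ring
  exact (HasDerivAt.fun_sum h1).div_const (2 * I)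

lemma re_tendsto {F : Filter ℝ} {g : ℝ → ℂ} {l : ℂ} (h : Tendsto g F (𝓝 l)) : Tendsto (fun x => (g x).re) F (𝓝 l.re) :=
  (Complex.continuous_re.tendsto l).comp h

lemma dd_lim : Tendsto (fun x : ℝ => dd c0 n P x) (cobounded ℝ) (𝓝 (c0 / (2 * I))) := by
  have : Tendsto (fun x : ℝ => (c0 + ∑ s ∈ P, n s * ((x:ℂ) - s)⁻¹) / (2 * I)) (cobounded ℝ) (𝓝 ((c0 + ∑ s ∈ P, (n s : ℂ) * 0) / (2 * I))) :=
    (tendsto_const_nhds.add (tendsto_finsetSum _ fun s _ => (inv_sub_tendsto s).const_mul _)).div_const _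
  simpa [dd, div_eq_mul_inv] using this

lemma dd1_lim : Tendsto (fun x : ℝ => dd1 n P x) (cobounded ℝ) (𝓝 0) := by
  have : Tendsto (fun x : ℝ => (∑ s ∈ P, -(n s * (((x:ℂ) - s)⁻¹) ^ 2)) / (2 * I)) (cobounded ℝ) (𝓝 ((∑ s ∈ P, -((n s : ℂ) * 0 ^ 2)) / (2 * I))) :=
    (tendsto_finsetSum _ fun s _ => (((inv_sub_tendsto s).pow 2).const_mul _).neg).div_const _
  simpa [dd1] using this

lemma dd2_lim : Tendsto (fun x : ℝ => dd2 n P x) (cobounded ℝ) (𝓝 0) := by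
  have : Tendsto (fun x : ℝ => (∑ s ∈ P, 2 * n s * (((x:ℂ) - s)⁻¹) ^ 3) / (2 * I)) (cobounded ℝ) (𝓝 ((∑ s ∈ P, (2 * n s : ℂ) * 0 ^ 3) / (2 * I))) :=
    (tendsto_finsetSum _ fun s _ => (((inv_sub_tendsto s).pow 3).const_mul _)).div_const _
  simpa [dd2] using this

lemma ev_cob {p : ℝ → Prop} (h : ∀ᶠ x in cobounded ℝ, p x) : ∃ X : ℝ, ∀ x, X ≤ |x| → p x := by
  obtain ⟨X, _, hX⟩ := (hasBasis_cobounded_norm (E := ℝ)).eventually_iff.1 h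
  exact ⟨X, fun x hx => hX hx⟩

def Sep (b c0 : ℂ) (n : ℂ → ℤ) (P : Finset ℂ) (X η : ℝ) : Prop :=
  (∀ a c : ℝ, a ≤ c → c - a < η → (∀ x ∈ Set.Icc a c, X ≤ |x|) → (∀ x ∈ Set.Icc a c, KK b c0 n P (x:ℂ) ≠ 1) →
    ∃ y0 y1 : ℝ → ℝ, (∀ x ∈ Set.Icc a c, HasDerivAt y0 (y1 x) x) ∧
      ∀ x ∈ Set.Icc a c, y1 x + y0 x ^ 2 + (dd c0 n P x).re ^ 2 / (2 * (1 - (KK b c0 n P x).re)) < 0) ∧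
  (∀ a c : ℝ, a < c → (∀ x ∈ Set.Icc a c, X ≤ |x|) → KK b c0 n P (a:ℂ) = 1 → KK b c0 n P (c:ℂ) = 1 → η ≤ c - a)

lemma KData.sep1 (k : KData f P b c0 n) (hc : c0 ≠ 0) : ∃ X η, 0 < η ∧ Sep b c0 n P X η := by
  set l : ℝ := (c0 / (2 * I)).re with hl
  have him : (c0 / (2 * I)).im = 0 := by
    have h1 : Tendsto (fun x : ℝ => (dd c0 n P x).im) (cobounded ℝ) (𝓝 (c0 / (2 * I)).im) :=
      (Complex.continuous_im.tendsto _).comp dd_lim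
    have h2 : (fun x : ℝ => (dd c0 n P x).im) = fun _ => 0 := by funext x; exact k.d_real x
    rw [h2] at h1
    exact (tendsto_nhds_unique h1 tendsto_const_nhds)
  have hl0 : l ≠ 0 := by
    intro h0
    have : c0 / (2 * I) = 0 := Complex.ext h0 him
    simp [hc] at this
  have t0 := re_tendsto (dd_lim (c0 := c0) (n := n) (P := P))
  have t1 := re_tendsto (dd1_lim (n := n) (P := P))
  have t2 := re_tendsto (dd2_lim (n := n) (P := P))
  rw [← hl] at t0
  simp only [Complex.zero_re] at t1 t2
  have hE : ∀ᶠ x in cobounded ℝ, -(dd c0 n P (x:ℝ)).re ^ 4 - 2 * (dd2 n P x).re * (dd c0 n P x).re + 3 * (dd1 n P x).re ^ 2 < 0 := by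
    have t3 := (((t0.pow 4).neg).sub ((t2.const_mul 2).mul t0)).add ((t1.pow 2).const_mul 3)
    refine t3.eventually_lt_const ?_
    have : 0 < l ^ 4 := by positivity
    simp; exact this
  have hN : ∀ᶠ x in cobounded ℝ, (dd c0 n P (x:ℝ)).re ≠ 0 := t0.eventually_ne hl0
  have hB : ∀ᶠ x in cobounded ℝ, |(dd c0 n P (x:ℝ)).re| < |l| + 1 := t0.abs.eventually_lt_const (by linarith)
  obtain ⟨X, hX⟩ := ev_cob (hE.and (hN.and hB))
  refine ⟨X, 1 / (2 * (|l| + 1)), by positivity, ?_, ?_⟩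
  · intro a c hac hη hreg hU
    set d := fun x : ℝ => (dd c0 n P x).re with hd
    set d1 := fun x : ℝ => (dd1 n P x).re with hd1
    set d2 := fun x : ℝ => (dd2 n P x).re with hd2
    refine ⟨fun x => 1 / 2 * (d x * kap b c0 n P x - d1 x / d x), fun x => 1 / 2 * ((d1 x * kap b c0 n P x + d x * (-2 * d x / (1 - (KK b c0 n P x).re))) - (d2 x * d x - d1 x * d1 x) / d x ^ 2), ?_, ?_⟩
    · intro x hx
      obtain ⟨e1, e2, e3⟩ := hX x (hreg x hx)
      have a0 : HasDerivAt d (d1 x) x := (dd_has c0 n (k.core.real_notMem x)).real_of_complex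
      have a1 : HasDerivAt d1 (d2 x) x := (dd1_has n (k.core.real_notMem x)).real_of_complex
      exact ((a0.mul (k.dkap (hU x hx))).sub (a1.div a0 e2)).const_mul _
    · intro x hx
      obtain ⟨e1, e2, e3⟩ := hX x (hreg x hx)
      have hp := k.re_ne (hU x hx)
      have hpq := k.pq x
      have h1 : d x ≠ 0 := e2
      have e1' : -(d x) ^ 4 - 2 * d2 x * d x + 3 * d1 x ^ 2 < 0 := e1
      change 1 / 2 * ((d1 x * kap b c0 n P x + d x * (-2 * d x / (1 - (KK b c0 n P x).re))) - (d2 x * d x - d1 x * d1 x) / d x ^ 2) + (1 / 2 * (d x * kap b c0 n P x - d1 x / d x)) ^ 2 + d x ^ 2 / (2 * (1 - (KK b c0 n P x).re)) < 0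
      have hk : kap b c0 n P x = (KK b c0 n P x).im / (1 - (KK b c0 n P x).re) := rfl
      rw [hk]
      set p := (KK b c0 n P x).re
      set q := (KK b c0 n P x).im
      have e : 1 / 2 * ((d1 x * (q / (1 - p)) + d x * (-2 * d x / (1 - p))) - (d2 x * d x - d1 x * d1 x) / d x ^ 2) + (1 / 2 * (d x * (q / (1 - p)) - d1 x / d x)) ^ 2 + d x ^ 2 / (2 * (1 - p))
        = (-(d x) ^ 4 - 2 * d2 x * d x + 3 * d1 x ^ 2) / (4 * d x ^ 2) := by
        field_simp
        linear_combination (4 * d x ^ 4) * hpq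
      rw [e]
      exact div_neg_of_neg_of_pos e1' (by positivity)
  · intro a c hac hreg ha hcc
    by_contra hlt
    push Not at hlt
    obtain ⟨ξ, hξ, hξ0⟩ := exists_hasDerivAt_eq_zero (f := fun t : ℝ => (KK b c0 n P t).im) (f' := fun x => 2 * (dd c0 n P x).re * (KK b c0 n P x).re) hac
      (fun x _ => (k.dq x).continuousAt.continuousWithinAt) (by simp [ha, hcc]) (fun x _ => k.dq x)
    have hr : (KK b c0 n P ξ).re = 0 := by
      obtain ⟨e1, e2, e3⟩ := hX ξ (hreg ξ ⟨hξ.1.le, hξ.2.le⟩)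
      rcases mul_eq_zero.1 hξ0 with h | h
      · rcases mul_eq_zero.1 h with h | h
        · norm_num at h
        · exact absurd h e2
      · exact h
    obtain ⟨ζ, hζ, hζe⟩ := exists_hasDerivAt_eq_slope (f := fun t : ℝ => (KK b c0 n P t).re) (f' := fun x => -2 * (dd c0 n P x).re * (KK b c0 n P x).im) hξ.1
      (fun x _ => (k.dp x).continuousAt.continuousWithinAt) (fun x _ => k.dp x)
    rw [hr, ha, eq_div_iff (by linarith [hξ.1])] at hζe
    simp only [Complex.one_re, zero_sub] at hζe
    obtain ⟨e1, e2, e3⟩ := hX ζ (hreg ζ ⟨hζ.1.le, by linarith [hζ.2, hξ.2]⟩)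
    have hq : |(KK b c0 n P ζ).im| ≤ 1 := by
      have := k.pq ζ
      rw [← sq_le_one_iff_abs_le_one]; nlinarith [sq_nonneg (KK b c0 n P ζ).re]
    have h5 : |-2 * (dd c0 n P ζ).re * (KK b c0 n P ζ).im * (ξ - a)| ≤ 2 * (|l| + 1) * 1 * (ξ - a) := by
      have hpos : 0 ≤ ξ - a := by linarith [hξ.1]
      rw [abs_mul, abs_mul, abs_mul, abs_of_nonneg hpos]
      refine mul_le_mul_of_nonneg_right (mul_le_mul ?_ hq (abs_nonneg _) (by positivity)) hpos
      rw [abs_neg, abs_two]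
      linarith
    rw [hζe] at h5
    norm_num at h5
    have h6 : ξ - a < 1 / (2 * (|l| + 1)) := by linarith [hξ.2]
    rw [lt_div_iff₀ (by positivity)] at h6
    linarith

lemma KK_mero (b c0 : ℂ) (n : ℂ → ℤ) (P : Finset ℂ) (z : ℂ) : MeromorphicAt (KK b c0 n P) z := by
  have h1 : ∀ s ∈ P, MeromorphicAt (fun z : ℂ => (z - s) ^ n s) z := by
    intro s hs
    exact ((analyticAt_id.sub analyticAt_const).meromorphicAt).fun_zpow _
  have h2 : MeromorphicAt (fun z : ℂ => ∏ s ∈ P, (z - s) ^ n s) z := MeromorphicAt.fun_prod h1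
  have h3 : AnalyticAt ℂ (fun z : ℂ => b * Complex.exp (c0 * z)) z := by fun_prop
  exact h3.meromorphicAt.mul h2

lemma KK_inv_mero (b : ℂ) (n : ℂ → ℤ) (P : Finset ℂ) (z : ℂ) : MeromorphicAt (fun w => KK b 0 n P w⁻¹) z := by
  have h1 : ∀ s ∈ P, MeromorphicAt (fun z : ℂ => (z⁻¹ - s) ^ n s) z := by
    intro s hs
    exact ((analyticAt_id.meromorphicAt.inv).sub (analyticAt_const.meromorphicAt)).fun_zpow _
  have h2 : MeromorphicAt (fun z : ℂ => ∏ s ∈ P, (z⁻¹ - s) ^ n s) z := MeromorphicAt.fun_prod h1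
  have h3 : AnalyticAt ℂ (fun z : ℂ => b) z := by fun_prop
  have e : (fun w => KK b 0 n P w⁻¹) = fun w => b * ∏ s ∈ P, (w⁻¹ - s) ^ n s := by funext w; simp [KK]
  rw [e]
  exact h3.meromorphicAt.mul h2

lemma KK_dich (b c0 : ℂ) (n : ℂ → ℤ) (P : Finset ℂ) (hne : ¬ ∀ z, ∀ᶠ w in 𝓝[≠] z, KK b c0 n P w = 1) (z : ℂ) :
    ¬ ∀ᶠ w in 𝓝[≠] z, KK b c0 n P w = 1 := by
  intro hz
  have hm : MeromorphicOn (fun w => KK b c0 n P w - 1) Set.univ := fun z _ => (KK_mero b c0 n P z).sub (analyticAt_const.meromorphicAt)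
  push Not at hne
  obtain ⟨z1, hz1⟩ := hne
  have h1 : meromorphicOrderAt (fun w => KK b c0 n P w - 1) z1 ≠ ⊤ := by
    intro h
    rw [meromorphicOrderAt_eq_top_iff] at h
    obtain ⟨w, hw⟩ := (hz1.and_eventually h).exists
    exact hw.1 (sub_eq_zero.1 hw.2)
  have h2 := hm.meromorphicOrderAt_ne_top_of_isPreconnected (x := z1) (y := z) isPreconnected_univ trivial trivial h1
  apply h2
  rw [meromorphicOrderAt_eq_top_iff]
  exact hz.mono fun w hw => sub_eq_zero.2 hw

lemma KData.sep0 (k : KData f P b 0 n) (hne : ¬ ∀ z, ∀ᶠ w in 𝓝[≠] z, KK b 0 n P w = 1) : ∃ X η, 0 < η ∧ Sep b 0 n P X η := by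
  set g : ℂ → ℂ := fun w => KK b 0 n P w⁻¹ - 1 with hg
  have hgm : MeromorphicAt g 0 := (KK_inv_mero b n P 0).sub (analyticAt_const.meromorphicAt)
  have hcobC : Tendsto (fun x : ℝ => (x:ℂ)⁻¹) (cobounded ℝ) (𝓝[≠] 0) := tendsto_inv₀_cobounded'.comp (RCLike.tendsto_ofReal_cobounded_cobounded ℂ)
  have hgt : meromorphicOrderAt g 0 ≠ ⊤ := by
    intro h
    rw [meromorphicOrderAt_eq_top_iff] at h
    have h1 := tendsto_inv₀_cobounded'.eventually h
    obtain ⟨X, _, hX⟩ := (hasBasis_cobounded_norm (E := ℂ)).eventually_iff.1 h1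
    refine KK_dich b 0 n P hne ((|X| + 1 : ℝ) : ℂ) ?_
    have ho : IsOpen {z : ℂ | X < ‖z‖} := isOpen_lt continuous_const continuous_norm
    have : ((|X| + 1 : ℝ) : ℂ) ∈ {z : ℂ | X < ‖z‖} := by
      simp only [Set.mem_setOf_eq, Complex.norm_real, Real.norm_eq_abs]
      rw [abs_of_pos (by positivity)]
      linarith [le_abs_self X]
    filter_upwards [nhdsWithin_le_nhds (ho.mem_nhds this)] with w hw
    have h3 := hX (show w ∈ {z : ℂ | X ≤ ‖z‖} from (show X < ‖w‖ from hw).le)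
    simp only [hg, inv_inv] at h3
    exact sub_eq_zero.1 h3
  obtain ⟨p, hp⟩ := WithTop.ne_top_iff_exists.1 hgt
  obtain ⟨h, hh, he⟩ := logderiv_form hgm hp.symm
  have hg0 := (meromorphicOrderAt_ne_top_iff_eventually_ne_zero hgm).1 hgt
  -- w^2 * g'/g -> 0
  have hlim : Tendsto (fun w : ℂ => w ^ 2 * (deriv g w / g w)) (𝓝[≠] 0) (𝓝 0) := by
    have hc : ContinuousAt (fun w : ℂ => w * p + w ^ 2 * h w) 0 := by
      have := hh.continuousAt
      fun_prop
    have h1 := hc.tendsto.mono_left (nhdsWithin_le_nhds (s := {(0:ℂ)}ᶜ))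
    simp only [zero_mul, ne_eq, OfNat.ofNat_ne_zero, not_false_eq_true, zero_pow, add_zero] at h1
    refine h1.congr' ?_
    filter_upwards [he, self_mem_nhdsWithin] with w hw hw0
    have hw0 : w ≠ 0 := by simpa using hw0
    rw [hw, sub_zero]; field_simp
  have hl2 := (hlim.comp hcobC).norm
  simp only [norm_zero] at hl2
  have hsm := hl2.eventually_lt_const (show (0:ℝ) < 2 by norm_num)
  have hne1 := hcobC.eventually hg0
  have hx0 : ∀ᶠ x : ℝ in cobounded ℝ, 1 ≤ ‖x‖ := eventually_cobounded_le_norm 1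
  obtain ⟨X, hX⟩ := ev_cob (hsm.and (hne1.and hx0))
  have hW : ∀ x : ℝ, X ≤ |x| → KK b 0 n P x ≠ 1 ∧ (dd 0 n P x).re ^ 2 / (2 * (1 - (KK b 0 n P x).re)) < 1 := by
    intro x hx
    obtain ⟨e1, e2, e3⟩ := hX x hx
    have hxne : (x:ℂ) ≠ 0 := by
      intro h0
      have : x = 0 := by exact_mod_cast h0
      rw [this] at e3; norm_num at e3
    have hK1 : KK b 0 n P x - 1 ≠ 0 := by simpa [hg] using e2
    have hK1' : KK b 0 n P x ≠ 1 := sub_ne_zero.1 hK1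
    refine ⟨hK1', ?_⟩
    have hder : HasDerivAt g (2 * I * dd 0 n P x * KK b 0 n P x * (-((x:ℂ)⁻¹ ^ 2)⁻¹)) (x:ℂ)⁻¹ := by
      have h1 : HasDerivAt (KK b 0 n P) (2 * I * dd 0 n P x * KK b 0 n P x) ((x:ℂ)⁻¹)⁻¹ := by
        rw [inv_inv]; exact KK_deriv k.hb 0 n (k.core.real_notMem x)
      exact (h1.comp (x:ℂ)⁻¹ (hasDerivAt_inv (inv_ne_zero hxne))).sub_const 1
    simp only [Function.comp] at e1
    rw [hder.deriv] at e1
    have e4 : (x:ℂ)⁻¹ ^ 2 * (2 * I * dd 0 n P x * KK b 0 n P x * (-((x:ℂ)⁻¹ ^ 2)⁻¹) / g (x:ℂ)⁻¹) = -(2 * I * dd 0 n P x * KK b 0 n P x) / (KK b 0 n P x - 1) := by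
      simp only [hg, inv_inv]
      field_simp
    rw [e4, norm_div, norm_neg, norm_mul, norm_mul, norm_mul, div_lt_iff₀ (norm_pos_iff.2 hK1)] at e1
    have hpq := k.pq x
    have hKn : ‖KK b 0 n P x‖ = 1 := by
      have h1 : ‖KK b 0 n P x‖ ^ 2 = 1 := by rw [Complex.sq_norm, Complex.normSq_apply]; linarith
      nlinarith [norm_nonneg (KK b 0 n P x)]
    have hdn : ‖dd 0 n P x‖ ^ 2 = (dd 0 n P x).re ^ 2 := by
      rw [Complex.sq_norm, Complex.normSq_apply, k.d_real x]; ring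
    have hKm : ‖KK b 0 n P x - 1‖ ^ 2 = 2 * (1 - (KK b 0 n P x).re) := by
      rw [Complex.sq_norm, Complex.normSq_apply]; simp; linarith
    rw [hKn] at e1
    simp only [Complex.norm_I, Complex.norm_ofNat, mul_one] at e1
    rw [div_lt_one (by linarith [k.re_ne hK1']), ← hdn, ← hKm]
    have : ‖dd 0 n P x‖ < ‖KK b 0 n P x - 1‖ := by linarith
    exact pow_lt_pow_left₀ this (norm_nonneg _) (by norm_num)
  refine ⟨X, 1, one_pos, ?_, ?_⟩
  · intro a c hac hη hreg hU
    refine ⟨fun x => -Real.tan (x - a), fun x => -(1 / Real.cos (x - a) ^ 2), ?_, ?_⟩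
    · intro x hx
      have hcos : Real.cos (x - a) ≠ 0 := (Real.cos_pos_of_mem_Ioo ⟨by linarith [hx.1, Real.pi_pos], by linarith [hx.2, Real.pi_gt_three]⟩).ne'
      have h1 := (Real.hasDerivAt_tan hcos).comp x ((hasDerivAt_id x).sub_const a)
      refine h1.neg.congr_deriv ?_
      simp
    · intro x hx
      have hcos : Real.cos (x - a) ≠ 0 := (Real.cos_pos_of_mem_Ioo ⟨by linarith [hx.1, Real.pi_pos], by linarith [hx.2, Real.pi_gt_three]⟩).ne'
      have h1 := (hW x (hreg x hx)).2
      have h2 : -(1 / Real.cos (x - a) ^ 2) + (-Real.tan (x - a)) ^ 2 = -1 := by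
        rw [Real.tan_eq_sin_div_cos]
        field_simp
        linarith [Real.sin_sq_add_cos_sq (x - a)]
      change -(1 / Real.cos (x - a) ^ 2) + (-Real.tan (x - a)) ^ 2 + _ < 0
      rw [h2]; linarith
  · intro a c hac hreg ha _
    exact absurd ha (hW a (hreg a ⟨le_rfl, hac.le⟩)).1

end NV

open Complex Filter Topology MeasureTheory
open scoped Classical

namespace NV
open Metric Real Bornology

variable {f : ℂ → ℂ} {P : Finset ℂ} {b c0 : ℂ} {n : ℂ → ℤ}

lemma KData.three (k : KData f P b c0 n) {X η : ℝ} (hS : Sep b c0 n P X η) {a c : ℝ} (hη : c - a < η)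
    (hreg : ∀ x ∈ Set.Icc a c, X ≤ |x|) : (ZR f ∩ Set.Icc a c).ncard ≤ 3 := by
  by_contra hcon
  push Not at hcon
  have hfin := zr_fin k.core.mero k.core.ne a c
  have hcard : 4 ≤ hfin.toFinset.card := by rw [← Set.ncard_eq_toFinset_card _ hfin]; omega
  obtain ⟨T, hT, hT4⟩ := Finset.exists_subset_card_eq hcard
  set e := T.orderEmbOfFin hT4 with he
  have hm : ∀ i, e i ∈ ZR f ∩ Set.Icc a c := fun i => by
    have := hT (T.orderEmbOfFin_mem hT4 i)
    simpa using this
  have key : ∀ i j, e i < e j → ∃ u ∈ Set.Icc (e i) (e j), KK b c0 n P (u:ℂ) = 1 := by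
    intro i j hij
    by_contra hU
    push Not at hU
    have hsub : ∀ x ∈ Set.Icc (e i) (e j), x ∈ Set.Icc a c := fun x hx => ⟨(hm i).2.1.trans hx.1, hx.2.trans (hm j).2.2⟩
    obtain ⟨y0, y1, h1, h2⟩ := hS.1 (e i) (e j) hij.le (by linarith [(hm i).2.1, (hm j).2.2]) (fun x hx => hreg x (hsub x hx)) hU
    exact k.gap hij (hm i).1 (hm j).1 hU h1 h2
  have l01 : e 0 < e 1 := e.strictMono (by decide)
  have l12 : e 1 < e 2 := e.strictMono (by decide)
  have l23 : e 2 < e 3 := e.strictMono (by decide)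
  obtain ⟨u, hu, hu1⟩ := key 0 1 l01
  obtain ⟨v, hv, hv1⟩ := key 2 3 l23
  have m0 := (hm 0).2.1
  have m3 := (hm 3).2.2
  have := hS.2 u v (by linarith [hu.2, hv.1]) (fun x hx => hreg x ⟨by linarith [hu.1, hx.1], by linarith [hv.2, hx.2]⟩) hu1 hv1
  linarith [hu.1, hv.2]

lemma count_lin {S : Set ℝ} {X δ : ℝ} (hδ : 0 < δ) (hfin : ∀ a c, (S ∩ Set.Icc a c).Finite)
    (h : ∀ a, X ≤ a → (S ∩ Set.Icc a (a + δ)).ncard ≤ 3) (N : ℕ) : (S ∩ Set.Icc X (X + N * δ)).ncard ≤ 3 * (N + 1) := by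
  induction N with
  | zero =>
    refine (Set.ncard_le_ncard ?_ (hfin X (X + δ))).trans (h X le_rfl)
    refine Set.inter_subset_inter_right _ (Set.Icc_subset_Icc_right ?_)
    push_cast; linarith
  | succ N ih =>
    have hN : 0 ≤ (N:ℝ) * δ := by positivity
    have hsub : S ∩ Set.Icc X (X + ((N+1 : ℕ):ℝ) * δ) ⊆ (S ∩ Set.Icc X (X + N * δ)) ∪ (S ∩ Set.Icc (X + N * δ) (X + N * δ + δ)) := by
      rintro x ⟨h1, h2, h3⟩
      push_cast at h3
      rcases le_total x (X + N * δ) with h4 | h4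
      · exact Or.inl ⟨h1, h2, h4⟩
      · exact Or.inr ⟨h1, h4, by linarith⟩
    refine (Set.ncard_le_ncard hsub ((hfin _ _).union (hfin _ _))).trans ((Set.ncard_union_le _ _).trans ?_)
    have := h (X + N * δ) (by linarith)
    omega

def LinCount (f : ℂ → ℂ) : Prop := ∃ C : ℝ, 0 ≤ C ∧ ∀ t, 1 ≤ t → ((ZP f ∩ closedBall 0 t).ncard : ℝ) ≤ C * t

lemma Core.zp_nonreal (h : Core f P) {z : ℂ} (hz : z ∈ ZP f) (him : z.im ≠ 0) : z ∈ P := by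
  by_contra hP
  obtain ⟨h1, h2, _⟩ := h.good z him hP
  exact hz (order_zero_of_an h1 h2)

lemma KData.lin (k : KData f P b c0 n) {X η : ℝ} (hη : 0 < η) (hS : Sep b c0 n P X η) : LinCount f := by
  have hfin := zr_fin k.core.mero k.core.ne
  set δ := η / 2 with hδ
  have hδ0 : 0 < δ := by positivity
  set X0 := max X 1 with hX0
  have hX1 : X ≤ X0 := le_max_left _ _
  have hX2 : 1 ≤ X0 := le_max_right _ _
  have c1 : ∀ N : ℕ, (ZR f ∩ Set.Icc X0 (X0 + N * δ)).ncard ≤ 3 * (N + 1) := by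
    refine count_lin hδ0 hfin fun a ha => k.three hS (by linarith) fun x hx => ?_
    rw [abs_of_nonneg (by linarith [hx.1])]; linarith [hx.1]
  have hneg : ∀ a c, (-ZR f) ∩ Set.Icc a c = -(ZR f ∩ Set.Icc (-c) (-a)) := by
    intro a c; ext x; simp [and_comm, neg_le]
  have hncard : ∀ S : Set ℝ, (-S).ncard = S.ncard := by
    intro S; rw [← Set.image_neg_eq_neg]; exact Set.ncard_image_of_injective _ neg_injective
  have c2 : ∀ N : ℕ, ((-ZR f) ∩ Set.Icc X0 (X0 + N * δ)).ncard ≤ 3 * (N + 1) := by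
    refine count_lin hδ0 (fun a c => ?_) fun a ha => ?_
    · rw [hneg]; exact (hfin _ _).neg
    · rw [hneg, hncard]
      refine k.three hS (by linarith) fun x hx => ?_
      rw [abs_of_nonpos (by linarith [hx.2])]; linarith [hx.2]
  set c := (ZR f ∩ Set.Icc (-X0) X0).ncard
  refine ⟨P.card + c + 6 * (2 + 1 / δ), by positivity, fun t ht => ?_⟩
  set N := ⌈t / δ⌉₊ with hN
  have hN1 : t / δ ≤ N := Nat.le_ceil _
  have hN2 : (N:ℝ) < t / δ + 1 := Nat.ceil_lt_add_one (by positivity)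
  have hNt : t ≤ N * δ := by rwa [div_le_iff₀ hδ0] at hN1
  have hsub : ZP f ∩ closedBall 0 t ⊆ ((P : Set ℂ) ∪ (fun x : ℝ => (x:ℂ)) '' (ZR f ∩ Set.Icc (-X0) X0)) ∪
      ((fun x : ℝ => (x:ℂ)) '' (ZR f ∩ Set.Icc X0 (X0 + N * δ)) ∪ (fun x : ℝ => ((-x : ℝ):ℂ)) '' ((-ZR f) ∩ Set.Icc X0 (X0 + N * δ))) := by
    rintro z ⟨h1, h2⟩
    by_cases him : z.im = 0
    · have hz : z = (z.re : ℂ) := Complex.ext (by simp) (by simp [him])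
      have h3 : z.re ∈ ZR f := by change meromorphicOrderAt f _ ≠ 0; rw [← hz]; exact h1
      have h4 : |z.re| ≤ t := (Complex.abs_re_le_norm z).trans (by simpa using h2)
      rw [abs_le] at h4
      by_cases h5 : z.re ≤ X0
      · by_cases h6 : -X0 ≤ z.re
        · exact Or.inl (Or.inr ⟨z.re, ⟨h3, h6, h5⟩, hz.symm⟩)
        · exact Or.inr (Or.inr ⟨-z.re, ⟨by simpa using h3, by linarith, by linarith⟩, by simpa using hz.symm⟩)
      · exact Or.inr (Or.inl ⟨z.re, ⟨h3, by linarith, by linarith⟩, hz.symm⟩)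
    · exact Or.inl (Or.inl (by simpa using k.core.zp_nonreal h1 him))
  have f1 : ((-ZR f) ∩ Set.Icc X0 (X0 + N * δ)).Finite := by rw [hneg]; exact (hfin _ _).neg
  have i1 : ∀ S : Set ℝ, ((fun x : ℝ => (x:ℂ)) '' S).ncard = S.ncard := fun S => Set.ncard_image_of_injective _ Complex.ofReal_injective
  have i2 : ∀ S : Set ℝ, ((fun x : ℝ => ((-x:ℝ):ℂ)) '' S).ncard = S.ncard := fun S =>
    Set.ncard_image_of_injective _ (Complex.ofReal_injective.comp neg_injective)
  have hle := Set.ncard_le_ncard hsub ((P.finite_toSet.union ((hfin _ _).image _)).union (((hfin _ _).image _).union (f1.image _)))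
  have u1 := Set.ncard_union_le ((P : Set ℂ) ∪ (fun x : ℝ => (x:ℂ)) '' (ZR f ∩ Set.Icc (-X0) X0))
      ((fun x : ℝ => (x:ℂ)) '' (ZR f ∩ Set.Icc X0 (X0 + N * δ)) ∪ (fun x : ℝ => ((-x : ℝ):ℂ)) '' ((-ZR f) ∩ Set.Icc X0 (X0 + N * δ)))
  have u2 := Set.ncard_union_le (P : Set ℂ) ((fun x : ℝ => (x:ℂ)) '' (ZR f ∩ Set.Icc (-X0) X0))
  have u3 := Set.ncard_union_le ((fun x : ℝ => (x:ℂ)) '' (ZR f ∩ Set.Icc X0 (X0 + N * δ))) ((fun x : ℝ => ((-x : ℝ):ℂ)) '' ((-ZR f) ∩ Set.Icc X0 (X0 + N * δ)))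
  rw [i1, i2] at u3
  rw [i1, Set.ncard_coe_finset] at u2
  have n1 := c1 N
  have n2 := c2 N
  have tot : (ZP f ∩ closedBall 0 t).ncard ≤ P.card + c + 6 * (N + 1) := by omega
  have tot' : ((ZP f ∩ closedBall 0 t).ncard : ℝ) ≤ P.card + c + 6 * (N + 1) := by exact_mod_cast tot
  refine tot'.trans ?_
  have q1 : (P.card : ℝ) + c ≤ (P.card + c) * t := by
    have : (0:ℝ) ≤ (P.card : ℝ) + c := by positivity
    nlinarith
  have q2 : (6:ℝ) * (N + 1) ≤ 6 * (2 + 1 / δ) * t := by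
    have : 6 * (2 + 1 / δ) * t = 6 * (2 * t + t / δ) := by field_simp
    rw [this]; linarith
  linarith

/-- Step 4. -/
lemma KData.lin_of_ne (k : KData f P b c0 n) (hne : ¬ ∀ z, ∀ᶠ w in 𝓝[≠] z, KK b c0 n P w = 1) : LinCount f := by
  by_cases hc : c0 = 0
  · subst hc
    obtain ⟨X, η, h1, h2⟩ := k.sep0 hne
    exact k.lin h1 h2
  · obtain ⟨X, η, h1, h2⟩ := k.sep1 hc
    exact k.lin h1 h2

end NV

open Complex Filter Topology MeasureTheory
open scoped Classical

namespace NV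
open Metric Real Bornology

/-- polynomially bounded in a half plane -/
def PB (Y : ℝ) (G : ℂ → ℂ) : Prop := ∃ (C : ℝ) (k : ℕ), 0 ≤ C ∧ ∀ z : ℂ, Y ≤ z.im → ‖G z‖ ≤ C * (1 + ‖z‖) ^ k

lemma PB.mono {Y Y' : ℝ} {G : ℂ → ℂ} (h : PB Y G) (hY : Y ≤ Y') : PB Y' G := by
  obtain ⟨C, k, h1, h2⟩ := h
  exact ⟨C, k, h1, fun z hz => h2 z (hY.trans hz)⟩

lemma PB.congr {Y : ℝ} {G H : ℂ → ℂ} (h : PB Y G) (he : ∀ z : ℂ, Y ≤ z.im → H z = G z) : PB Y H := by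
  obtain ⟨C, k, h1, h2⟩ := h
  exact ⟨C, k, h1, fun z hz => by rw [he z hz]; exact h2 z hz⟩

lemma PB.mul {Y : ℝ} {G H : ℂ → ℂ} (hG : PB Y G) (hH : PB Y H) : PB Y fun z => G z * H z := by
  obtain ⟨C, k, h1, h2⟩ := hG
  obtain ⟨D, l, h3, h4⟩ := hH
  refine ⟨C * D, k + l, by positivity, fun z hz => ?_⟩
  rw [norm_mul, pow_add]
  calc ‖G z‖ * ‖H z‖ ≤ (C * (1 + ‖z‖) ^ k) * (D * (1 + ‖z‖) ^ l) :=
        mul_le_mul (h2 z hz) (h4 z hz) (norm_nonneg _) (by positivity)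
    _ = _ := by ring

lemma PB.const (Y : ℝ) (c : ℂ) : PB Y fun _ => c := ⟨‖c‖, 0, norm_nonneg _, fun z _ => by simp⟩

lemma PB.add {Y : ℝ} {G H : ℂ → ℂ} (hG : PB Y G) (hH : PB Y H) : PB Y fun z => G z + H z := by
  obtain ⟨C, k, h1, h2⟩ := hG
  obtain ⟨D, l, h3, h4⟩ := hH
  refine ⟨C + D, k + l, by positivity, fun z hz => (norm_add_le _ _).trans ?_⟩
  have hz1 : 1 ≤ 1 + ‖z‖ := by linarith [norm_nonneg z]
  have a1 : (1 + ‖z‖) ^ k ≤ (1 + ‖z‖) ^ (k + l) := pow_le_pow_right₀ hz1 (by omega)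
  have a2 : (1 + ‖z‖) ^ l ≤ (1 + ‖z‖) ^ (k + l) := pow_le_pow_right₀ hz1 (by omega)
  have := mul_le_mul_of_nonneg_left a1 h1
  have := mul_le_mul_of_nonneg_left a2 h3
  have := h2 z hz
  have := h4 z hz
  rw [add_mul]; linarith

lemma PB.deriv {Y : ℝ} {G : ℂ → ℂ} (h : PB Y G) (hG : ∀ z : ℂ, Y ≤ z.im → AnalyticAt ℂ G z) : PB (Y + 1) (deriv G) := by
  obtain ⟨C, k, h1, h2⟩ := h
  refine ⟨C * 2 ^ k, k, by positivity, fun z hz => ?_⟩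
  have him : ∀ w ∈ closedBall z 1, Y ≤ w.im := by
    intro w hw
    have h3 : |(w - z).im| ≤ 1 := (Complex.abs_im_le_norm _).trans (by simpa [dist_eq_norm] using hw)
    rw [Complex.sub_im, abs_le] at h3
    linarith [h3.1]
  have hd : DiffContOnCl ℂ G (ball z 1) := by
    refine DifferentiableOn.diffContOnCl fun w hw => ?_
    rw [closure_ball z one_ne_zero] at hw
    exact (hG w (him w hw)).differentiableAt.differentiableWithinAt
  have := Complex.norm_deriv_le_of_forall_mem_sphere_norm_le (C := C * (2 ^ k * (1 + ‖z‖) ^ k)) one_pos hd (fun w hw => by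
    refine (h2 w (him w (sphere_subset_closedBall hw))).trans (mul_le_mul_of_nonneg_left ?_ h1)
    rw [← mul_pow]
    refine pow_le_pow_left₀ (by positivity) ?_ k
    have : ‖w - z‖ = 1 := by simpa [dist_eq_norm] using hw
    have h5 : ‖w‖ ≤ ‖w - z‖ + ‖z‖ := by simpa using norm_add_le (w - z) z
    linarith [norm_nonneg z])
  rw [div_one] at this
  rwa [mul_assoc]

lemma pb_logderiv {Y : ℝ} {G : ℂ → ℂ} (hG : ∀ z : ℂ, Y < z.im → AnalyticAt ℂ G z ∧ G z ≠ 0)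
    (hg : GR (mm fun w => G (zz Y w))) : PB (Y + 1) fun z => deriv G z / G z := by
  set g : ℂ → ℂ := fun w => G (zz Y w) with hgd
  have gan : ∀ w ∈ ball (0:ℂ) 1, AnalyticAt ℂ g w := fun w hw =>
    (hG _ (im_zz_gt Y hw)).1.comp' (analyticAt_zz Y hw)
  have g0 : ∀ w ∈ ball (0:ℂ) 1, g w ≠ 0 := fun w hw => (hG _ (im_zz_gt Y hw)).2
  have hfp : FP g := FP.of_analytic gan
  have hnz : NZ g := nz_of_fin (fun w hw => (gan w hw).meromorphicAt) ∅ fun w hw _ => g0 w hw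
  obtain ⟨J, hJ0, hJ⟩ := hfp.jensen0 hnz
  obtain ⟨C, hC, hgr⟩ := hg
  set K := 6 * C + J + 1 with hK
  have hK0 : 0 < K := by positivity
  refine ⟨4096 * K * (1 + |Y|) ^ 8, 8, by positivity, fun z hz => ?_⟩
  have hzY : Y < z.im := by linarith
  set w := ww Y z with hw
  have hwb : w ∈ ball (0:ℂ) 1 := ww_mem hzY
  have hw1 : ‖w‖ < 1 := by simpa using hwb
  have hzw : zz Y w = z := zz_ww Y hzY
  set d := 1 - ‖w‖ with hd
  have hd0 : 0 < d := by linarith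
  have hd1 : d ≤ 1 := by linarith [norm_nonneg w]
  set R := 1 - d / 2 with hR
  have hsub : closedBall (0:ℂ) R ⊆ ball 0 1 := closedBall_subset_ball (by linarith)
  have e1 : ‖deriv g w / g w‖ ≤ 256 * R ^ 2 * (K / d) / (R - ‖w‖) ^ 3 := by
    have := zf_deriv_bound (g := g) (R := R) (r := ‖w‖) (M := K / d - 1) (fun u hu => gan u (hsub hu)) (fun u hu => g0 u (hsub hu))
      (norm_nonneg _) (by linarith) (by
        rw [(hfp.mean_abs (r := R) (by linarith) (by linarith)).2]
        have b1 := hJ R (by linarith) (by linarith)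
        have b2 := hgr R (by linarith) (by linarith)
        have b3 : Real.log (1 / (1 - R)) ≤ 2 / d := by
          have : 1 / (1 - R) = 2 / d := by
            have h9 : 1 - R = d / 2 := by rw [hR]; ring
            rw [h9, one_div_div]
          rw [this]
          have := Real.log_le_sub_one_of_pos (x := 2 / d) (by positivity)
          linarith
        have b4 : 1 ≤ 1 / d := by rw [le_div_iff₀ hd0]; linarith
        have b5 : C * (1 + Real.log (1 / (1 - R))) ≤ C * (3 * (1 / d)) := by
          refine mul_le_mul_of_nonneg_left ?_ hC
          have : 2 / d = 2 * (1 / d) := by ring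
          linarith
        have b6 : K / d = 6 * C * (1 / d) + (J + 1) * (1 / d) := by rw [hK]; ring
        have b7 : J + 1 ≤ (J + 1) * (1 / d) := le_mul_of_one_le_right (by linarith) b4
        rw [b6]
        linarith) (w := w) le_rfl
    simpa using this
  have e2 : 256 * R ^ 2 * (K / d) / (R - ‖w‖) ^ 3 ≤ 2048 * K * (1 / d) ^ 4 := by
    have : R - ‖w‖ = d / 2 := by rw [hR, hd]; ring
    rw [this]
    have hR1 : R ^ 2 ≤ 1 := by
      have : 0 ≤ R := by linarith
      nlinarith
    have : 256 * R ^ 2 * (K / d) / (d / 2) ^ 3 = R ^ 2 * (2048 * K * (1 / d) ^ 4) := by field_simp; ring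
    rw [this]
    exact mul_le_of_le_one_left (by positivity) hR1
  have e3 : deriv G z / G z = qq w * (deriv g w / g w) := by
    have h1 : AnalyticAt ℂ G (zz Y w) := by rw [hzw]; exact (hG z hzY).1
    have := deriv_zz hwb h1
    rw [← mul_div_assoc, this, hgd]
    simp only [hzw]
  set T := ‖z - I * Y + I‖ with hT
  have hT0 : 0 < T := by
    rw [hT, norm_pos_iff]
    intro h; have := congrArg Complex.im h; simp at this; linarith
  have hT1 : T ≤ (1 + |Y|) * (1 + ‖z‖) := by
    have h1 : T ≤ ‖z‖ + |Y| + 1 := by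
      refine (norm_add_le _ _).trans ?_
      have h2 := norm_sub_le z (I * Y)
      simp only [norm_mul, Complex.norm_I, one_mul, Complex.norm_real, Real.norm_eq_abs] at h2 ⊢
      linarith
    nlinarith [abs_nonneg Y, norm_nonneg z, mul_nonneg (abs_nonneg Y) (norm_nonneg z)]
  have e4 : 1 / d ≤ T ^ 2 := by
    have h1 := norm_ww hzY
    rw [← hw, ← hT] at h1
    have h2 : 4 / T ^ 2 ≤ 1 - ‖w‖ ^ 2 := by
      rw [h1]; gcongr; linarith
    have h3 : 1 - ‖w‖ ^ 2 ≤ 2 * d := by rw [hd]; nlinarith [sq_nonneg (1 - ‖w‖)]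
    rw [div_le_iff₀ hd0]
    rw [div_le_iff₀ (by positivity)] at h2
    nlinarith [sq_nonneg T]
  change ‖deriv G z / G z‖ ≤ _
  rw [e3, norm_mul]
  calc ‖qq w‖ * ‖deriv g w / g w‖ ≤ 2 * (2048 * K * (1 / d) ^ 4) :=
        mul_le_mul (qq_le hwb) (e1.trans e2) (norm_nonneg _) (by norm_num)
    _ = 4096 * K * (1 / d) ^ 4 := by ring
    _ ≤ 4096 * K * (T ^ 2) ^ 4 := by gcongr
    _ = 4096 * K * T ^ 8 := by ring
    _ ≤ 4096 * K * ((1 + |Y|) * (1 + ‖z‖)) ^ 8 := by gcongr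
    _ = _ := by ring

lemma mm_pb {Y : ℝ} {U : ℂ → ℂ} (hU : PB Y U) (hm : ∀ z : ℂ, Y < z.im → MeromorphicAt U z) :
    ∃ B : ℝ, 0 ≤ B ∧ ∀ r : ℝ, 1/2 ≤ r → r < 1 → mm (fun w => U (zz Y w)) r ≤ B := by
  obtain ⟨C, k, hC, hb⟩ := hU
  set D := C + 1 with hD
  set E := 2 * (2 + |Y|) with hE
  have hE0 : 1 ≤ E := by rw [hE]; linarith [abs_nonneg Y]
  refine ⟨Real.log D + k * Real.log E, add_nonneg (Real.log_nonneg (by linarith)) (mul_nonneg (by positivity) (Real.log_nonneg hE0)), fun r h1 h2 => ?_⟩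
  have hr0 : 0 < r := by linarith
  have hcl : closedBall (0:ℂ) |r| ⊆ ball 0 1 := closedBall_subset_ball (by rwa [abs_of_pos hr0])
  have hav : circleAverage (fun w => Real.log ‖1 - w‖) 0 r = 0 := by
    have := AnalyticOnNhd.circleAverage_log_norm_of_ne_zero (R := r) (c := 0) (g := fun w => 1 - w)
      (fun w _ => by fun_prop) (fun w hw => one_sub_ne (hcl hw))
    simpa using this
  have hci : CircleIntegrable (fun w : ℂ => Real.log ‖1 - w‖) 0 r :=
    MeromorphicOn.circleIntegrable_log_norm (f := fun w => 1 - w) fun z hz => (by fun_prop : AnalyticAt ℂ (fun w : ℂ => 1 - w) z).meromorphicAt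
  have hci2 := ci_const_add (Real.log D + k * Real.log E) (ci_const_mul (-(k:ℝ)) hci)
  have := avg_const_add (Real.log D + k * Real.log E) (ci_const_mul (-(k:ℝ)) hci)
  rw [avg_const_mul, hav, mul_zero, add_zero] at this
  rw [← this]
  refine circleAverage_mono (mero_ciP (fun w hw => (hm _ (im_zz_gt Y hw)).comp_analyticAt (analyticAt_zz Y hw)) hr0 h2) hci2 fun w hw => ?_
  have hwb := hcl (sphere_subset_closedBall hw)
  have hw1 : ‖w‖ < 1 := by simpa using hwb
  have hn0 : 0 < ‖1 - w‖ := norm_pos_iff.2 (one_sub_ne hwb)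
  have hn2 : ‖1 - w‖ ≤ 2 := (norm_sub_le _ _).trans (by simp; linarith)
  have hz : 1 + ‖zz Y w‖ ≤ E / ‖1 - w‖ := by
    have a1 : ‖zz Y w‖ ≤ |Y| + 2 / ‖1 - w‖ := by
      rw [zz, norm_mul, Complex.norm_I, one_mul]
      refine (norm_add_le _ _).trans ?_
      rw [norm_div, Complex.norm_real, Real.norm_eq_abs]
      gcongr
      exact (norm_add_le _ _).trans (by simp; linarith)
    rw [le_div_iff₀ hn0]
    have a2 : (|Y| + 2 / ‖1 - w‖) * ‖1 - w‖ = |Y| * ‖1 - w‖ + 2 := by field_simp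
    have a3 := mul_le_mul_of_nonneg_right a1 hn0.le
    have a4 := mul_le_mul_of_nonneg_left hn2 (abs_nonneg Y)
    rw [hE]; nlinarith
  have hb1 : ‖U (zz Y w)‖ ≤ D * (E / ‖1 - w‖) ^ k := by
    refine (hb _ (im_zz_gt Y hwb).le).trans ?_
    have : (1 + ‖zz Y w‖) ^ k ≤ (E / ‖1 - w‖) ^ k := pow_le_pow_left₀ (by positivity) hz k
    exact mul_le_mul (by linarith) this (by positivity) (by linarith)
  have hlog : Real.log (D * (E / ‖1 - w‖) ^ k) = Real.log D + k * Real.log E + -k * Real.log ‖1 - w‖ := by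
    rw [Real.log_mul (by positivity) (by positivity), Real.log_pow, Real.log_div (by positivity) hn0.ne']
    ring
  have hge : 1 ≤ D * (E / ‖1 - w‖) ^ k := by
    have : 1 ≤ E / ‖1 - w‖ := le_trans (by linarith [norm_nonneg (zz Y w)]) hz
    exact one_le_mul_of_one_le_of_one_le (by linarith) (one_le_pow₀ this)
  change log⁺ ‖U (zz Y w)‖ ≤ _
  rw [← hlog]
  refine (posLog_le_posLog (norm_nonneg _) hb1).trans ?_
  rw [posLog_apply, max_eq_right (Real.log_nonneg hge)]

end NV

open Complex Filter Topology MeasureTheory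
open scoped Classical

namespace NV
open Metric Real Bornology

variable {f : ℂ → ℂ} {P : Finset ℂ}

lemma mero_top {W : ℂ → ℂ} (hm : ∀ z, MeromorphicAt W z) {z0 : ℂ} (h0 : meromorphicOrderAt W z0 = ⊤) (z : ℂ) :
    meromorphicOrderAt W z = ⊤ := by
  by_contra h1
  exact MeromorphicOn.meromorphicOrderAt_ne_top_of_isPreconnected (U := Set.univ) (x := z) (y := z0) (fun z _ => hm z) isPreconnected_univ trivial trivial h1 h0

lemma mero_const {c : ℂ → ℂ} (hm : ∀ z, MeromorphicAt c z) (hd : ∀ z, ∀ᶠ w in 𝓝[≠] z, deriv c w = 0) :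
    ∃ k : ℂ, ∀ z, ∀ᶠ w in 𝓝[≠] z, c w = k := by
  obtain ⟨z0, hz0⟩ := (hm 0).eventually_analyticAt.exists
  refine ⟨c z0, fun z => ?_⟩
  have hd : ∀ᶠ z in 𝓝 z0, deriv c z = 0 :=
    (hz0.deriv.frequently_zero_iff_eventually_zero).1 (hd z0).frequently
  have hconst : ∀ᶠ z in 𝓝 z0, c z = c z0 := by
    obtain ⟨ε, hε, hb⟩ := Metric.eventually_nhds_iff_ball.1 (hd.and hz0.eventually_analyticAt)
    filter_upwards [ball_mem_nhds z0 hε] with z hz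
    have hdo : DifferentiableOn ℂ c (ball z0 ε) := fun w hw => (hb w hw).2.differentiableAt.differentiableWithinAt
    exact isOpen_ball.is_const_of_deriv_eq_zero (convex_ball z0 ε).isPreconnected hdo
      (fun w hw => (hb w hw).1) hz (mem_ball_self hε)
  have := mero_top (W := fun z => c z - c z0) (fun z => (hm z).fun_sub (MeromorphicAt.const _ z)) (z0 := z0) (by
    rw [meromorphicOrderAt_eq_top_iff]
    exact (hconst.mono fun z hz => by simp [hz]).filter_mono nhdsWithin_le_nhds) z
  rw [meromorphicOrderAt_eq_top_iff] at this
  exact this.mono fun z hz => by simpa [sub_eq_zero] using hz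

noncomputable def QQ (f : ℂ → ℂ) : ℂ → ℂ := fun z => LL f z - LL (til f) z

structure KOne (f : ℂ → ℂ) (P : Finset ℂ) : Prop where
  core : Core f P
  hA : ∀ z, ∀ᶠ w in 𝓝[≠] z, AA f w = AA (til f) w

lemma KOne.meroQ (k : KOne f P) (z : ℂ) : MeromorphicAt (QQ f) z := (k.core.meroL z).fun_sub (k.core.til.meroL z)

lemma wron_deriv {f g : ℂ → ℂ} {w : ℂ} (a : AnalyticAt ℂ f w) (b : AnalyticAt ℂ g w) :
    deriv (fun z => deriv f z * g z - f z * deriv g z) w = deriv (deriv f) w * g w - f w * deriv (deriv g) w := by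
  have h1 := (a.deriv.differentiableAt.hasDerivAt.mul b.differentiableAt.hasDerivAt).sub
    (a.differentiableAt.hasDerivAt.mul b.deriv.differentiableAt.hasDerivAt)
  have h2 := h1.deriv
  refine Eq.trans h2 ?_
  ring

/-- the Wronskian is a nonzero constant -/
lemma KOne.wron (k : KOne f P) : ∃ c : ℂ, c ≠ 0 ∧ ∀ z, ∀ᶠ w in 𝓝[≠] z, deriv f w * til f w - f w * deriv (til f) w = c := by
  have h := k.core
  obtain ⟨c, hc⟩ := mero_const (c := fun w => deriv f w * til f w - f w * deriv (til f) w)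
    (fun z => ((h.mero z).deriv.fun_mul (h.til.mero z)).fun_sub ((h.mero z).fun_mul (h.til.mero z).deriv)) (fun z => by
      filter_upwards [h.ev_an z, h.til.ev_an z, k.hA z] with w h1 h2 h3
      rw [wron_deriv h1.1 h2.1]
      simp only [AA] at h3
      rw [div_eq_div_iff h1.2 h2.2] at h3
      linear_combination h3)
  refine ⟨c, ?_, hc⟩
  rintro rfl
  apply h.snr
  obtain ⟨d, hd⟩ := mero_const (c := fun w => til f w / f w) (fun z => (h.til.mero z).fun_div (h.mero z)) (fun z => by
    filter_upwards [h.ev_an z, h.til.ev_an z, hc z] with w h1 h2 h3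
    have h4 := (h2.1.differentiableAt.hasDerivAt.div h1.1.differentiableAt.hasDerivAt h1.2).deriv
    refine Eq.trans h4 ?_
    rw [div_eq_zero_iff]; left
    linear_combination -h3)
  refine ⟨d, fun z => ?_⟩
  filter_upwards [h.ev_an z, hd z] with w h1 h2
  rw [← h2, div_mul_cancel₀ _ h1.2]

lemma KOne.Qeq (k : KOne f P) : ∃ c : ℂ, c ≠ 0 ∧ ∀ z, ∀ᶠ w in 𝓝[≠] z, QQ f w = c / (f w * til f w) := by
  obtain ⟨c, hc, h⟩ := k.wron
  refine ⟨c, hc, fun z => ?_⟩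
  filter_upwards [h z, k.core.ev_an z, k.core.til.ev_an z] with w h1 h2 h3
  rw [← h1]; simp only [QQ, LL]
  have := h2.2
  have := h3.2
  field_simp

lemma KOne.neQ (k : KOne f P) (z : ℂ) : meromorphicOrderAt (QQ f) z ≠ ⊤ := by
  obtain ⟨c, hc, h⟩ := k.Qeq
  rw [meromorphicOrderAt_ne_top_iff_eventually_ne_zero (k.meroQ z)]
  filter_upwards [h z, k.core.ev_an z, k.core.til.ev_an z] with w h1 h2 h3
  rw [h1]; exact div_ne_zero hc (mul_ne_zero h2.2 h3.2)

lemma KOne.anQ (k : KOne f P) {z : ℂ} (h1 : z.im ≠ 0) (h2 : z ∉ P) : AnalyticAt ℂ (QQ f) z ∧ QQ f z ≠ 0 := by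
  obtain ⟨c, hc, h⟩ := k.Qeq
  obtain ⟨a1, a2, _⟩ := k.core.good z h1 h2
  obtain ⟨b1, b2, _⟩ := k.core.til.good z h1 h2
  have hq : AnalyticAt ℂ (QQ f) z := (a1.deriv.fun_div a1 a2).fun_sub (b1.deriv.fun_div b1 b2)
  refine ⟨hq, ?_⟩
  have h3 : AnalyticAt ℂ (fun w => c / (f w * til f w)) z := analyticAt_const.fun_div (a1.fun_mul b1) (mul_ne_zero a2 b2)
  have h4 : QQ f z = c / (f z * til f z) :=
    ((hq.frequently_eq_iff_eventually_eq h3).1 (h z).frequently).self_of_nhds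
  rw [h4]; exact div_ne_zero hc (mul_ne_zero a2 b2)

lemma KOne.Aeq (k : KOne f P) {z : ℂ} (h1 : z.im ≠ 0) (h2 : z ∉ P) : AA f z = AA (til f) z :=
  (((k.core.anA h1 h2).1.frequently_eq_iff_eventually_eq (k.core.til.anA h1 h2).1).1 (k.hA z).frequently).self_of_nhds

/-- orders at real points -/
lemma KOne.ordQ (k : KOne f P) (x : ℝ) {p : ℤ} (hp : meromorphicOrderAt f x = p) :
    meromorphicOrderAt (QQ f) x = ((-2 * p : ℤ) : WithTop ℤ) ∧ p ≤ 0 := by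
  obtain ⟨c, hc, h⟩ := k.Qeq
  have hp' : meromorphicOrderAt (til f) x = p := by
    rw [til_order (k.core.mero _), conj_real, hp]
  have e1 : meromorphicOrderAt (QQ f) x = ((-2 * p : ℤ) : WithTop ℤ) := by
    have e : QQ f =ᶠ[𝓝[≠] (x:ℂ)] (fun _ => c) * (f * til f)⁻¹ := by
      filter_upwards [h x] with w hw
      rw [hw]; simp [div_eq_mul_inv]
    rw [meromorphicOrderAt_congr e, meromorphicOrderAt_mul (MeromorphicAt.const c _) ((k.core.mero _).mul (k.core.til.mero _)).inv,
      meromorphicOrderAt_inv, meromorphicOrderAt_mul (k.core.mero _) (k.core.til.mero _), hp, hp',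
      order_zero_of_an (g := fun _ => c) analyticAt_const hc, zero_add, ← WithTop.coe_add, ← WithTop.LinearOrderedAddCommGroup.coe_neg]
    congr 1; ring
  refine ⟨e1, ?_⟩
  obtain ⟨k1, a1, b1⟩ := logderiv_form (k.core.mero _) hp
  obtain ⟨k2, a2, b2⟩ := logderiv_form (k.core.til.mero _) hp'
  have e : QQ f =ᶠ[𝓝[≠] (x:ℂ)] (fun w => k1 w - k2 w) := by
    filter_upwards [b1, b2] with w h1 h2
    simp only [QQ, LL, h1, h2]; ring
  have h3 := (a1.fun_sub a2).meromorphicOrderAt_nonneg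
  rw [← meromorphicOrderAt_congr e, e1] at h3
  have : (0:ℤ) ≤ -2 * p := by exact_mod_cast h3
  omega

noncomputable def Th (f : ℂ → ℂ) : ℂ → ℂ := fun z => deriv (AA f) z / AA f z - 2 * (deriv (QQ f) z / QQ f z)

lemma KOne.meroT (k : KOne f P) (z : ℂ) : MeromorphicAt (Th f) z :=
  ((k.core.meroA z).deriv.fun_div (k.core.meroA z)).fun_sub
    ((MeromorphicAt.const 2 z).fun_mul ((k.meroQ z).deriv.fun_div (k.meroQ z)))

lemma KOne.neT (k : KOne f P) {x : ℝ} (hx : meromorphicOrderAt f x ≠ 0) (z : ℂ) : meromorphicOrderAt (Th f) z ≠ ⊤ := by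
  intro hz
  have h0 := mero_top k.meroT hz (x:ℂ)
  have hf := k.core.ne x
  obtain ⟨p, hp⟩ := WithTop.ne_top_iff_exists.1 hf
  obtain ⟨hq, hp0⟩ := k.ordQ x hp.symm
  have hpne : p ≠ 0 := by rintro rfl; exact hx hp.symm
  obtain ⟨a, ha⟩ := WithTop.ne_top_iff_exists.1 (k.core.neA x)
  obtain ⟨k1, a1, b1⟩ := logderiv_form (k.core.meroA x) ha.symm
  obtain ⟨k2, a2, b2⟩ := logderiv_form (k.meroQ x) hq
  rw [meromorphicOrderAt_eq_top_iff] at h0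
  -- order of A is -2
  have hlim := k.core.A_lim hp.symm
  have hpc : ((p:ℂ) ^ 2 - p) ≠ 0 := by
    have : p ^ 2 - p ≠ 0 := by nlinarith [lt_of_le_of_ne hp0 hpne]
    exact_mod_cast this
  have hid : AnalyticAt ℂ (fun z : ℂ => z - x) (x:ℂ) := by fun_prop
  have ho : meromorphicOrderAt (fun z => (z - x) ^ 2 * AA f z) (x:ℂ) = 0 :=
    (tendsto_ne_zero_iff_meromorphicOrderAt_eq_zero ((hid.fun_pow 2).meromorphicAt.fun_mul (k.core.meroA x))).1 ⟨_, hpc, hlim⟩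
  have ho1 : meromorphicOrderAt (fun z : ℂ => (z - x) ^ 2) (x:ℂ) = ((2:ℤ) : WithTop ℤ) := by
    rw [meromorphicOrderAt_eq_int_iff (hid.fun_pow 2).meromorphicAt]
    exact ⟨fun _ => 1, analyticAt_const, one_ne_zero, Eventually.of_forall fun z => by simp⟩
  have ho2 : a = -2 := by
    have := meromorphicOrderAt_mul (hid.fun_pow 2).meromorphicAt (k.core.meroA x)
    rw [ho1, ← ha] at this
    have h5 := ho.symm.trans this
    have : (0:ℤ) = 2 + a := by exact_mod_cast h5
    omega
  have hev : ∀ᶠ z in 𝓝[≠] (x:ℂ), (a + 4 * p : ℂ) = (z - x) * (2 * k2 z - k1 z) := by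
    filter_upwards [h0, b1, b2, self_mem_nhdsWithin] with z h0 h1 h2 h3
    have h4 : z - x ≠ 0 := sub_ne_zero.2 h3
    simp only [Th, h1, h2] at h0
    field_simp at h0
    push_cast at h0
    linear_combination h0
  have hc : Tendsto (fun z : ℂ => (z - x) * (2 * k2 z - k1 z)) (𝓝[≠] (x:ℂ)) (𝓝 (((x:ℂ) - x) * (2 * k2 x - k1 x))) := by
    have : AnalyticAt ℂ (fun z : ℂ => (z - x) * (2 * k2 z - k1 z)) (x:ℂ) := hid.fun_mul ((analyticAt_const.fun_mul a2).fun_sub a1)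
    exact this.continuousAt.tendsto.mono_left nhdsWithin_le_nhds
  have hc2 := hc.congr' (hev.mono fun z hz => hz.symm)
  rw [sub_self, zero_mul] at hc2
  have h6 := tendsto_nhds_unique hc2 tendsto_const_nhds
  have h7 : a + 4 * p = 0 := by exact_mod_cast h6.symm
  omega

end NV

open Complex Filter Topology MeasureTheory
open scoped Classical

namespace NV
open Metric Real Bornology

variable {f : ℂ → ℂ} {P : Finset ℂ}

lemma pl_sq (x : ℂ) : log⁺ ‖x‖ ≤ log⁺ ‖x * x‖ := by
  rcases le_total ‖x‖ 1 with h | h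
  · rw [posLog_eq_zero_iff _ |>.2 (by rwa [abs_of_nonneg (norm_nonneg x)])]; exact posLog_nonneg
  · refine posLog_le_posLog (norm_nonneg _) ?_
    rw [norm_mul]; nlinarith

/-- bounded mean of `log⁺ |Q|` in a high half plane -/
lemma KOne.bdd (k : KOne f P) {x : ℝ} (hx : meromorphicOrderAt f x ≠ 0) : ∃ Y B : ℝ, 0 ≤ Y ∧ 0 ≤ B ∧
    ∀ r : ℝ, 1/2 ≤ r → r < 1 → mm (fun w => QQ f (zz Y w)) r ≤ B := by
  have h := k.core
  set Y0 : ℝ := ∑ s ∈ P, |s.im| + 1 with hY0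
  have hY0p : 1 ≤ Y0 := by
    have : 0 ≤ ∑ s ∈ P, |s.im| := Finset.sum_nonneg fun s _ => abs_nonneg _
    linarith
  have him : ∀ z : ℂ, Y0 < z.im → z.im ≠ 0 := fun z hz => by linarith
  have hnP : ∀ z : ℂ, Y0 < z.im → z ∉ P := fun z hz hP => by
    have := Finset.single_le_sum (f := fun s : ℂ => |s.im|) (fun s _ => abs_nonneg _) hP
    have := le_abs_self z.im
    linarith
  have hQ : ∀ z : ℂ, Y0 < z.im → AnalyticAt ℂ (QQ f) z ∧ QQ f z ≠ 0 := fun z hz => k.anQ (him z hz) (hnP z hz)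
  have hA : ∀ z : ℂ, Y0 < z.im → AnalyticAt ℂ (AA f) z ∧ AA f z ≠ 0 := fun z hz => h.anA (him z hz) (hnP z hz)
  obtain ⟨g1, g2, -⟩ := h.UH (Y := Y0) (by linarith)
  obtain ⟨g3, -, -⟩ := h.til.UH (Y := Y0) (by linarith)
  have meQ : Me fun w => QQ f (zz Y0 w) := fun w hw => (k.meroQ _).comp_analyticAt (analyticAt_zz Y0 hw)
  have meL : Me fun w => LL f (zz Y0 w) := fun w hw => (h.meroL _).comp_analyticAt (analyticAt_zz Y0 hw)
  have meM : Me fun w => LL (til f) (zz Y0 w) := fun w hw => (h.til.meroL _).comp_analyticAt (analyticAt_zz Y0 hw)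
  have gQ : GR (mm fun w => QQ f (zz Y0 w)) := by
    obtain ⟨C1, c1, d1⟩ := g1
    obtain ⟨C2, c2, d2⟩ := g3
    refine ⟨1 + C1 + C2, by positivity, fun r h1 h2 => ?_⟩
    have := mm_gen (N := 1) meQ meL meM (Me.const 0) (Ev_of fun z => by
      have := pl_sub (LL f (zz Y0 z)) (LL (til f) (zz Y0 z))
      simp only [norm_zero, posLog_zero, QQ]
      linarith) h1 h2
    have m0 : mm (fun _ => (0:ℂ)) r = 0 := by simp [mm, circleAverage_const]
    rw [m0] at this
    have := d1 r h1 h2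
    have := d2 r h1 h2
    have := log_inv1_nonneg h1 h2
    nlinarith
  have pQ := pb_logderiv hQ gQ
  have pA := pb_logderiv hA g2
  -- derivative identities
  have hL : ∀ z : ℂ, Y0 < z.im → HasDerivAt (LL f) (AA f z - LL f z ^ 2) z := fun z hz => by
    obtain ⟨a, b, _⟩ := h.good z (him z hz) (hnP z hz)
    exact AA_eq a b
  have hM : ∀ z : ℂ, Y0 < z.im → HasDerivAt (LL (til f)) (AA f z - LL (til f) z ^ 2) z := fun z hz => by
    obtain ⟨a, b, _⟩ := h.til.good z (him z hz) (hnP z hz)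
    rw [k.Aeq (him z hz) (hnP z hz)]
    exact AA_eq a b
  have dQ : ∀ z : ℂ, Y0 < z.im → deriv (QQ f) z = - (QQ f z * (LL f z + LL (til f) z)) := fun z hz => by
    refine ((hL z hz).sub (hM z hz)).deriv.trans ?_
    simp only [QQ]; ring
  have hLan : ∀ z : ℂ, Y0 < z.im → AnalyticAt ℂ (LL f) z := fun z hz => by
    obtain ⟨a, b, _⟩ := h.good z (him z hz) (hnP z hz)
    exact a.deriv.fun_div a b
  have hMan : ∀ z : ℂ, Y0 < z.im → AnalyticAt ℂ (LL (til f)) z := fun z hz => by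
    obtain ⟨a, b, _⟩ := h.til.good z (him z hz) (hnP z hz)
    exact a.deriv.fun_div a b
  set N : ℂ → ℂ := fun z => LL f z + LL (til f) z with hN
  have hNan : ∀ z : ℂ, Y0 < z.im → AnalyticAt ℂ N z := fun z hz => (hLan z hz).fun_add (hMan z hz)
  have pN : PB (Y0 + 1) N := ((PB.const _ (-1)).mul pQ).congr fun z hz => by
    have hz' : Y0 < z.im := by linarith
    have := (hQ z hz').2
    simp only [dQ z hz', hN]
    field_simp
  have pN' : PB (Y0 + 2) (deriv N) := (pN.deriv fun z hz => hNan z (by linarith)).mono (by linarith)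
  set Ψ : ℂ → ℂ := fun z => AA f z - QQ f z ^ 2 / 4 with hΨ
  have pΨ : PB (Y0 + 2) Ψ := (((PB.const _ (1/2)).mul pN').add ((PB.const _ (1/4)).mul ((pN.mul pN).mono (by linarith)))).congr fun z hz => by
    have hz' : Y0 < z.im := by linarith
    have : deriv N z = _ := ((hL z hz').add (hM z hz')).deriv
    rw [this]; simp only [hΨ, hN, QQ]; ring
  have hΨan : ∀ z : ℂ, Y0 < z.im → AnalyticAt ℂ Ψ z := fun z hz =>
    (hA z hz).1.fun_sub (((hQ z hz).1.fun_pow 2).fun_div analyticAt_const (by norm_num))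
  have pΨ' : PB (Y0 + 3) (deriv Ψ) := (pΨ.deriv fun z hz => hΨan z (by linarith)).mono (by linarith)
  set Y := Y0 + 3 with hY
  set V : ℂ → ℂ := fun z => deriv Ψ z + (-2) * (Ψ z * (deriv (QQ f) z / QQ f z)) with hV
  have pV : PB Y V := pΨ'.add ((PB.const _ (-2)).mul ((pΨ.mono (by linarith)).mul (pQ.mono (by linarith))))
  have pT : PB Y (Th f) := (((pA.mono (by linarith)).add ((PB.const _ (-2)).mul (pQ.mono (by linarith)))).congr fun z hz => by
    simp only [Th]; ring)
  have hVT : ∀ z : ℂ, Y0 < z.im → V z = AA f z * Th f z := fun z hz => by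
    have h1 := (hA z hz).1.differentiableAt.hasDerivAt
    have h2 := (hQ z hz).1.differentiableAt.hasDerivAt
    have h3 : deriv Ψ z = deriv (AA f) z - (2 * QQ f z * deriv (QQ f) z) / 4 := by
      have := (h1.sub ((h2.pow 2).div_const 4)).deriv
      refine Eq.trans this ?_
      simp
    have h4 := (hA z hz).2
    have h5 := (hQ z hz).2
    simp only [hV]
    rw [h3]
    simp only [Th, hΨ]
    field_simp
    ring
  have anT : ∀ z : ℂ, Y0 < z.im → AnalyticAt ℂ (Th f) z := fun z hz =>
    ((hA z hz).1.deriv.fun_div (hA z hz).1 (hA z hz).2).fun_sub (analyticAt_const.fun_mul ((hQ z hz).1.deriv.fun_div (hQ z hz).1 (hQ z hz).2))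
  have anV : ∀ z : ℂ, Y0 < z.im → AnalyticAt ℂ V z := fun z hz =>
    (hΨan z hz).deriv.fun_add (analyticAt_const.fun_mul ((hΨan z hz).fun_mul ((hQ z hz).1.deriv.fun_div (hQ z hz).1 (hQ z hz).2)))
  obtain ⟨B1, b1, hB1⟩ := mm_pb pV fun z hz => (anV z (by linarith)).meromorphicAt
  obtain ⟨B2, b2, hB2⟩ := mm_pb pT fun z hz => (anT z (by linarith)).meromorphicAt
  obtain ⟨B3, b3, hB3⟩ := mm_pb (pΨ.mono (show Y0 + 2 ≤ Y by linarith)) fun z hz => (hΨan z (by linarith)).meromorphicAt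
  have hT : ∀ w ∈ ball (0:ℂ) 1, AnalyticAt ℂ (fun w => Th f (zz Y w)) w := fun w hw =>
    (anT _ (by have := im_zz_gt Y hw; linarith)).comp' (analyticAt_zz Y hw)
  have fpT : FP fun w => Th f (zz Y w) := FP.of_analytic hT
  have nzT : NZ fun w => Th f (zz Y w) := by
    intro w hw
    rw [meromorphicOrderAt_ne_top_iff_eventually_ne_zero (hT w hw).meromorphicAt]
    have h1 := (meromorphicOrderAt_ne_top_iff_eventually_ne_zero (k.meroT (zz Y w))).1 (k.neT hx _)
    have h2 : Tendsto (zz Y) (𝓝[≠] w) (𝓝[≠] (zz Y w)) := by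
      refine tendsto_nhdsWithin_iff.2 ⟨((analyticAt_zz Y hw).continuousAt.tendsto).mono_left nhdsWithin_le_nhds, ?_⟩
      filter_upwards [self_mem_nhdsWithin, nhdsWithin_le_nhds (isOpen_ball.mem_nhds hw)] with v hv hvb he
      apply hv
      have he' : zz Y v = zz Y w := he
      rw [Set.mem_singleton_iff, ← ww_zz Y hvb, he', ww_zz Y hw]
    exact h2.eventually h1
  obtain ⟨J, hJ0, hJ⟩ := fpT.jensen0 nzT
  refine ⟨Y, 4 * (1 + B1 + (B2 + J) + B3), by linarith, by positivity, fun r h1 h2 => ?_⟩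
  have hgt : ∀ w ∈ ball (0:ℂ) 1, Y0 < (zz Y w).im := fun w hw => by have := im_zz_gt Y hw; linarith
  have key := mm_gen (N := 4) (h := fun w => QQ f (zz Y w)) (k₁ := fun w => V (zz Y w)) (k₂ := fun w => (Th f (zz Y w))⁻¹) (k₃ := fun w => Ψ (zz Y w))
    (fun w hw => (k.meroQ _).comp_analyticAt (analyticAt_zz Y hw))
    (fun w hw => (anV _ (hgt w hw)).meromorphicAt.comp_analyticAt (analyticAt_zz Y hw))
    (fun w hw => (hT w hw).meromorphicAt.fun_inv)
    (fun w hw => (hΨan _ (hgt w hw)).meromorphicAt.comp_analyticAt (analyticAt_zz Y hw))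
    (((nzT.ev fpT).and Ev_ball).mono fun w hw => by
      obtain ⟨hw0, hwb⟩ := hw
      set z := zz Y w
      have e1 : QQ f z * QQ f z = 4 * (V z * (Th f z)⁻¹ - Ψ z) := by
        rw [hVT z (hgt w hwb)]
        simp only [hΨ]
        field_simp
        ring
      have l1 := pl_sq (QQ f z)
      rw [e1] at l1
      have l2 := pl_mul 4 (V z * (Th f z)⁻¹ - Ψ z)
      have l3 := pl_sub (V z * (Th f z)⁻¹) (Ψ z)
      have l4 := pl_mul (V z) (Th f z)⁻¹
      have l5 : log⁺ ‖(4:ℂ)‖ ≤ 3 := by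
        rw [posLog_apply]
        have : Real.log ‖(4:ℂ)‖ ≤ 3 := by
          have := Real.log_le_sub_one_of_pos (x := 4) (by norm_num)
          simp at *; linarith
        exact max_le (by norm_num) this
      have p1 : 0 ≤ log⁺ ‖V z‖ := posLog_nonneg
      have p2 : 0 ≤ log⁺ ‖(Th f z)⁻¹‖ := posLog_nonneg
      have p3 : 0 ≤ log⁺ ‖Ψ z‖ := posLog_nonneg
      linarith) h1 h2
  refine key.trans (mul_le_mul_of_nonneg_left ?_ (by norm_num))
  have i1 := hB1 r h1 h2
  have i2 := hB2 r h1 h2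
  have i3 := hB3 r h1 h2
  have i4 := mm_inv fpT.me h1 h2
  have i5 := hJ r h1 h2
  linarith

end NV

open Complex Filter Topology MeasureTheory
open scoped Classical

namespace NV
open Metric Real Bornology

variable {f : ℂ → ℂ} {P : Finset ℂ}

lemma jensen_count {Q : ℂ → ℂ} (hm : ∀ z, MeromorphicAt Q z)
    (hP : ∀ z ∉ P, 0 ≤ meromorphicOrderAt Q z) (h0P : (0:ℂ) ∉ P) : ∃ C : ℝ, 0 ≤ C ∧ ∀ R t : ℝ, 1 ≤ R → 2 * R ≤ t →
    ∀ S : Finset ℂ, (∀ u ∈ S, u ≠ 0 ∧ u ∉ P ∧ ‖u‖ ≤ R ∧ 2 ≤ (meromorphicOrderAt Q u).untop₀) →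
    (S.card : ℝ) - C * (1 + Real.log t) ≤ circleAverage (fun z => Real.log ‖Q z‖) 0 t := by
  set Dv : ℂ → ℝ := fun u => ((meromorphicOrderAt Q u).untop₀ : ℝ) with hDv
  set c : ℂ → ℝ := fun u => |Dv u| * (1 + |Real.log ‖u‖|) with hc
  have hc0 : ∀ u, 0 ≤ c u := fun u => by positivity
  refine ⟨∑ u ∈ P, c u + |Real.log ‖meromorphicTrailingCoeffAt Q 0‖|, by
    have := Finset.sum_nonneg (s := P) fun u _ => hc0 u
    positivity, ?_⟩
  intro R t hR hRt S hS
  have ht1 : 1 ≤ t := by linarith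
  have ht0 : 0 < t := by linarith
  have hlt : 0 ≤ Real.log t := Real.log_nonneg ht1
  have hM : MeromorphicOn Q (closedBall 0 |t|) := fun z _ => hm z
  rw [hM.circleAverage_log_norm ht0.ne']
  rw [abs_of_pos ht0] at hM ⊢
  set d := MeromorphicOn.divisor Q (closedBall 0 t) with hd
  have hdin : ∀ u ∈ closedBall (0:ℂ) t, ((d u : ℤ) : ℝ) = Dv u := fun u hu => by
    rw [hd, MeromorphicOn.divisor_apply hM hu]
  have hdout : ∀ u ∉ closedBall (0:ℂ) t, d u = 0 := fun u hu => by
    by_contra h0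
    exact hu (d.supportWithinDomain h0)
  have hD0 : ∀ u ∉ P, 0 ≤ Dv u := fun u hu => by
    have h7 : 0 ≤ (meromorphicOrderAt Q u).untop₀ := WithTop.untop₀_nonneg.2 (hP u hu)
    simp only [hDv]
    exact_mod_cast h7
  have hfin := d.finiteSupport (isCompact_closedBall 0 t)
  rw [finsum_eq_sum_of_support_subset (s := hfin.toFinset ∪ S)]
  swap
  · intro u hu
    simp only [Finset.coe_union, Set.Finite.coe_toFinset, Set.mem_union, Function.mem_support] at *
    left; intro h0; apply hu; simp [h0]
  set T := hfin.toFinset ∪ S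
  have hkey : ∀ u ∈ T, (if u ∈ S then (1:ℝ) else 0) - (if u ∈ P then c u * (1 + Real.log t) else 0) ≤
      (d u : ℝ) * Real.log (t * ‖0 - u‖⁻¹) := by
    intro u hu
    rw [zero_sub, norm_neg]
    by_cases huP : u ∈ P
    · have huS : u ∉ S := fun h => (hS u h).2.1 huP
      rw [if_pos huP, if_neg huS]
      have hu0 : u ≠ 0 := fun h => h0P (h ▸ huP)
      have h2 : |(d u : ℝ)| ≤ |Dv u| := by
        by_cases hu : u ∈ closedBall (0:ℂ) t
        · rw [hdin u hu]
        · rw [hdout u hu]; simp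
      have h3 : |Real.log (t * ‖u‖⁻¹)| ≤ (1 + |Real.log ‖u‖|) * (1 + Real.log t) := by
        rw [Real.log_mul ht0.ne' (by simpa using hu0), Real.log_inv]
        refine (abs_add_le _ _).trans ?_
        rw [abs_neg, abs_of_nonneg hlt]
        nlinarith [abs_nonneg (Real.log ‖u‖), mul_nonneg (abs_nonneg (Real.log ‖u‖)) hlt]
      have h4 : |(d u : ℝ) * Real.log (t * ‖u‖⁻¹)| ≤ |Dv u| * ((1 + |Real.log ‖u‖|) * (1 + Real.log t)) := by
        rw [abs_mul]; exact mul_le_mul h2 h3 (abs_nonneg _) (abs_nonneg _)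
      have h5 := neg_abs_le ((d u : ℝ) * Real.log (t * ‖u‖⁻¹))
      simp only [hc]
      rw [mul_assoc]
      linarith
    · rw [if_neg huP, sub_zero]
      by_cases hub : u ∈ closedBall (0:ℂ) t
      · rw [hdin u hub]
        have hub' : ‖u‖ ≤ t := by simpa using hub
        split_ifs with h
        · obtain ⟨h1, _, h3, h4⟩ := hS u h
          have h5 : (2:ℝ) ≤ Dv u := by simp only [hDv]; exact_mod_cast h4
          have hnu : 0 < ‖u‖ := norm_pos_iff.2 h1
          have h6 : Real.log 2 ≤ Real.log (t * ‖u‖⁻¹) := by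
            apply Real.log_le_log (by norm_num)
            rw [← div_eq_mul_inv, le_div_iff₀ hnu]; linarith
          have := Real.log_two_gt_d9
          nlinarith
        · rcases eq_or_ne u 0 with rfl | hu0
          · simp
          refine mul_nonneg (hD0 u huP) (Real.log_nonneg ?_)
          rw [← div_eq_mul_inv, one_le_div (norm_pos_iff.2 hu0)]; exact hub'
      · rw [hdout u hub]
        have : u ∉ S := fun h => hub (by have := (hS u h).2.2.1; simp; linarith)
        simp [this]
  have hsum := Finset.sum_le_sum hkey
  rw [Finset.sum_sub_distrib, ← Finset.sum_filter, ← Finset.sum_filter] at hsum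
  have e1 : T.filter (· ∈ S) = S := by
    ext u; simp [T]
  have e2 : ∑ u ∈ T.filter (· ∈ P), c u * (1 + Real.log t) ≤ ∑ u ∈ P, c u * (1 + Real.log t) :=
    Finset.sum_le_sum_of_subset_of_nonneg (fun u hu => (Finset.mem_filter.1 hu).2) fun u _ _ => mul_nonneg (hc0 u) (by linarith)
  rw [e1, Finset.sum_const, nsmul_eq_mul, mul_one] at hsum
  have e3 : ∑ u ∈ P, c u * (1 + Real.log t) = (∑ u ∈ P, c u) * (1 + Real.log t) := (Finset.sum_mul _ _ _).symm
  have h0 : 0 ≤ (d 0 : ℝ) * Real.log t := by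
    rw [hdin 0 (by simp [ht0.le])]
    exact mul_nonneg (hD0 0 h0P) hlt
  have h1 := neg_abs_le (Real.log ‖meromorphicTrailingCoeffAt Q 0‖)
  have h2 := mul_nonneg (abs_nonneg (Real.log ‖meromorphicTrailingCoeffAt Q 0‖)) hlt
  rw [add_mul]
  have h3 : |Real.log ‖meromorphicTrailingCoeffAt Q 0‖| * (1 + Real.log t) =
    |Real.log ‖meromorphicTrailingCoeffAt Q 0‖| + |Real.log ‖meromorphicTrailingCoeffAt Q 0‖| * Real.log t := by ring
  rw [h3]
  linarith

lemma KOne.radius (k : KOne f P) {x : ℝ} (hx : meromorphicOrderAt f x ≠ 0) : ∃ C R₀ : ℝ, 0 ≤ C ∧ ∀ R, R₀ ≤ R →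
    ∃ t, R < t ∧ t < 2 * R ∧ circleAverage (fun z => log⁺ ‖QQ f z‖) 0 t ≤ C * R := by
  have h := k.core
  obtain ⟨Y, B, hY, hB, hb⟩ := k.bdd hx
  obtain ⟨C1, R1, c1, a1⟩ := area_bdd (Y := Y) (F := fun z => log⁺ ‖QQ f z‖) hB (fun z => posLog_nonneg) (fun r h1 h2 =>
    mero_ciP (h := fun w => QQ f (zz Y w)) (fun w hw => (k.meroQ _).comp_analyticAt (analyticAt_zz Y hw)) (by linarith) h2) hb
  obtain ⟨g1, -, -⟩ := h.UH (Y := 0) le_rfl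
  obtain ⟨g3, -, -⟩ := h.til.UH (Y := 0) le_rfl
  have gQ : GR (mm fun w => QQ f (zz 0 w)) := by
    obtain ⟨C1, c1, d1⟩ := g1
    obtain ⟨C2, c2, d2⟩ := g3
    refine ⟨1 + C1 + C2, by positivity, fun r h1 h2 => ?_⟩
    have := mm_gen (N := 1) (h := fun w => QQ f (zz 0 w)) (k₁ := fun w => LL f (zz 0 w)) (k₂ := fun w => LL (til f) (zz 0 w))
      (fun w hw => (k.meroQ _).comp_analyticAt (analyticAt_zz 0 hw)) (fun w hw => (h.meroL _).comp_analyticAt (analyticAt_zz 0 hw)) 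
      (fun w hw => (h.til.meroL _).comp_analyticAt (analyticAt_zz 0 hw)) (Me.const 0) (Ev_of fun z => by
      have := pl_sub (LL f (zz 0 z)) (LL (til f) (zz 0 z))
      simp only [norm_zero, posLog_zero, QQ]
      linarith) h1 h2
    have m0 : mm (fun _ => (0:ℂ)) r = 0 := by simp [mm, circleAverage_const]
    rw [m0] at this
    have := d1 r h1 h2
    have := d2 r h1 h2
    have := log_inv1_nonneg h1 h2
    nlinarith
  obtain ⟨C2, R2, c2, a2⟩ := area_strip (S := Y + 1) (by linarith) (grf_of k.meroQ gQ)
  refine ⟨C1 + C2, max (max R1 R2) 1, by positivity, fun R hR => ?_⟩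
  have hR1 : R1 ≤ R := (le_max_left _ _).trans ((le_max_left _ _).trans hR)
  have hR2 : R2 ≤ R := (le_max_right _ _).trans ((le_max_left _ _).trans hR)
  have hR0 : 1 ≤ R := (le_max_right _ _).trans hR
  have hsub : {z : ℂ | R < ‖z‖ ∧ ‖z‖ < 2 * R ∧ 0 < z.im} ⊆ {z : ℂ | R < ‖z‖ ∧ ‖z‖ < 2 * R ∧ Y < z.im} ∪
      {z : ℂ | R < ‖z‖ ∧ ‖z‖ < 2 * R ∧ 0 < z.im ∧ z.im < Y + 1} := by
    rintro z ⟨h1, h2, h3⟩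
    by_cases h4 : Y < z.im
    · exact Or.inl ⟨h1, h2, h4⟩
    · exact Or.inr ⟨h1, h2, h3, by linarith⟩
  have hA : ∫⁻ z in {z : ℂ | R < ‖z‖ ∧ ‖z‖ < 2 * R ∧ 0 < z.im}, ENNReal.ofReal (log⁺ ‖QQ f z‖) ≤ ENNReal.ofReal ((C1 + C2) * R ^ 3) := by
    refine (lintegral_mono_set hsub).trans ((lintegral_union_le _ _ _).trans ?_)
    refine (add_le_add (a1 R hR1) (a2 R hR2)).trans ?_
    rw [← ENNReal.ofReal_add (by positivity) (by positivity), add_mul]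
  obtain ⟨t, t1, t2, t3⟩ := good_radius (F := fun z => log⁺ ‖QQ f z‖) (fun z => posLog_nonneg) (meas_pl k.meroQ) (fun z => by
    have : QQ f ((starRingEnd ℂ) z) = - (starRingEnd ℂ) (QQ f z) := by
      have e1 : LL (til f) z = (starRingEnd ℂ) (LL f ((starRingEnd ℂ) z)) := by rw [← til_LL]; rfl
      have e2 : LL (til f) ((starRingEnd ℂ) z) = (starRingEnd ℂ) (LL f z) := by rw [← til_LL]; simp [til]
      simp only [QQ, e1, e2, map_sub, Complex.conj_conj]; ring
    simp only [this, norm_neg, RCLike.norm_conj]) (fun r _ => ci_pl k.meroQ r) (by linarith) (by positivity) hA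
  refine ⟨t, t1, t2, t3.trans (le_of_eq ?_)⟩
  have : R ≠ 0 := by linarith
  field_simp

lemma lin_of_large (hm : ∀ z, MeromorphicAt f z) (hne : ∀ z, meromorphicOrderAt f z ≠ ⊤) {C R₀ : ℝ} (hC : 0 ≤ C)
    (h : ∀ t, R₀ ≤ t → ((ZP f ∩ closedBall 0 t).ncard : ℝ) ≤ C * t) : LinCount f := by
  set T := max R₀ 1 with hT
  refine ⟨C * T, mul_nonneg hC (by positivity), fun t ht => ?_⟩
  have hT1 : 1 ≤ T := le_max_right _ _
  have hmono : (ZP f ∩ closedBall 0 t).ncard ≤ (ZP f ∩ closedBall 0 (max T t)).ncard :=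
    Set.ncard_le_ncard (Set.inter_subset_inter_right _ (closedBall_subset_closedBall (le_max_right _ _))) (zp_fin hm hne _)
  have h1 := h (max T t) ((le_max_left _ _).trans (le_max_left _ _))
  have h2 : ((ZP f ∩ closedBall 0 t).ncard : ℝ) ≤ (ZP f ∩ closedBall 0 (max T t)).ncard := by exact_mod_cast hmono
  refine h2.trans (h1.trans ?_)
  rw [mul_assoc]
  refine mul_le_mul_of_nonneg_left (max_le ?_ ?_) hC <;> nlinarith

/-- Step 5. -/
lemma KOne.lin (k : KOne f P) : LinCount f := by
  by_cases hex : ∃ x : ℝ, meromorphicOrderAt f x ≠ 0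
  swap
  · push Not at hex
    refine lin_of_large k.core.mero k.core.ne (C := P.card) (R₀ := 1) (by positivity) fun t ht => ?_
    have hsub : ZP f ∩ closedBall 0 t ⊆ (P : Set ℂ) := by
      rintro z ⟨h1, -⟩
      by_cases him : z.im = 0
      · have hz : z = (z.re : ℂ) := Complex.ext (by simp) (by simp [him])
        exact absurd (hex z.re) (by rw [← hz]; exact h1)
      · exact k.core.zp_nonreal h1 him
    have := Set.ncard_le_ncard hsub P.finite_toSet
    rw [Set.ncard_coe_finset] at this
    have h3 : ((ZP f ∩ closedBall 0 t).ncard : ℝ) ≤ P.card := by exact_mod_cast this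
    have : (0:ℝ) ≤ P.card := by positivity
    nlinarith
  obtain ⟨x, hx⟩ := hex
  have h0P : (0:ℂ) ∉ P := by simpa using k.core.real_notMem 0
  have hreal : ∀ z : ℂ, z.im = 0 → (z.re : ℂ) = z := fun z hz => Complex.ext (by simp) (by simp [hz])
  have hordr : ∀ z : ℂ, z.im = 0 → ∃ p : ℤ, meromorphicOrderAt f z = p ∧ meromorphicOrderAt (QQ f) z = ((-2 * p : ℤ) : WithTop ℤ) ∧ p ≤ 0 := by
    intro z hz
    obtain ⟨p, hp⟩ := WithTop.ne_top_iff_exists.1 (k.core.ne z)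
    have := k.ordQ z.re (p := p) (by rw [hreal z hz]; exact hp.symm)
    rw [hreal z hz] at this
    exact ⟨p, hp.symm, this⟩
  obtain ⟨C1, c1, hJ⟩ := jensen_count (Q := QQ f) (P := P) k.meroQ (fun z hz => by
    by_cases him : z.im = 0
    · obtain ⟨p, -, h2, h3⟩ := hordr z him
      rw [h2]; exact_mod_cast (by omega : (0:ℤ) ≤ -2 * p)
    · exact (k.anQ him hz).1.meromorphicOrderAt_nonneg) h0P
  obtain ⟨C2, R₀, c2, hr⟩ := k.radius hx
  refine lin_of_large k.core.mero k.core.ne (C := P.card + 1 + 2 * C2 + 4 * C1) (R₀ := max R₀ 1) (by positivity) fun R hR => ?_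
  have hR0 : R₀ ≤ R := (le_max_left _ _).trans hR
  have hR1 : 1 ≤ R := (le_max_right _ _).trans hR
  obtain ⟨t, t1, t2, t3⟩ := hr (2 * R) (by linarith)
  have hfin := zp_fin k.core.mero k.core.ne R
  set S := hfin.toFinset.filter fun z => z.im = 0 ∧ z ≠ 0 with hS
  have j := hJ R t hR1 t1.le S (fun u hu => by
    simp only [hS, Finset.mem_filter, Set.Finite.mem_toFinset, Set.mem_inter_iff, mem_closedBall, dist_zero_right] at hu
    obtain ⟨⟨h1, h2⟩, h3, h4⟩ := hu
    refine ⟨h4, fun hP => k.core.im u hP h3, h2, ?_⟩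
    obtain ⟨p, e1, e2, e3⟩ := hordr u h3
    rw [e2, WithTop.untop₀_coe]
    have : p ≠ 0 := by rintro rfl; exact h1 e1
    omega)
  have hle : circleAverage (fun z => Real.log ‖QQ f z‖) 0 t ≤ circleAverage (fun z => log⁺ ‖QQ f z‖) 0 t := by
    refine circleAverage_mono (MeromorphicOn.circleIntegrable_log_norm fun z _ => k.meroQ z) (ci_pl k.meroQ t) fun z _ => ?_
    change Real.log ‖QQ f z‖ ≤ log⁺ ‖QQ f z‖
    rw [posLog_apply]; exact le_max_right _ _
  have hsub : ZP f ∩ closedBall 0 R ⊆ ((S ∪ insert 0 P : Finset ℂ) : Set ℂ) := by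
    rintro z hz
    by_cases him : z.im = 0
    · by_cases hz0 : z = 0
      · simp [hz0]
      · simp only [Finset.coe_union, Set.mem_union, Finset.mem_coe]
        left
        simp only [hS, Finset.mem_filter, Set.Finite.mem_toFinset]
        exact ⟨hz, him, hz0⟩
    · have := k.core.zp_nonreal hz.1 him
      simp [this]
  have hc := Set.ncard_le_ncard hsub (Finset.finite_toSet _)
  rw [Set.ncard_coe_finset] at hc
  have hc2 := (hc.trans (Finset.card_union_le _ _)).trans (Nat.add_le_add_left (Finset.card_insert_le _ _) _)
  have hc3 : ((ZP f ∩ closedBall 0 R).ncard : ℝ) ≤ S.card + (P.card + 1) := by exact_mod_cast hc2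
  have hlog : 1 + Real.log t ≤ 4 * R := by
    have := Real.log_le_sub_one_of_pos (x := t) (by linarith)
    linarith
  have := mul_le_mul_of_nonneg_left hlog c1
  have hPR : (P.card : ℝ) + 1 ≤ (P.card + 1) * R := by
    have : (0:ℝ) ≤ P.card := by positivity
    nlinarith
  nlinarith

/-- linear counting -/
lemma Core.lin (h : Core f P) : LinCount f := by
  obtain ⟨b, c0, n, hb, hK⟩ := h.K
  by_cases hne : ∀ z, ∀ᶠ w in 𝓝[≠] z, KK b c0 n P w = 1
  · refine KOne.lin (P := P) ⟨h, fun z => ?_⟩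
    filter_upwards [hK z, hne z] with w h1 h2
    rw [h1, h2, one_mul]
  · exact KData.lin_of_ne ⟨h, hb, hK⟩ hne

end NV

open Complex Filter Topology MeasureTheory
open scoped Classical

namespace NV
open Metric Real Bornology

variable {f : ℂ → ℂ} {P : Finset ℂ}

lemma lin_bound {g : ℝ → ℝ} {C : ℝ} (hg : ∀ t, 1 ≤ t → 0 ≤ g t ∧ g t ≤ C * t) (hC : 0 ≤ C) {r : ℝ} (hr : 1 ≤ r) :
    ∫ t in (1:ℝ)..r, g t / t ≤ C * r := by
  have h1 : ‖∫ t in (1:ℝ)..r, g t / t‖ ≤ C * |r - 1| := by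
    apply intervalIntegral.norm_integral_le_of_norm_le_const
    intro t ht
    rw [Set.uIoc_of_le hr] at ht
    have h2 := hg t ht.1.le
    have h3 : 0 < t := by linarith [ht.1]
    rw [Real.norm_of_nonneg (div_nonneg h2.1 h3.le), div_le_iff₀ h3]
    exact h2.2
  rw [abs_of_nonneg (by linarith)] at h1
  have h4 := Real.le_norm_self (∫ t in (1:ℝ)..r, g t / t)
  nlinarith

lemma ord_LL (hm : ∀ z, MeromorphicAt f z) (hne : ∀ z, meromorphicOrderAt f z ≠ ⊤) (x : ℂ) :
    -1 ≤ meromorphicOrderAt (LL f) x ∧ (x ∉ ZP f → 0 ≤ meromorphicOrderAt (LL f) x) := by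
  obtain ⟨n, hn⟩ := WithTop.ne_top_iff_exists.1 (hne x)
  obtain ⟨k, hk, he⟩ := logderiv_form (hm x) hn.symm
  constructor
  · have e : LL f =ᶠ[𝓝[≠] x] (fun z => z - x)⁻¹ * (fun z => n + (z - x) * k z) := by
      filter_upwards [he, self_mem_nhdsWithin] with z h1 h2
      have h3 : z - x ≠ 0 := sub_ne_zero.2 h2
      simp only [LL, h1, Pi.mul_apply, Pi.inv_apply]
      field_simp
    have ha : AnalyticAt ℂ (fun z => (n:ℂ) + (z - x) * k z) x := by fun_prop
    have hs : AnalyticAt ℂ (fun z : ℂ => z - x) x := by fun_prop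
    have ho : meromorphicOrderAt (fun z : ℂ => z - x) x = ((1:ℤ) : WithTop ℤ) := by
      rw [meromorphicOrderAt_eq_int_iff hs.meromorphicAt]
      exact ⟨fun _ => 1, analyticAt_const, one_ne_zero, by simp⟩
    rw [meromorphicOrderAt_congr e, meromorphicOrderAt_mul hs.meromorphicAt.inv ha.meromorphicAt, meromorphicOrderAt_inv, ho]
    have h5 : 0 ≤ meromorphicOrderAt (fun z => (n:ℂ) + (z - x) * k z) x := ha.meromorphicOrderAt_nonneg
    calc (-1 : WithTop ℤ) = -((1:ℤ) : WithTop ℤ) + 0 := by rw [add_zero]; rfl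
      _ ≤ _ := by gcongr
  · intro hx
    have hn0 : n = 0 := by
      have : meromorphicOrderAt f x = 0 := by by_contra h; exact hx h
      rw [this] at hn; exact_mod_cast hn
    have e : LL f =ᶠ[𝓝[≠] x] k := by
      filter_upwards [he] with z h1
      simp [LL, h1, hn0]
    rw [meromorphicOrderAt_congr e]
    exact hk.meromorphicOrderAt_nonneg

lemma logc_le (h : Core f P) : ∃ C : ℝ, 0 ≤ C ∧ ∀ t, 3 ≤ t →
    ValueDistribution.logCounting (LL f) ⊤ t ≤ C * (t * Real.log t) := by
  obtain ⟨C, hC, hl⟩ := h.lin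
  have hL : MeromorphicOn (LL f) Set.univ := fun z _ => h.meroL z
  set K : ℝ := ∑ u ∈ (zp_fin h.mero h.ne 1).toFinset, |Real.log ‖u‖| with hK
  have hK0 : 0 ≤ K := Finset.sum_nonneg fun _ _ => abs_nonneg _
  refine ⟨C + K + 1, by positivity, fun t ht => ?_⟩
  have ht0 : 0 < t := by linarith
  have hlt : 1 ≤ Real.log t := by
    rw [Real.le_log_iff_exp_le ht0]
    linarith [Real.exp_one_lt_d9]
  rw [ValueDistribution.logCounting_top]
  set D := (MeromorphicOn.divisor (LL f) Set.univ)⁻ with hD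
  have hDv : ∀ u, D u = max (-(meromorphicOrderAt (LL f) u).untop₀) 0 := by
    intro u
    rw [hD, Function.locallyFinsuppWithin.negPart_apply, MeromorphicOn.divisor_apply hL trivial]
    rfl
  have hD0 : ∀ u, 0 ≤ D u := fun u => by rw [hDv]; exact le_max_right _ _
  have hD1 : ∀ u, D u ≤ 1 := fun u => by
    rw [hDv]
    refine max_le ?_ (by norm_num)
    have h1 := (ord_LL h.mero h.ne u).1
    rcases eq_or_ne (meromorphicOrderAt (LL f) u) ⊤ with h2 | h2
    · rw [h2]; simp
    · obtain ⟨m, hm⟩ := WithTop.ne_top_iff_exists.1 h2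
      rw [← hm] at h1 ⊢
      have : ((-1:ℤ) : WithTop ℤ) ≤ m := h1
      have := WithTop.coe_le_coe.1 this
      simp; linarith
  have hDz : ∀ u ∉ ZP f, D u = 0 := fun u hu => by
    rw [hDv]
    apply max_eq_right
    have := WithTop.untop₀_nonneg.2 ((ord_LL h.mero h.ne u).2 hu)
    linarith
  set S := (zp_fin h.mero h.ne t).toFinset with hS
  have hcard : (S.card : ℝ) ≤ C * t := by
    rw [hS, ← Set.ncard_eq_toFinset_card _ (zp_fin h.mero h.ne t)]; exact hl t (by linarith)
  have hev : ∀ u ∈ closedBall (0:ℂ) t, D.toClosedBall t u = D u := fun u hu =>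
    Function.locallyFinsuppWithin.toClosedBall_eval_within D (by rwa [abs_of_pos ht0])
  have hout : ∀ u ∉ closedBall (0:ℂ) t, D.toClosedBall t u = 0 := fun u hu => by
    by_contra h0
    have := Function.locallyFinsuppWithin.toClosedBall_support_subset_closedBall D h0
    rw [abs_of_pos ht0] at this
    exact hu this
  change ∑ᶠ z, (D.toClosedBall t z : ℝ) * Real.log (t * ‖z‖⁻¹) + (D 0 : ℝ) * Real.log t ≤ _
  rw [finsum_eq_sum_of_support_subset (s := S)]
  swap
  · intro u hu
    rw [Function.mem_support] at hu
    rw [hS, Set.Finite.coe_toFinset]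
    have hb : u ∈ closedBall (0:ℂ) t := by
      by_contra h0; apply hu; rw [hout u h0]; simp
    refine ⟨?_, hb⟩
    by_contra h0; apply hu; rw [hev u hb, hDz u h0]; simp
  have hterm : ∀ u ∈ S, (D.toClosedBall t u : ℝ) * Real.log (t * ‖u‖⁻¹) ≤
      Real.log t + if u ∈ closedBall (0:ℂ) 1 then |Real.log ‖u‖| else 0 := by
    intro u hu
    rw [hS, Set.Finite.mem_toFinset] at hu
    rw [hev u hu.2]
    have a0 : (0:ℝ) ≤ D u := by exact_mod_cast hD0 u
    have a1 : (D u : ℝ) ≤ 1 := by exact_mod_cast hD1 u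
    have b : Real.log (t * ‖u‖⁻¹) ≤ Real.log t + if u ∈ closedBall (0:ℂ) 1 then |Real.log ‖u‖| else 0 := by
      rcases eq_or_ne u 0 with rfl | hu0
      · simp; linarith
      rw [Real.log_mul ht0.ne' (by simpa using hu0), Real.log_inv]
      split_ifs with h1
      · linarith [neg_abs_le (Real.log ‖u‖)]
      · have : 1 < ‖u‖ := by simpa using h1
        linarith [Real.log_nonneg this.le]
    have c : 0 ≤ Real.log t + if u ∈ closedBall (0:ℂ) 1 then |Real.log ‖u‖| else 0 := by
      split_ifs
      · linarith [abs_nonneg (Real.log ‖u‖)]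
      · linarith
    calc _ ≤ (D u : ℝ) * (Real.log t + if u ∈ closedBall (0:ℂ) 1 then |Real.log ‖u‖| else 0) :=
          mul_le_mul_of_nonneg_left b a0
      _ ≤ _ := mul_le_of_le_one_left c a1
  have hsum := Finset.sum_le_sum hterm
  rw [Finset.sum_add_distrib, Finset.sum_const, nsmul_eq_mul, ← Finset.sum_filter] at hsum
  have hK1 : ∑ u ∈ S.filter (· ∈ closedBall (0:ℂ) 1), |Real.log ‖u‖| ≤ K := by
    refine Finset.sum_le_sum_of_subset_of_nonneg (fun u hu => ?_) fun _ _ _ => abs_nonneg _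
    rw [Finset.mem_filter, hS, Set.Finite.mem_toFinset] at hu
    rw [Set.Finite.mem_toFinset]
    exact ⟨hu.1.1, hu.2⟩
  have h5 : (D 0 : ℝ) * Real.log t ≤ Real.log t :=
    mul_le_of_le_one_left (by linarith) (by exact_mod_cast hD1 0)
  have h6 : (S.card : ℝ) * Real.log t ≤ C * t * Real.log t := mul_le_mul_of_nonneg_right hcard (by linarith)
  have h7 : Real.log t ≤ t * Real.log t := le_mul_of_one_le_left (by linarith) (by linarith)
  have h8 : K ≤ K * (t * Real.log t) := le_mul_of_one_le_right hK0 (by linarith)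
  have h9 : (C + K + 1) * (t * Real.log t) = C * t * Real.log t + K * (t * Real.log t) + t * Real.log t := by ring
  rw [h9]
  linarith

lemma Core.mL (h : Core f P) : ∃ C R₀ : ℝ, 0 ≤ C ∧ ∀ R, R₀ ≤ R →
    circleAverage (fun z => log⁺ ‖LL f z‖) 0 R ≤ C * (R * Real.log R) := by
  obtain ⟨C1, R1, hC1, g⟩ := h.good1
  obtain ⟨C2, hC2, g2⟩ := logc_le h
  refine ⟨C1 + 4 * C2, max R1 3, by positivity, fun R hR => ?_⟩
  have hR1 := (le_max_left _ _).trans hR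
  have hR3 := (le_max_right R1 3).trans hR
  obtain ⟨t, t1, t2, t3⟩ := g R hR1
  have hlR : 0 ≤ Real.log R := Real.log_nonneg (by linarith)
  have hmono := ValueDistribution.characteristic_monotoneOn (f := LL f) (fun z => h.meroL z)
    (show R ∈ Set.Ioi 0 from by simp; linarith) (show t ∈ Set.Ioi 0 from by simp; linarith) t1.le
  simp only [ValueDistribution.characteristic, Pi.add_apply, ValueDistribution.proximity_top] at hmono
  have hnn : 0 ≤ ValueDistribution.logCounting (LL f) ⊤ R := by
    rw [ValueDistribution.logCounting_top]
    exact Function.locallyFinsuppWithin.logCounting_nonneg (negPart_nonneg _) (by linarith)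
  have h1 : circleAverage (fun z => log⁺ ‖LL f z‖) 0 t ≤ circleAverage (FF f) 0 t := by
    refine circleAverage_mono (ci_pl h.meroL t) (h.ciF t) fun z _ => ?_
    simp only [FF]
    have := posLog_nonneg (x := ‖AA f z‖)
    have := posLog_nonneg (x := ‖(AA f z)⁻¹‖)
    have := posLog_nonneg (x := ‖AA (NV.til f) z‖)
    have := posLog_nonneg (x := ‖(AA (NV.til f) z)⁻¹‖)
    have := posLog_nonneg (x := ‖LL (NV.til f) z‖)
    linarith
  have h2 := g2 t (by linarith)
  have h3 : t * Real.log t ≤ 4 * (R * Real.log R) := by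
    have e : Real.log t ≤ 2 * Real.log R := by
      have : Real.log t ≤ Real.log (R ^ 2) := Real.log_le_log (by linarith) (by nlinarith)
      rwa [Real.log_pow, Nat.cast_ofNat] at this
    have e2 : 0 ≤ Real.log t := Real.log_nonneg (by linarith)
    calc t * Real.log t ≤ (2 * R) * (2 * Real.log R) := mul_le_mul t2.le e e2 (by linarith)
      _ = _ := by ring
  have h4 := mul_le_mul_of_nonneg_left h3 hC2
  have h5 : (C1 + 4 * C2) * (R * Real.log R) = C1 * (R * Real.log R) + C2 * (4 * (R * Real.log R)) := by ring
  rw [h5]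
  linarith

end NV

namespace NV
open Metric Real Bornology

lemma nonreal_exists (S : Set ℂ) (hS : {z : ℂ | z ∈ S ∧ z.im ≠ 0}.Finite) : ∃ z, z ∉ S := by
  by_contra h
  push Not at h
  have hinf : (Set.range fun n : ℕ => (n : ℂ) + I).Infinite :=
    Set.infinite_range_of_injective fun a b hab => by simpa using hab
  refine hinf (hS.subset ?_)
  rintro _ ⟨n, rfl⟩
  exact ⟨h _, by simp⟩

lemma core_exists (f : ℂ → ℂ) (hmero : ∀ z, MeromorphicAt f z)
    (hsnr : StrictlyNonReal f)
    (hzp : {z : ℂ | (0 < meroOrder f z ∨ meroOrder f z < 0) ∧ z.im ≠ 0}.Finite)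
    (hzp'' : {z : ℂ | (0 < meroOrder (iteratedDeriv 2 f) z ∨
        meroOrder (iteratedDeriv 2 f) z < 0) ∧ z.im ≠ 0}.Finite) :
    ∃ (F : ℂ → ℂ) (P : Finset ℂ), (∀ z, F =ᶠ[𝓝[≠] z] f) ∧ Core F P := by
  have hM : MeromorphicOn f Set.univ := fun z _ => hmero z
  set F := toMeromorphicNFOn f Set.univ with hF
  have heq : ∀ z, F =ᶠ[𝓝[≠] z] f := fun z => hM.toMeromorphicNFOn_eq_self_on_nhdsNE (Set.mem_univ z)
  have hnf : ∀ z, MeromorphicNFAt F z := fun z => meromorphicNFOn_toMeromorphicNFOn f Set.univ (Set.mem_univ z)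
  have hi : iteratedDeriv 2 f = deriv (deriv f) := by
    rw [iteratedDeriv_succ, iteratedDeriv_one]
  have hm2 : ∀ z, MeromorphicAt (deriv (deriv f)) z := fun z => (hmero z).deriv.deriv
  have heq2 : ∀ z, deriv (deriv F) =ᶠ[𝓝[≠] z] deriv (deriv f) := fun z =>
    EventuallyEq.nhdsNE_deriv (EventuallyEq.nhdsNE_deriv (heq z))
  have o1 : ∀ z, meroOrder f z = meromorphicOrderAt F z := fun z => by
    rw [meroOrder, dif_pos (hmero z), meromorphicOrderAt_congr (heq z)]
  have o2 : ∀ z, meroOrder (iteratedDeriv 2 f) z = meromorphicOrderAt (deriv (deriv F)) z := fun z => by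
    rw [hi, meroOrder, dif_pos (hm2 z), meromorphicOrderAt_congr (heq2 z)]
  simp only [o1] at hzp
  simp only [o2] at hzp''
  have hmF : ∀ z, MeromorphicAt F z := fun z => (hnf z).meromorphicAt
  have n1 : ∀ z, meromorphicOrderAt F z ≠ ⊤ := by
    obtain ⟨z0, h0⟩ := nonreal_exists {z | 0 < meromorphicOrderAt F z ∨ meromorphicOrderAt F z < 0} hzp
    intro z hz
    apply h0
    left
    rw [mero_top hmF hz z0]; simp
  have n2 : ∀ z, meromorphicOrderAt (deriv (deriv F)) z ≠ ⊤ := by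
    obtain ⟨z0, h0⟩ := nonreal_exists {z | 0 < meromorphicOrderAt (deriv (deriv F)) z ∨
      meromorphicOrderAt (deriv (deriv F)) z < 0} hzp''
    intro z hz
    apply h0
    left
    rw [mero_top (fun z => (hmF z).deriv.deriv) hz z0]; simp
  set E := hzp.toFinset ∪ hzp''.toFinset with hE
  have hEim : ∀ z ∈ E, z.im ≠ 0 := by
    intro z hz
    simp only [hE, Finset.mem_union, Set.Finite.mem_toFinset] at hz
    rcases hz with hz | hz
    · exact hz.2
    · exact hz.2
  refine ⟨F, E ∪ E.image (starRingEnd ℂ), heq, hnf, n1, n2, ?_, ?_, ?_, ?_⟩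
  · intro z hz
    simp only [Finset.mem_union, Finset.mem_image] at hz ⊢
    rcases hz with hz | ⟨w, hw, rfl⟩
    · exact Or.inr ⟨z, hz, rfl⟩
    · left; simpa using hw
  · intro z hz
    simp only [Finset.mem_union, Finset.mem_image] at hz
    rcases hz with hz | ⟨w, hw, rfl⟩
    · exact hEim z hz
    · simpa using hEim w hw
  · intro z him hz
    have hz' : z ∉ E := fun h => hz (Finset.mem_union_left _ h)
    simp only [hE, Finset.mem_union, Set.Finite.mem_toFinset, not_or] at hz'
    have a1 : meromorphicOrderAt F z = 0 := by
      by_contra h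
      exact hz'.1 ⟨(lt_or_gt_of_ne h).symm, him⟩
    have a2 : meromorphicOrderAt (deriv (deriv F)) z = 0 := by
      by_contra h
      exact hz'.2 ⟨(lt_or_gt_of_ne h).symm, him⟩
    have b1 : AnalyticAt ℂ F z := ((hnf z).meromorphicOrderAt_nonneg_iff_analyticAt).1 a1.ge
    exact ⟨b1, ((hnf z).meromorphicOrderAt_eq_zero_iff).1 a1,
      (b1.deriv.deriv.meromorphicNFAt.meromorphicOrderAt_eq_zero_iff).1 a2⟩
  · rintro ⟨c, hc⟩
    refine hsnr ⟨c, fun z => ?_⟩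
    have ht : Tendsto (starRingEnd ℂ) (𝓝[≠] z) (𝓝[≠] ((starRingEnd ℂ) z)) := by
      refine tendsto_nhdsWithin_iff.2 ⟨(Complex.continuous_conj.tendsto z).mono_left nhdsWithin_le_nhds, ?_⟩
      filter_upwards [self_mem_nhdsWithin] with w hw
      exact fun h => hw ((starRingEnd ℂ).injective h)
    filter_upwards [hc z, heq z, ht.eventually (heq ((starRingEnd ℂ) z))] with w h1 h2 h3
    rw [h2] at h1
    rw [← h1]
    simp only [mtilde, til, h3]

lemma dc_le {f F : ℂ → ℂ} (hmero : ∀ z, MeromorphicAt F z) (hne : ∀ z, meromorphicOrderAt F z ≠ ⊤)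
    {C : ℝ} (hl : ∀ t, 1 ≤ t → ((ZP F ∩ closedBall 0 t).ncard : ℝ) ≤ C * t) {S : Set ℂ} (hS : S ⊆ ZP F)
    (t : ℝ) (ht : 1 ≤ t) : 0 ≤ distinctCount S t ∧ distinctCount S t ≤ C * t := by
  refine ⟨Nat.cast_nonneg _, le_trans ?_ (hl t ht)⟩
  simp only [distinctCount]
  exact_mod_cast Set.ncard_le_ncard (Set.inter_subset_inter_left _ hS) (zp_fin hmero hne t)

lemma pc_le {f F : ℂ → ℂ} (hmero : ∀ z, MeromorphicAt F z) (hne : ∀ z, meromorphicOrderAt F z ≠ ⊤)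
    (ho : ∀ z, meroOrder f z = meromorphicOrderAt (LL F) z)
    {C : ℝ} (hl : ∀ t, 1 ≤ t → ((ZP F ∩ closedBall 0 t).ncard : ℝ) ≤ C * t)
    (t : ℝ) (ht : 1 ≤ t) : 0 ≤ poleCount f t ∧ poleCount f t ≤ C * t := by
  have h1 : ∀ z, poleMult f z ≤ 1 := fun z => by
    simp only [poleMult, ho]
    have h1 := (ord_LL hmero hne z).1
    rcases eq_or_ne (meromorphicOrderAt (LL F) z) ⊤ with h2 | h2
    · rw [h2]; simp
    · obtain ⟨m, hm⟩ := WithTop.ne_top_iff_exists.1 h2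
      rw [← hm] at h1 ⊢
      have : ((-1:ℤ) : WithTop ℤ) ≤ m := h1
      have := WithTop.coe_le_coe.1 this
      simp only [WithTop.untopD_coe]
      omega
  have h0 : ∀ z ∉ ZP F, poleMult f z = 0 := fun z hz => by
    simp only [poleMult, ho]
    have h1 := (ord_LL hmero hne z).2 hz
    rcases eq_or_ne (meromorphicOrderAt (LL F) z) ⊤ with h2 | h2
    · rw [h2]; simp
    · obtain ⟨m, hm⟩ := WithTop.ne_top_iff_exists.1 h2
      rw [← hm] at h1 ⊢
      have : ((0:ℤ) : WithTop ℤ) ≤ m := h1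
      have := WithTop.coe_le_coe.1 this
      simp only [WithTop.untopD_coe]
      omega
  have hfin := zp_fin hmero hne t
  have e : poleCount f t = ∑ z ∈ hfin.toFinset, (poleMult f z : ℝ) := by
    simp only [poleCount]
    apply finsum_mem_eq_sum_of_inter_support_eq
    ext z
    simp only [Set.mem_inter_iff, Set.Finite.coe_toFinset, Function.mem_support]
    constructor
    · rintro ⟨a, b⟩
      refine ⟨⟨?_, a⟩, b⟩
      by_contra h
      exact b (by rw [h0 z h]; simp)
    · rintro ⟨⟨_, a⟩, b⟩
      exact ⟨a, b⟩
  rw [e]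
  refine ⟨Finset.sum_nonneg fun _ _ => Nat.cast_nonneg _, le_trans ?_ (hl t ht)⟩
  rw [Set.ncard_eq_toFinset_card _ hfin]
  calc _ ≤ ∑ z ∈ hfin.toFinset, (1:ℝ) := Finset.sum_le_sum fun z _ => by exact_mod_cast h1 z
    _ = _ := by simp

lemma prox_eq (h : ℂ → ℂ) (r : ℝ) : proximity h r = circleAverage (fun z => log⁺ ‖h z‖) 0 r := by
  simp only [proximity, circleAverage, smul_eq_mul, circleMap, zero_add, logPlus, posLog_apply]
  simp only [max_comm]

end NV

/-- Let `f` be a strictly non-real meromorphic function in the plane such that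
all but finitely many zeros and poles of `f` and of `f''` are real.  Then, as `r` tends to
infinity, `Nbar(r, f) + Nbar(r, 1/f) = O(r)` and `T(r, f'/f) = O(r log r)`. -/
theorem statement_3 (f : ℂ → ℂ) (hmero : ∀ z, MeromorphicAt f z)
    (hsnr : StrictlyNonReal f)
    (hzp : {z : ℂ | (0 < meroOrder f z ∨ meroOrder f z < 0) ∧ z.im ≠ 0}.Finite)
    (hzp'' : {z : ℂ | (0 < meroOrder (iteratedDeriv 2 f) z ∨
        meroOrder (iteratedDeriv 2 f) z < 0) ∧ z.im ≠ 0}.Finite) :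
    (∃ C : ℝ, ∀ᶠ r in atTop, NbarPoles f r + NbarZeros f r ≤ C * r) ∧
    (∃ C : ℝ, ∀ᶠ r in atTop, TChar (fun z => deriv f z / f z) r ≤ C * (r * Real.log r)) := by

  obtain ⟨F, P, heq, h⟩ := NV.core_exists f hmero hsnr hzp hzp''
  obtain ⟨C, hC, hl⟩ := h.lin
  have o1 : ∀ z, meroOrder f z = meromorphicOrderAt F z := fun z => by
    rw [meroOrder, dif_pos (hmero z), meromorphicOrderAt_congr (heq z)]
  have eL : ∀ z, (fun z => deriv f z / f z) =ᶠ[𝓝[≠] z] NV.LL F := fun z => by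
    filter_upwards [heq z, EventuallyEq.nhdsNE_deriv (heq z)] with w h1 h2
    simp only [NV.LL, h1, h2]
  have oL : ∀ z, meroOrder (fun z => deriv f z / f z) z = meromorphicOrderAt (NV.LL F) z := fun z => by
    rw [meroOrder, dif_pos ((hmero z).deriv.fun_div (hmero z)), meromorphicOrderAt_congr (eL z)]
  constructor
  · refine ⟨C + C, ?_⟩
    filter_upwards [eventually_ge_atTop 1] with r hr
    have a1 : NbarPoles f r ≤ C * r := NV.lin_bound (fun t ht => NV.dc_le (f := f) h.mero h.ne hl (fun z hz => by
      have hz' : meroOrder f z < 0 := hz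
      rw [o1] at hz'
      exact ne_of_lt hz') t ht) hC hr
    have a2 : NbarZeros f r ≤ C * r := NV.lin_bound (fun t ht => NV.dc_le (f := f) h.mero h.ne hl (fun z hz => by
      have hz' : 0 < meroOrder f z := hz
      rw [o1] at hz'
      exact ne_of_gt hz') t ht) hC hr
    linarith
  · obtain ⟨C', R₀, hC', hm⟩ := h.mL
    refine ⟨C + C', ?_⟩
    filter_upwards [eventually_ge_atTop 3, eventually_ge_atTop R₀] with r hr hr0
    have a1 : NCount (fun z => deriv f z / f z) r ≤ C * r :=
      NV.lin_bound (fun t ht => NV.pc_le h.mero h.ne oL hl t ht) hC (by linarith)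
    have a2 : proximity (fun z => deriv f z / f z) r ≤ C' * (r * Real.log r) := by
      rw [NV.prox_eq]
      refine le_of_eq_of_le (Real.circleAverage_congr_codiscreteWithin ?_ (by linarith)) (hm r hr0)
      refine NV.sphere_cod (U := Set.univ) (Set.subset_univ _) ?_
      rw [NV.ev_open_iff isOpen_univ]
      intro x _
      filter_upwards [eL x] with z hz
      rw [← hz]
    have hlr : 1 ≤ Real.log r := by
      rw [Real.le_log_iff_exp_le (by linarith)]
      linarith [Real.exp_one_lt_d9]
    have a3 : C * r ≤ C * (r * Real.log r) :=
      mul_le_mul_of_nonneg_left (le_mul_of_one_le_right (by linarith) hlr) hC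
    simp only [TChar]
    rw [add_mul]
    linarith
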